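/- arXiv:0904.2443 — 3 statements merged into one kernel-verified Lean document; each statement's English description precedes it below -/
import Mathlib

section
/- Let f ∈ E_rad be nonzero and φ = φ_f. For every ℓ > 0, the map e ↦ a_φ(e,ℓ) is a strictly increasing C¹ diffeomorphism from (e_{φ,ℓ}, 0) onto (0, ∞), and its derivative is ∂a_φ/∂e (e,ℓ) = 4π²√2 ∫_{r₁(φ,e,ℓ)}^{r₂(φ,e,ℓ)} (e − ψ_{φ,ℓ}(r))^{−1/2} dr > 0 for every e ∈ (e_{φ,ℓ}, 0). -/
noncomputable section

open MeasureTheory Real Filter Set Topology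
open scoped ENNReal NNReal

abbrev E3 : Type := EuclideanSpace ℝ (Fin 3)
abbrev Phase : Type := E3 × E3

/-- Spherical symmetry: invariance under all rotations of `ℝ³` acting jointly on `x` and `v`. -/
def SphSym (f : Phase → ℝ) : Prop :=
  ∀ R : E3 ≃ₗᵢ[ℝ] E3, LinearMap.det (R.toLinearEquiv : E3 →ₗ[ℝ] E3) = 1 →
    ∀ z : Phase, f (R z.1, R z.2) = f z

/-- `|x × v|²`, via the Lagrange identity. -/
def ellOf (z : Phase) : ℝ := ‖z.1‖ ^ 2 * ‖z.2‖ ^ 2 - (inner ℝ z.1 z.2 : ℝ) ^ 2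

/-- Spatial density. -/
def rhoF (f : Phase → ℝ) (x : E3) : ℝ := ∫ v : E3, f (x, v)

/-- Poisson field. -/
def phiF (f : Phase → ℝ) (x : E3) : ℝ := - ∫ y : E3, rhoF f y / (4 * π * ‖x - y‖)

/-- Radial representation of the Poisson field. -/
def phiRad (f : Phase → ℝ) (r : ℝ) : ℝ :=
  phiF f (r • (EuclideanSpace.single (0 : Fin 3) (1:ℝ)))

def mass (f : Phase → ℝ) : ℝ := ∫ z : Phase, f z

def kineticE (f : Phase → ℝ) : ℝ := ∫ z : Phase, ‖z.2‖ ^ 2 * f z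

def gradPhi (f : Phase → ℝ) (x : E3) : E3 := gradient (phiF f) x

def fieldSq (f : Phase → ℝ) : ℝ := ∫ x : E3, ‖gradPhi f x‖ ^ 2

/-- `L²` distance between the force fields of `f` and `g`. -/
def fieldDist (f g : Phase → ℝ) : ℝ :=
  Real.sqrt (∫ x : E3, ‖gradPhi f x - gradPhi g x‖ ^ 2)

/-- The Hamiltonian. -/
def Ham (f : Phase → ℝ) : ℝ := kineticE f / 2 - fieldSq f / 2

/-- The norm of the energy space. -/
def eNormE (f : Phase → ℝ) : ℝ≥0∞ :=
  eLpNorm f 1 volume + eLpNorm f ⊤ volume +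
    ∫⁻ z : Phase, (‖z.2‖₊ : ℝ≥0∞) ^ 2 * (‖f z‖₊ : ℝ≥0∞)

def memE (f : Phase → ℝ) : Prop := Measurable f ∧ (∀ z, 0 ≤ f z) ∧ eNormE f < ⊤

def memErad (f : Phase → ℝ) : Prop := memE f ∧ SphSym f

/-- Density of the measure `ν_ℓ`. -/
def nuDens (ℓ : ℝ) (p : ℝ × ℝ) : ℝ≥0∞ :=
  if 0 < p.1 ∧ ℓ < p.1 ^ 2 * p.2 ^ 2 then
    ENNReal.ofReal (4 * π ^ 2 * p.1 * |p.2| / Real.sqrt (p.1 ^ 2 * p.2 ^ 2 - ℓ))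
  else 0

def nuMeas (ℓ : ℝ) : Measure (ℝ × ℝ) := volume.withDensity (nuDens ℓ)

/-- Representative phase point with `|x| = r`, `|v| = |u|`, `|x×v|² = ℓ` and
`x·v = sign u · √(r²u²-ℓ)`. -/
def radPoint (r u ℓ : ℝ) : Phase :=
  (r • (EuclideanSpace.single (0 : Fin 3) (1:ℝ)),
   (Real.sign u * Real.sqrt (r ^ 2 * u ^ 2 - ℓ) / r) • (EuclideanSpace.single (0 : Fin 3) (1:ℝ))
     + (Real.sqrt ℓ / r) • (EuclideanSpace.single (1 : Fin 3) (1:ℝ)))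

/-- Distribution function of `f` at kinetic momentum `ℓ`. -/
def muDist (f : Phase → ℝ) (s ℓ : ℝ) : ℝ≥0∞ :=
  nuMeas ℓ {p : ℝ × ℝ | s < f (radPoint p.1 p.2 ℓ)}

/-- `g ∈ Eq(f)` : `g` is nonnegative, spherically symmetric and equimeasurable to `f`
at (almost) every kinetic momentum `ℓ`. -/
def EqMeas (f g : Phase → ℝ) : Prop :=
  (∀ z, 0 ≤ g z) ∧ SphSym g ∧
    ∀ s : ℝ, 0 < s →
      ∀ᵐ ℓ ∂(volume.restrict (Ioi (0:ℝ))), muDist g s ℓ = muDist f s ℓ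

/-- Schwarz symmetrization of `f` at fixed `ℓ`. -/
def schwarz (f : Phase → ℝ) (t ℓ : ℝ) : ℝ :=
  if ENNReal.ofReal t < muDist f 0 ℓ then
    sSup {s : ℝ | 0 ≤ s ∧ ENNReal.ofReal t < muDist f s ℓ}
  else 0

/-- Effective potential. -/
def psiPot (φ : ℝ → ℝ) (ℓ r : ℝ) : ℝ := φ r + ℓ / (2 * r ^ 2)

def eMinPot (φ : ℝ → ℝ) (ℓ : ℝ) : ℝ := sInf (psiPot φ ℓ '' Ioi 0)

def r1Pot (φ : ℝ → ℝ) (e ℓ : ℝ) : ℝ := sInf {r : ℝ | 0 < r ∧ psiPot φ ℓ r < e}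

def r2Pot (φ : ℝ → ℝ) (e ℓ : ℝ) : ℝ := sSup {r : ℝ | 0 < r ∧ psiPot φ ℓ r < e}

/-- The Jacobian `a_φ(e, ℓ)` (meaningful for `e < 0`). -/
def aPot (φ : ℝ → ℝ) (e ℓ : ℝ) : ℝ :=
  8 * π ^ 2 * Real.sqrt 2 * ∫ r in Ioi (0:ℝ), Real.sqrt (max (e - psiPot φ ℓ r) 0)

/-- Inverse of the bijection `e ↦ a_φ(e,ℓ)` from `(e_{φ,ℓ},0)` onto `(0,∞)`. -/
def aPotInv (φ : ℝ → ℝ) (s ℓ : ℝ) : ℝ :=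
  sSup {e : ℝ | eMinPot φ ℓ < e ∧ e < 0 ∧ aPot φ e ℓ < s}

/-- Microscopic energy w.r.t. the Poisson field of `g`. -/
def microE (g : Phase → ℝ) (z : Phase) : ℝ := ‖z.2‖ ^ 2 / 2 + phiF g z.1

/-- Rearrangement of `f` with respect to the microscopic energy of the field of `g`. -/
def rearr (f g : Phase → ℝ) (z : Phase) : ℝ :=
  if microE g z < 0 then
    schwarz f (aPot (phiRad g) (microE g z) (ellOf z)) (ellOf z)
  else 0

/-- Assumption (A). -/
structure AssumptionA (Q : Phase → ℝ) (F : ℝ → ℝ → ℝ) (e₀ : ℝ) : Prop where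
  contQ : Continuous Q
  nonneg : ∀ z, 0 ≤ Q z
  nonzero : Q ≠ 0
  cpt : HasCompactSupport Q
  sph : SphSym Q
  eqF : ∀ z : Phase, Q z = F (microE Q z) (ellOf z)
  Fnonneg : ∀ e ℓ, 0 ≤ ℓ → 0 ≤ F e ℓ
  Fcont : ContinuousOn (fun p : ℝ × ℝ => F p.1 p.2) {p : ℝ × ℝ | 0 ≤ p.2}
  e₀neg : e₀ < 0
  Fsupp : ∀ e ℓ, 0 ≤ ℓ → 0 < F e ℓ → e < e₀
  FC1 : ContDiffOn ℝ 1 (fun p : ℝ × ℝ => F p.1 p.2) {p : ℝ × ℝ | 0 ≤ p.2 ∧ 0 < F p.1 p.2}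
  FeNeg : ∀ e ℓ, 0 ≤ ℓ → 0 < F e ℓ → deriv (fun e' => F e' ℓ) e < 0

/-- The reduced functional `J_{f^*}(φ_g) = H(f^{*φ_g}) + ½|∇φ_g − ∇φ_{f^{*φ_g}}|²`. -/
def Jred (f g : Phase → ℝ) : ℝ :=
  Ham (rearr f g) + (∫ x : E3, ‖gradPhi g x - gradPhi (rearr f g) x‖ ^ 2) / 2

def distL1 (f g : Phase → ℝ) : ℝ := ∫ z : Phase, |f z - g z|

def distL1v (f g : Phase → ℝ) : ℝ := ∫ z : Phase, ‖z.2‖ ^ 2 * |f z - g z|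

namespace Aux8

lemma one_div_sqrt (x : ℝ) : 1/√x = x^(-(1/2):ℝ) := by
  rcases lt_trichotomy x 0 with h|h|h
  · rw [Real.rpow_def_of_neg h, Real.sqrt_eq_zero_of_nonpos h.le]
    have : cos (-(1/2) * π) = 0 := by
      rw [neg_mul, Real.cos_neg, one_div_mul_eq_div, Real.cos_pi_div_two]
    rw [this]; simp
  · subst h; rw [Real.zero_rpow (by norm_num)]; simp
  · rw [Real.rpow_neg h.le, Real.sqrt_eq_rpow, one_div]

structure WP (g : ℝ → ℝ) (u0 M B c δ : ℝ) : Prop where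
  cvx : ConvexOn ℝ (Ioi 0) g
  u0pos : 0 < u0
  min : ∀ u, 0 < u → g u0 ≤ g u
  Mpos : 0 < M
  lb : ∀ u, 0 < u → -M * u ≤ g u
  Bpos : 0 < B
  big : ∀ u, B ≤ u → 0 ≤ g u
  cpos : 0 < c
  δpos : 0 < δ
  ub : ∀ u, 0 < u → u ≤ δ → g u ≤ -c * u

variable {g : ℝ → ℝ} {u0 M B c δ : ℝ}

lemma WP.cont (H : WP g u0 M B c δ) : ContinuousOn g (Ioi 0) :=
  ConvexOn.continuousOn isOpen_Ioi H.cvx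

lemma WP.neg (H : WP g u0 M B c δ) : g u0 < 0 := by
  have h1 := H.min δ H.δpos
  have h2 := H.ub δ H.δpos le_rfl
  nlinarith [mul_pos H.cpos H.δpos]

lemma WP.u0lt (H : WP g u0 M B c δ) : u0 < B := by
  by_contra h
  have := H.big u0 (not_lt.1 h)
  linarith [H.neg]

lemma WP.btw (H : WP g u0 M B c δ) {a b e t : ℝ} (ha : 0 < a) (hb : 0 < b) (h1 : g a < e)
    (h2 : g b ≤ e) (t0 : 0 ≤ t) (t1 : t < 1) : g (a + t * (b - a)) < e := by
  have := H.cvx.2 (mem_Ioi.2 ha) (mem_Ioi.2 hb) (show 0 ≤ 1 - t by linarith) t0 (by ring)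
  simp only [smul_eq_mul] at this
  rw [show (1 - t) * a + t * b = a + t * (b - a) by ring] at this
  nlinarith [mul_pos (show 0 < 1 - t by linarith) (show 0 < e - g a by linarith),
    mul_nonneg t0 (show 0 ≤ e - g b by linarith)]

lemma WP.btw2 (H : WP g u0 M B c δ) {a b e x : ℝ} (ha : 0 < a) (hb : 0 < b) (h1 : g a < e)
    (h2 : g b ≤ e) (hx : (a < x ∧ x < b) ∨ (b < x ∧ x < a)) : g x < e := by
  have hab : b - a ≠ 0 := by rcases hx with h | h <;> intro h' <;> linarith [h.1, h.2]
  have := H.btw (t := (x - a) / (b - a)) ha hb h1 h2 ?_ ?_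
  · rwa [div_mul_cancel₀ _ hab, add_sub_cancel] at this
  · rcases hx with h | h
    · exact div_nonneg (by linarith) (by linarith)
    · exact div_nonneg_of_nonpos (by linarith) (by linarith)
  · rcases hx with h | h
    · rw [div_lt_one (by linarith)]; linarith
    · rw [div_lt_one_of_neg (by linarith)]; linarith

lemma WP.exU (H : WP g u0 M B c δ) : ∀ e, ∃ p : ℝ × ℝ, e ∈ Ioo (g u0) 0 →
    0 < p.1 ∧ p.1 < u0 ∧ u0 < p.2 ∧ g p.1 = e ∧ g p.2 = e ∧
    (∀ u, 0 < u → (g u < e ↔ p.1 < u ∧ u < p.2)) ∧ 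
    (∀ u, 0 < u → g u ≤ e → p.1 ≤ u ∧ u ≤ p.2) := by
  intro e
  by_cases he : e ∈ Ioo (g u0) 0
  swap
  · exact ⟨0, fun h => absurd h he⟩
  obtain ⟨he1, he2⟩ := he
  have h0 := H.u0pos
  have hM := H.Mpos
  -- right
  obtain ⟨p2, hp2, hg2⟩ : ∃ x ∈ Icc u0 B, g x = e := by
    have hc : ContinuousOn g (Icc u0 B) := H.cont.mono (fun x hx => lt_of_lt_of_le h0 hx.1)
    exact intermediate_value_Icc H.u0lt.le hc ⟨he1.le, he2.le.trans (H.big B le_rfl)⟩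
  have hsm : 0 < -e / M := div_pos (by linarith) hM
  have hsu : -e / M ≤ u0 := by
    rw [div_le_iff₀ hM]; have := H.lb u0 h0; nlinarith
  obtain ⟨p1, hp1, hg1⟩ : ∃ x ∈ Icc (-e/M) u0, g x = e := by
    have hc : ContinuousOn g (Icc (-e/M) u0) := H.cont.mono (fun x hx => lt_of_lt_of_le hsm hx.1)
    refine intermediate_value_Icc' hsu hc ⟨he1.le, ?_⟩
    have := H.lb _ hsm
    rw [neg_mul, mul_div_cancel₀ _ hM.ne'] at this
    linarith
  have hp1p : 0 < p1 := lt_of_lt_of_le hsm hp1.1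
  have h1 : p1 < u0 := lt_of_le_of_ne hp1.2 (by rintro rfl; linarith)
  have h2 : u0 < p2 := lt_of_le_of_ne hp2.1 (by rintro rfl; linarith)
  have key : ∀ u, 0 < u → g u ≤ e → p1 ≤ u ∧ u ≤ p2 := by
    intro u hu hle
    constructor
    · by_contra hlt
      have := H.btw2 (x := p1) h0 hu he1 hle (Or.inr ⟨by linarith, h1⟩)
      linarith
    · by_contra hlt
      have := H.btw2 (x := p2) h0 hu he1 hle (Or.inl ⟨h2, by linarith⟩)
      linarith
  refine ⟨(p1, p2), fun _ => ⟨hp1p, h1, h2, hg1, hg2, ?_, key⟩⟩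
  intro u hu
  constructor
  · intro hlt
    obtain ⟨ha, hb⟩ := key u hu hlt.le
    exact ⟨lt_of_le_of_ne ha (by intro hh; rw [← hh, hg1] at hlt; exact lt_irrefl _ hlt),
      lt_of_le_of_ne hb (by intro hh; rw [hh, hg2] at hlt; exact lt_irrefl _ hlt)⟩
  · rintro ⟨ha, hb⟩
    simp only at ha hb
    rcases lt_trichotomy u u0 with h | h | h
    · exact H.btw2 h0 hp1p he1 hg1.le (Or.inr ⟨ha, h⟩)
    · rwa [h]
    · exact H.btw2 h0 (by linarith) he1 hg2.le (Or.inl ⟨h, hb⟩)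

def UU (H : WP g u0 M B c δ) (e : ℝ) : ℝ × ℝ := Classical.choose (H.exU e)

lemma UU_spec (H : WP g u0 M B c δ) {e : ℝ} (he : e ∈ Ioo (g u0) 0) :
    0 < (UU H e).1 ∧ (UU H e).1 < u0 ∧ u0 < (UU H e).2 ∧ g (UU H e).1 = e ∧ g (UU H e).2 = e ∧
    (∀ u, 0 < u → (g u < e ↔ (UU H e).1 < u ∧ u < (UU H e).2)) ∧ 
    (∀ u, 0 < u → g u ≤ e → (UU H e).1 ≤ u ∧ u ≤ (UU H e).2) :=
  Classical.choose_spec (H.exU e) he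

lemma UU2_cont (H : WP g u0 M B c δ) : ContinuousOn (fun e => (UU H e).2) (Ioo (g u0) 0) := by
  refine ConcaveOn.continuousOn isOpen_Ioo ⟨convex_Ioo _ _, ?_⟩
  intro x hx y hy a b ha hb hab
  have hz : a • x + b • y ∈ Ioo (g u0) 0 := convex_Ioo _ _ hx hy ha hb hab
  obtain ⟨x1, x2, x3, x4, x5, x6, x7⟩ := UU_spec H hx
  obtain ⟨y1, y2, y3, y4, y5, y6, y7⟩ := UU_spec H hy
  obtain ⟨z1, z2, z3, z4, z5, z6, z7⟩ := UU_spec H hz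
  have px : (UU H x).2 ∈ Ioi (0:ℝ) := mem_Ioi.2 (by linarith)
  have py : (UU H y).2 ∈ Ioi (0:ℝ) := mem_Ioi.2 (by linarith)
  have hm : a • (UU H x).2 + b • (UU H y).2 ∈ Ioi (0:ℝ) := convex_Ioi _ px py ha hb hab
  refine (z7 _ hm ?_).2
  have := H.cvx.2 px py ha hb hab
  rwa [x5, y5] at this

lemma UU1_cont (H : WP g u0 M B c δ) : ContinuousOn (fun e => (UU H e).1) (Ioo (g u0) 0) := by
  refine ConvexOn.continuousOn isOpen_Ioo ⟨convex_Ioo _ _, ?_⟩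
  intro x hx y hy a b ha hb hab
  have hz : a • x + b • y ∈ Ioo (g u0) 0 := convex_Ioo _ _ hx hy ha hb hab
  obtain ⟨x1, x2, x3, x4, x5, x6, x7⟩ := UU_spec H hx
  obtain ⟨y1, y2, y3, y4, y5, y6, y7⟩ := UU_spec H hy
  obtain ⟨z1, z2, z3, z4, z5, z6, z7⟩ := UU_spec H hz
  have px : (UU H x).1 ∈ Ioi (0:ℝ) := mem_Ioi.2 (by linarith)
  have py : (UU H y).1 ∈ Ioi (0:ℝ) := mem_Ioi.2 (by linarith)
  have hm : a • (UU H x).1 + b • (UU H y).1 ∈ Ioi (0:ℝ) := convex_Ioi _ px py ha hb hab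
  refine (z7 _ hm ?_).1
  have := H.cvx.2 px py ha hb hab
  rwa [x4, y4] at this

def kk (g : ℝ → ℝ) (e u : ℝ) : ℝ := (u⁻¹)^2 * (1 / √(e - g u))

lemma seg_pos {a b t : ℝ} (ha : 0 < a) (hb : 0 < b) (h0 : 0 ≤ t) (h1 : t ≤ 1) :
    min a b ≤ a + t * (b - a) := by
  rcases le_total a b with h | h
  · rw [min_eq_left h]; nlinarith
  · rw [min_eq_right h]; nlinarith

lemma KK_bound (H : WP g u0 M B c δ) {U e d m : ℝ} (hU : 0 < U) (hg : g U = e) (hd : 0 < d)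
    (hde : d ≤ e - g u0) (hm : 0 < m) (hmu : m ≤ u0) (hmU : m ≤ U) {t : ℝ} (h0 : 0 < t) (h1 : t ≤ 1) :
    ‖kk g e (u0 + t * (U - u0))‖ ≤ (m⁻¹)^2 * (1/√d) * (1 - t) ^ (-(1/2):ℝ) := by
  have hp : m ≤ u0 + t * (U - u0) := (le_min hmu hmU).trans (seg_pos H.u0pos hU h0.le h1)
  have hnn : 0 ≤ kk g e (u0 + t * (U - u0)) := by unfold kk; positivity
  rw [Real.norm_of_nonneg hnn, ← one_div_sqrt]
  unfold kk
  rcases h1.eq_or_lt with h | h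
  · subst h; simp [hg]
  rw [mul_assoc]
  have h3 : d * (1 - t) ≤ e - g (u0 + t * (U - u0)) := by
    have := H.cvx.2 (mem_Ioi.2 H.u0pos) (mem_Ioi.2 hU) (show 0 ≤ 1 - t by linarith) h0.le (by ring)
    simp only [smul_eq_mul, hg] at this
    rw [show (1 - t) * u0 + t * U = u0 + t * (U - u0) by ring] at this
    nlinarith
  have h4 : 0 < d * (1 - t) := mul_pos hd (by linarith)
  gcongr ?_ ^ 2 * ?_
  · exact inv_nonneg.2 (hm.le.trans hp)
  · exact inv_anti₀ hm hp
  · rw [one_div_mul_one_div, ← Real.sqrt_mul hd.le]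
    gcongr

lemma bound_int (C : ℝ) : IntervalIntegrable (fun t : ℝ => C * (1 - t) ^ (-(1/2):ℝ)) volume 0 1 := by
  have := (intervalIntegral.intervalIntegrable_rpow' (a := 0) (b := 1) (r := -(1/2)) (by norm_num))
  have := (this.comp_sub_left 1).symm
  simp only [sub_zero, sub_self] at this
  exact this.const_mul C

lemma KK_meas (H : WP g u0 M B c δ) {U e : ℝ} (hU : 0 < U) :
    AEStronglyMeasurable (fun t => kk g e (u0 + t * (U - u0))) (volume.restrict (uIoc 0 1)) := by
  have hc : ContinuousOn (fun t => g (u0 + t * (U - u0))) (uIoc 0 1) := by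
    refine H.cont.comp (by fun_prop) ?_
    intro t ht
    rw [uIoc_of_le zero_le_one] at ht
    exact lt_of_lt_of_le (lt_min H.u0pos hU) (seg_pos H.u0pos hU ht.1.le ht.2)
  have hm : AEMeasurable (fun t => g (u0 + t * (U - u0))) (volume.restrict (uIoc 0 1)) :=
    hc.aemeasurable measurableSet_uIoc
  refine AEMeasurable.aestronglyMeasurable ?_
  unfold kk
  have h2 : AEMeasurable (fun t : ℝ => ((u0 + t * (U - u0))⁻¹)^2) (volume.restrict (uIoc 0 1)) := by
    fun_prop
  exact h2.mul ((hm.const_sub e).sqrt.const_div 1)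

lemma KK_int (H : WP g u0 M B c δ) {U e : ℝ} (hU : 0 < U) (hg : g U = e) (he : g u0 < e) :
    IntervalIntegrable (kk g e) volume u0 U := by
  have h1 : IntervalIntegrable (fun t => kk g e (u0 + t * (U - u0))) volume 0 1 := by
    refine (bound_int (((min u0 U)⁻¹)^2 * (1/√(e - g u0)))).mono_fun (KK_meas H hU) ?_
    refine (ae_restrict_iff' measurableSet_uIoc).2 (Eventually.of_forall fun t ht => ?_)
    rw [uIoc_of_le zero_le_one] at ht
    refine (KK_bound H hU hg (sub_pos.2 he) le_rfl (lt_min H.u0pos hU) (min_le_left _ _)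
      (min_le_right _ _) ht.1 ht.2).trans (le_abs_self _)
  have hne : U - u0 ≠ 0 := by
    intro h
    have : U = u0 := by linarith
    subst this; linarith
  have h2 := (IntervalIntegrable.comp_mul_left_iff (f := fun x => kk g e (u0 + x)) (a := 0) (b := U - u0) hne).1
    (by simpa [div_self hne, mul_comm] using h1)
  have h3 := h2.comp_sub_right u0
  simpa using h3

lemma KK_cont (H : WP g u0 M B c δ) {U : ℝ → ℝ} {e : ℝ} (hUc : ContinuousAt U e) (he : g u0 < e)
    (hU : ∀ᶠ x in 𝓝 e, 0 < U x ∧ g (U x) = x) :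
    ContinuousAt (fun x => ∫ u in u0..U x, kk g x u) e := by
  have heq : (fun x => ∫ u in u0..U x, kk g x u) =
      fun x => (U x - u0) * ∫ t in (0:ℝ)..1, kk g x (u0 + t * (U x - u0)) := by
    funext x
    have := intervalIntegral.smul_integral_comp_add_mul (a := 0) (b := 1) (kk g x) (U x - u0) u0
    simp only [mul_zero, add_zero, mul_one, add_sub_cancel, smul_eq_mul] at this
    rw [← this]
    simp only [mul_comm (U x - u0)]
  rw [heq]
  obtain ⟨hUe, hgUe⟩ := hU.self_of_nhds
  refine (hUc.sub continuousAt_const).mul ?_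
  set m := min u0 (U e / 2) with hm
  set d := (e - g u0) / 2 with hd
  have hmp : 0 < m := lt_min H.u0pos (by linarith)
  refine intervalIntegral.continuousAt_of_dominated_interval (bound := fun t => (m⁻¹)^2 * (1/√d) * (1 - t) ^ (-(1/2):ℝ)) ?_ ?_ (bound_int _) ?_
  · filter_upwards [hU] with x hx
    exact KK_meas H hx.1
  · have e1 : ∀ᶠ x in 𝓝 e, U e / 2 < U x := hUc.eventually_const_lt (by linarith)
    have e2 : ∀ᶠ x in 𝓝 e, g u0 + d < x := eventually_gt_nhds (by rw [hd]; linarith)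
    filter_upwards [hU, e1, e2] with x hx h1 h2
    refine Eventually.of_forall fun t ht => ?_
    rw [uIoc_of_le zero_le_one] at ht
    exact KK_bound H hx.1 hx.2 (by rw [hd]; linarith) (by linarith) hmp (min_le_left _ _)
      ((min_le_right _ _).trans h1.le) ht.1 ht.2
  · have : ∀ᵐ t : ℝ, t ≠ 1 := by simp [ae_iff]
    filter_upwards [this] with t ht1 ht
    rw [uIoc_of_le zero_le_one] at ht
    have ht2 : t < 1 := lt_of_le_of_ne ht.2 ht1
    have hpos : 0 < u0 + t * (U e - u0) :=
      lt_of_lt_of_le (lt_min H.u0pos hUe) (seg_pos H.u0pos hUe ht.1.le ht.2)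
    have hs : ContinuousAt (fun x => u0 + t * (U x - u0)) e :=
      continuousAt_const.add (continuousAt_const.mul (hUc.sub continuousAt_const))
    have hgc : ContinuousAt (fun x => g (u0 + t * (U x - u0))) e :=
      ContinuousAt.comp (f := fun x => u0 + t * (U x - u0))
        (H.cont.continuousAt (Ioi_mem_nhds hpos)) hs
    have hlt : g (u0 + t * (U e - u0)) < e := H.btw H.u0pos hUe he hgUe.le ht.1.le ht2
    unfold kk
    refine ((hs.inv₀ hpos.ne').pow 2).mul ?_
    refine continuousAt_const.div (Real.continuous_sqrt.continuousAt.comp (continuousAt_id.sub hgc)) ?_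
    exact (Real.sqrt_pos.2 (sub_pos.2 hlt)).ne'


lemma kk_zero (H : WP g u0 M B c δ) {e u : ℝ} (he : e ∈ Ioo (g u0) 0) (hu : 0 < u)
    (h : u ∉ Ioc (UU H e).1 (UU H e).2) : kk g e u = 0 := by
  obtain ⟨x1, x2, x3, x4, x5, x6, x7⟩ := UU_spec H he
  have : ¬ g u < e := fun hh => h ⟨((x6 u hu).1 hh).1, ((x6 u hu).1 hh).2.le⟩
  unfold kk
  rw [Real.sqrt_eq_zero_of_nonpos (by linarith)]; simp

lemma kk_ii (H : WP g u0 M B c δ) {e : ℝ} (he : e ∈ Ioo (g u0) 0) :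
    IntervalIntegrable (kk g e) volume u0 (UU H e).1 ∧
    IntervalIntegrable (kk g e) volume u0 (UU H e).2 := by
  obtain ⟨x1, x2, x3, x4, x5, x6, x7⟩ := UU_spec H he
  exact ⟨KK_int H x1 x4 he.1, KK_int H (by linarith) x5 he.1⟩

lemma kk_integrable (H : WP g u0 M B c δ) {e : ℝ} (he : e ∈ Ioo (g u0) 0) :
    IntegrableOn (kk g e) (Ioi 0) := by
  obtain ⟨x1, x2, x3, x4, x5, x6, x7⟩ := UU_spec H he
  obtain ⟨h1, h2⟩ := kk_ii H he
  have h3 := (intervalIntegrable_iff_integrableOn_Ioc_of_le (x2.trans x3).le).1 (h1.symm.trans h2)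
  exact h3.of_forall_sdiff_eq_zero measurableSet_Ioi (fun u hu => kk_zero H he hu.1 hu.2)

lemma kk_integral (H : WP g u0 M B c δ) {e : ℝ} (he : e ∈ Ioo (g u0) 0) :
    ∫ u in Ioi 0, kk g e u =
      (∫ u in u0..(UU H e).2, kk g e u) - ∫ u in u0..(UU H e).1, kk g e u := by
  obtain ⟨x1, x2, x3, x4, x5, x6, x7⟩ := UU_spec H he
  obtain ⟨h1, h2⟩ := kk_ii H he
  rw [intervalIntegral.integral_interval_sub_left h2 h1,
    intervalIntegral.integral_of_le (x2.trans x3).le]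
  exact setIntegral_eq_of_subset_of_forall_sdiff_eq_zero measurableSet_Ioi
    (fun u hu => x1.trans hu.1) (fun u hu => kk_zero H he hu.1 hu.2)

variable {ψ : ℝ → ℝ}

def TT (ψ : ℝ → ℝ) (e : ℝ) : ℝ := ∫ r in Ioi (0:ℝ), 1 / √(e - ψ r)

lemma chg (hψ : ∀ r, 0 < r → ψ r = g r⁻¹) (e : ℝ) : ∀ x ∈ Ioi (0:ℝ),
    (|(-1:ℝ)| * x ^ ((-1:ℝ) - 1)) • (fun r => 1 / √(e - ψ r)) (x ^ (-1:ℝ)) = kk g e x := by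
  intro x hx
  have hx : 0 < x := hx
  have h2 : x ^ ((-1:ℝ) - 1) = (x⁻¹)^2 := by
    rw [show ((-1:ℝ) - 1) = -((2:ℕ):ℝ) by norm_num, Real.rpow_neg hx.le, Real.rpow_natCast, inv_pow]
  simp only [smul_eq_mul, Real.rpow_neg_one, h2, hψ _ (inv_pos.2 hx), inv_inv, kk]
  norm_num

lemma T_integrable (H : WP g u0 M B c δ) (hψ : ∀ r, 0 < r → ψ r = g r⁻¹) {e : ℝ}
    (he : e ∈ Ioo (g u0) 0) : IntegrableOn (fun r => 1 / √(e - ψ r)) (Ioi 0) := by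
  rw [← integrableOn_Ioi_comp_rpow_iff _ (show (-1:ℝ) ≠ 0 by norm_num)]
  exact (integrableOn_congr_fun (chg hψ e) measurableSet_Ioi).2 (kk_integrable H he)

lemma T_eq (H : WP g u0 M B c δ) (hψ : ∀ r, 0 < r → ψ r = g r⁻¹) {e : ℝ}
    (he : e ∈ Ioo (g u0) 0) : TT ψ e =
      (∫ u in u0..(UU H e).2, kk g e u) - ∫ u in u0..(UU H e).1, kk g e u := by
  rw [← kk_integral H he, TT, ← integral_comp_rpow_Ioi _ (show (-1:ℝ) ≠ 0 by norm_num)]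
  exact setIntegral_congr_fun measurableSet_Ioi (chg hψ e)

lemma T_cont (H : WP g u0 M B c δ) (hψ : ∀ r, 0 < r → ψ r = g r⁻¹) :
    ContinuousOn (TT ψ) (Ioo (g u0) 0) := by
  intro e he
  have hn := isOpen_Ioo.mem_nhds he
  refine ContinuousAt.continuousWithinAt ?_
  have h1 := KK_cont H ((UU1_cont H).continuousAt hn) he.1 (by
    filter_upwards [hn] with x hx
    exact ⟨(UU_spec H hx).1, (UU_spec H hx).2.2.2.1⟩)
  have h2 := KK_cont H ((UU2_cont H).continuousAt hn) he.1 (by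
    filter_upwards [hn] with x hx
    exact ⟨H.u0pos.trans (UU_spec H hx).2.2.1, (UU_spec H hx).2.2.2.2.1⟩)
  refine (h2.sub h1).congr ?_
  filter_upwards [hn] with x hx
  exact (T_eq H hψ hx).symm

lemma lvl (H : WP g u0 M B c δ) (hψ : ∀ r, 0 < r → ψ r = g r⁻¹) {e : ℝ}
    (he : e ∈ Ioo (g u0) 0) : {r | 0 < r ∧ ψ r < e} = Ioo ((UU H e).2)⁻¹ ((UU H e).1)⁻¹ := by
  obtain ⟨x1, x2, x3, x4, x5, x6, x7⟩ := UU_spec H he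
  have x8 : 0 < (UU H e).2 := by linarith
  ext r
  simp only [mem_setOf_eq, mem_Ioo]
  constructor
  · rintro ⟨hr, h⟩
    rw [hψ r hr] at h
    obtain ⟨h1, h2⟩ := (x6 _ (inv_pos.2 hr)).1 h
    exact ⟨inv_lt_of_inv_lt₀ hr h2, (lt_inv_comm₀ x1 hr).1 h1⟩
  · rintro ⟨h1, h2⟩
    have hr : 0 < r := (inv_pos.2 x8).trans h1
    refine ⟨hr, ?_⟩
    rw [hψ r hr, x6 _ (inv_pos.2 hr)]
    exact ⟨(lt_inv_comm₀ hr x1).1 h2, inv_lt_of_inv_lt₀ x8 h1⟩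

lemma rr (H : WP g u0 M B c δ) (hψ : ∀ r, 0 < r → ψ r = g r⁻¹) {e : ℝ}
    (he : e ∈ Ioo (g u0) 0) : 0 < ((UU H e).2)⁻¹ ∧ ((UU H e).2)⁻¹ < ((UU H e).1)⁻¹ ∧
      sInf {r | 0 < r ∧ ψ r < e} = ((UU H e).2)⁻¹ ∧ sSup {r | 0 < r ∧ ψ r < e} = ((UU H e).1)⁻¹ := by
  obtain ⟨x1, x2, x3, x4, x5, x6, x7⟩ := UU_spec H he
  have x8 : 0 < (UU H e).2 := by linarith
  have h : ((UU H e).2)⁻¹ < ((UU H e).1)⁻¹ := inv_strictAnti₀ x1 (by linarith)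
  rw [lvl H hψ he, csInf_Ioo h, csSup_Ioo h]
  exact ⟨inv_pos.2 x8, h, rfl, rfl⟩

lemma T_interval (H : WP g u0 M B c δ) (hψ : ∀ r, 0 < r → ψ r = g r⁻¹) {e : ℝ}
    (he : e ∈ Ioo (g u0) 0) : 
    ∫ r in (sInf {r | 0 < r ∧ ψ r < e})..(sSup {r | 0 < r ∧ ψ r < e}), 1 / √(e - ψ r) = TT ψ e := by
  obtain ⟨h1, h2, h3, h4⟩ := rr H hψ he
  rw [h3, h4, intervalIntegral.integral_of_le h2.le, TT]
  symm
  refine setIntegral_eq_of_subset_of_forall_sdiff_eq_zero measurableSet_Ioi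
    (fun u hu => h1.trans hu.1) (fun r hr => ?_)
  have : ¬ (ψ r < e) := by
    intro hh
    have : r ∈ {r | 0 < r ∧ ψ r < e} := ⟨hr.1, hh⟩
    rw [lvl H hψ he] at this
    exact hr.2 ⟨this.1, this.2.le⟩
  rw [Real.sqrt_eq_zero_of_nonpos (by linarith)]; simp

lemma T_pos (H : WP g u0 M B c δ) (hψ : ∀ r, 0 < r → ψ r = g r⁻¹) {e : ℝ}
    (he : e ∈ Ioo (g u0) 0) : 0 < TT ψ e := by
  rw [← T_interval H hψ he]
  obtain ⟨h1, h2, h3, h4⟩ := rr H hψ he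
  rw [h3, h4]
  refine intervalIntegral.intervalIntegral_pos_of_pos_on ?_ ?_ h2
  · rw [intervalIntegrable_iff_integrableOn_Ioc_of_le h2.le]
    exact (T_integrable H hψ he).mono_set (fun u hu => h1.trans hu.1)
  · intro r hr
    rw [← lvl H hψ he] at hr
    have := hr.2
    exact one_div_pos.2 (Real.sqrt_pos.2 (by linarith))

lemma psi_cont (H : WP g u0 M B c δ) (hψ : ∀ r, 0 < r → ψ r = g r⁻¹) : ContinuousOn ψ (Ioi 0) := by
  have : ContinuousOn (fun r => g r⁻¹) (Ioi 0) :=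
    H.cont.comp (continuousOn_inv₀.mono fun x hx => ne_of_gt hx) (fun x hx => mem_Ioi.2 (inv_pos.2 (mem_Ioi.1 hx)))
  exact this.congr fun r hr => hψ r hr

def AA (ψ : ℝ → ℝ) (e : ℝ) : ℝ := ∫ r in Ioi (0:ℝ), √(max (e - ψ r) 0)

lemma A_integrable (H : WP g u0 M B c δ) (hψ : ∀ r, 0 < r → ψ r = g r⁻¹) {e : ℝ}
    (he : e ∈ Ioo (g u0) 0) : IntegrableOn (fun r => √(max (e - ψ r) 0)) (Ioi 0) := by
  obtain ⟨h1, h2, h3, h4⟩ := rr H hψ he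
  have : IntegrableOn (fun r => √(max (e - ψ r) 0)) (Icc ((UU H e).2)⁻¹ ((UU H e).1)⁻¹) := by
    refine ContinuousOn.integrableOn_Icc ?_
    have := (psi_cont H hψ).mono (fun x (hx : x ∈ Icc ((UU H e).2)⁻¹ ((UU H e).1)⁻¹) => lt_of_lt_of_le h1 hx.1)
    fun_prop
  refine this.of_forall_sdiff_eq_zero measurableSet_Ioi (fun r hr => ?_)
  have : ¬ (ψ r < e) := by
    intro hh
    have : r ∈ {r | 0 < r ∧ ψ r < e} := ⟨hr.1, hh⟩
    rw [lvl H hψ he] at this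
    exact hr.2 ⟨this.1.le, this.2.le⟩
  rw [max_eq_right (by linarith)]; simp

lemma sqrt_ftc (a b p : ℝ) : ∫ s in a..b, 1 / √(s - p) = 2 * (√(max (b - p) 0) - √(max (a - p) 0)) := by
  have hs : ∀ x : ℝ, √(max x 0) = √x := fun x => by
    rcases le_total x 0 with h | h
    · rw [max_eq_right h, Real.sqrt_eq_zero_of_nonpos h, Real.sqrt_zero]
    · rw [max_eq_left h]
  simp only [one_div_sqrt, hs]
  rw [intervalIntegral.integral_comp_sub_right (fun x => x ^ (-(1/2):ℝ)), integral_rpow (Or.inl (by norm_num))]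
  rw [show (-(1/2):ℝ) + 1 = 1/2 by norm_num, ← Real.sqrt_eq_rpow, ← Real.sqrt_eq_rpow]
  ring

lemma A_diff (H : WP g u0 M B c δ) (hψ : ∀ r, 0 < r → ψ r = g r⁻¹) {a b : ℝ}
    (ha : a ∈ Ioo (g u0) 0) (hb : b ∈ Ioo (g u0) 0) (hab : a ≤ b) :
    ∫ s in a..b, TT ψ s = 2 * (AA ψ b - AA ψ a) := by
  have hsub : Icc a b ⊆ Ioo (g u0) 0 := fun x hx => ⟨ha.1.trans_le hx.1, hx.2.trans_lt hb.2⟩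
  have hTi : IntegrableOn (TT ψ) (Ioc a b) :=
    (((T_cont H hψ).mono hsub).integrableOn_Icc).mono_set Ioc_subset_Icc_self
  have hm : AEMeasurable ψ (volume.restrict (Ioi 0)) := (psi_cont H hψ).aemeasurable measurableSet_Ioi
  have hF : Integrable (Function.uncurry (fun s r => 1 / √(s - ψ r)))
      ((volume.restrict (Ioc a b)).prod (volume.restrict (Ioi 0))) := by
    rw [integrable_prod_iff]
    · constructor
      · refine (ae_restrict_iff' measurableSet_Ioc).2 (Eventually.of_forall fun s hs => ?_)
        exact T_integrable H hψ (hsub (Ioc_subset_Icc_self hs))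
      · refine hTi.congr (Eventually.of_forall fun s => ?_)
        refine integral_congr_ae (Eventually.of_forall fun r => ?_)
        simp only [Function.uncurry]
        rw [Real.norm_of_nonneg (by positivity)]
    · refine AEMeasurable.aestronglyMeasurable ?_
      have h1 : AEMeasurable (fun p : ℝ × ℝ => ψ p.2) ((volume.restrict (Ioc a b)).prod (volume.restrict (Ioi 0))) :=
        hm.comp_snd
      exact ((measurable_fst.aemeasurable.sub h1).sqrt.const_div 1)
  rw [intervalIntegral.integral_of_le hab]
  unfold TT
  rw [integral_integral_swap hF]
  unfold AA
  rw [← integral_sub (A_integrable H hψ hb) (A_integrable H hψ ha), ← integral_const_mul]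
  refine integral_congr_ae (Eventually.of_forall fun r => ?_)
  simp only
  rw [← intervalIntegral.integral_of_le hab, sqrt_ftc]

lemma A_deriv (H : WP g u0 M B c δ) (hψ : ∀ r, 0 < r → ψ r = g r⁻¹) {e : ℝ}
    (he : e ∈ Ioo (g u0) 0) : HasDerivAt (AA ψ) (TT ψ e / 2) e := by
  obtain ⟨a, ha1, ha2⟩ := exists_between he.1
  have ha : a ∈ Ioo (g u0) 0 := ⟨ha1, ha2.trans he.2⟩
  have hn := isOpen_Ioo.mem_nhds he
  have h1 : HasDerivAt (fun x => ∫ s in a..x, TT ψ s) (TT ψ e) e := by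
    refine intervalIntegral.integral_hasDerivAt_right ?_ ?_ ((T_cont H hψ).continuousAt hn)
    · refine ContinuousOn.intervalIntegrable ((T_cont H hψ).mono ?_)
      rw [uIcc_of_le ha2.le]
      exact fun x hx => ⟨ha1.trans_le hx.1, hx.2.trans_lt he.2⟩
    · exact (T_cont H hψ).stronglyMeasurableAtFilter isOpen_Ioo e he
  have h2 := (h1.div_const 2).const_add (AA ψ a)
  refine h2.congr_of_eventuallyEq ?_
  filter_upwards [hn, Ioi_mem_nhds ha2] with x hx hx2
  rw [A_diff H hψ ha hx (le_of_lt hx2)]; ring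

lemma A_pos (H : WP g u0 M B c δ) (hψ : ∀ r, 0 < r → ψ r = g r⁻¹) {e : ℝ}
    (he : e ∈ Ioo (g u0) 0) : 0 < AA ψ e := by
  have h0 : ∀ x, 0 ≤ AA ψ x := fun x => integral_nonneg fun r => Real.sqrt_nonneg _
  obtain ⟨a, ha1, ha2⟩ := exists_between he.1
  have ha : a ∈ Ioo (g u0) 0 := ⟨ha1, ha2.trans he.2⟩
  have h1 := A_diff H hψ ha he ha2.le
  have hs : ∀ x ∈ Icc a e, x ∈ Ioo (g u0) 0 := fun x hx => ⟨ha1.trans_le hx.1, hx.2.trans_lt he.2⟩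
  have h2 : 0 < ∫ s in a..e, TT ψ s := by
    refine intervalIntegral.intervalIntegral_pos_of_pos_on ?_ ?_ ha2
    · refine ContinuousOn.intervalIntegrable ((T_cont H hψ).mono ?_)
      rw [uIcc_of_le ha2.le]
      exact hs
    · exact fun x hx => T_pos H hψ (hs x (Ioo_subset_Icc_self hx))
  linarith [h0 a]

lemma A_small (H : WP g u0 M B c δ) (hψ : ∀ r, 0 < r → ψ r = g r⁻¹) {y : ℝ} (hy : 0 < y) :
    ∃ e ∈ Ioo (g u0) 0, AA ψ e < y := by
  have hneg := H.neg
  set e1 := g u0 / 2 with he1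
  have h1 : e1 ∈ Ioo (g u0) 0 := ⟨by linarith, by linarith⟩
  obtain ⟨hr1, hr2, -, -⟩ := rr H hψ h1
  set R := ((UU H e1).1)⁻¹ with hR
  have hRp : 0 < R := hr1.trans hr2
  have hle : ∀ e ∈ Ioo (g u0) 0, e ≤ e1 → AA ψ e ≤ R * √(e - g u0) := by
    intro e he hee
    have hsub : ∀ r ∈ Ioi (0:ℝ) \ Ioc 0 R, √(max (e - ψ r) 0) = 0 := by
      intro r hr
      have : ¬ (ψ r < e) := by
        intro hh
        have : r ∈ {r | 0 < r ∧ ψ r < e1} := ⟨hr.1, hh.trans_le hee⟩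
        rw [lvl H hψ h1] at this
        exact hr.2 ⟨hr.1, this.2.le⟩
      rw [max_eq_right (by linarith)]; simp
    rw [AA, setIntegral_eq_of_subset_of_forall_sdiff_eq_zero measurableSet_Ioi
      (fun u (hu : u ∈ Ioc 0 R) => hu.1) hsub]
    have := setIntegral_mono_on (μ := volume) (s := Ioc 0 R) (f := fun r => √(max (e - ψ r) 0)) (g := fun _ => √(e - g u0))
      ((A_integrable H hψ he).mono_set (fun u hu => hu.1)) (by simp) measurableSet_Ioc ?_
    · simpa [hRp.le] using this
    · intro r hr
      apply Real.sqrt_le_sqrt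
      refine max_le ?_ (by linarith [he.1])
      rw [hψ r hr.1]
      linarith [H.min _ (inv_pos.2 hr.1)]
  set q := y / (2 * R) with hq
  have hqp : 0 < q := by positivity
  refine ⟨min e1 (g u0 + q^2), ⟨lt_min h1.1 (by nlinarith), (min_le_left _ _).trans_lt h1.2⟩, ?_⟩
  refine (hle _ ⟨lt_min h1.1 (by nlinarith), (min_le_left _ _).trans_lt h1.2⟩ (min_le_left _ _)).trans_lt ?_
  have : √(min e1 (g u0 + q^2) - g u0) ≤ q := by
    rw [Real.sqrt_le_left hqp.le]
    linarith [min_le_right e1 (g u0 + q^2)]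
  calc _ ≤ R * q := by gcongr
    _ = y / 2 := by rw [hq]; field_simp
    _ < y := by linarith

lemma A_large (H : WP g u0 M B c δ) (hψ : ∀ r, 0 < r → ψ r = g r⁻¹) {y : ℝ} :
    ∃ e ∈ Ioo (g u0) 0, y < AA ψ e := by
  have hneg := H.neg
  have hc := H.cpos
  have hδ := H.δpos
  set R := δ⁻¹ with hR
  have hRp : 0 < R := inv_pos.2 hδ
  have key : ∀ N, R ≤ N → -(c / (2 * N)) ∈ Ioo (g u0) 0 →
      (N - R) * √(c / (2 * N)) ≤ AA ψ (-(c / (2 * N))) := by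
    intro N hN he
    have hNp : 0 < N := hRp.trans_le hN
    have h1 : ∫ r in Ioc R N, √(max (-(c / (2 * N)) - ψ r) 0) ≤ AA ψ (-(c / (2 * N))) := by
      refine setIntegral_mono_set (A_integrable H hψ he) (Eventually.of_forall fun r => Real.sqrt_nonneg _) ?_
      exact LE.le.eventuallyLE (fun u hu => hRp.trans hu.1)
    refine le_trans ?_ h1
    have := setIntegral_mono_on (μ := volume) (s := Ioc R N) (f := fun _ => √(c / (2 * N))) (g := fun r => √(max (-(c / (2 * N)) - ψ r) 0))
      (by simp) ((A_integrable H hψ he).mono_set (fun u hu => hRp.trans hu.1)) measurableSet_Ioc ?_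
    · simpa [hN] using this
    · intro r hr
      have hrp : 0 < r := hRp.trans hr.1
      apply Real.sqrt_le_sqrt
      refine le_max_of_le_left ?_
      rw [hψ r hrp]
      have h2 := H.ub r⁻¹ (inv_pos.2 hrp) (inv_le_of_inv_le₀ hδ hr.1.le)
      have h3 : N⁻¹ ≤ r⁻¹ := inv_anti₀ hrp hr.2
      have h4 : c / (2 * N) = c * N⁻¹ / 2 := by field_simp
      rw [h4]
      nlinarith
  have hlim : Tendsto (fun N : ℝ => -(c / (2 * N))) atTop (𝓝 0) := by
    have : Tendsto (fun N : ℝ => c / (2 * N)) atTop (𝓝 0) :=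
      Tendsto.div_atTop tendsto_const_nhds (tendsto_id.const_mul_atTop two_pos)
    simpa using this.neg
  have e1 : ∀ᶠ N : ℝ in atTop, g u0 < -(c / (2 * N)) := hlim.eventually_const_lt hneg
  set q := √(c / 8) with hq
  have hqp : 0 < q := Real.sqrt_pos.2 (by positivity)
  have e2 : ∀ᶠ N : ℝ in atTop, y / q < √N :=
    (Real.tendsto_sqrt_atTop).eventually_gt_atTop _
  obtain ⟨N, hN1, hN2, hN3⟩ := (e1.and (e2.and (eventually_ge_atTop (2 * R)))).exists
  have hNp : 0 < N := by linarith
  have hmem : -(c / (2 * N)) ∈ Ioo (g u0) 0 := ⟨hN1, by have : 0 < c / (2 * N) := by positivity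
                                                        linarith⟩
  refine ⟨_, hmem, lt_of_lt_of_le ?_ (key N (by linarith) hmem)⟩
  have h5 : N * √(c / (2 * N)) = 2 * (q * √N) := by
    rw [hq, ← Real.sqrt_mul (by positivity)]
    have h6 : √(c / (2 * N)) = √(4 * (c / 8 * N) / N ^ 2) := by congr 1; field_simp; norm_num
    rw [h6, Real.sqrt_div (by positivity), Real.sqrt_sq hNp.le, Real.sqrt_mul (by norm_num),
      show √(4:ℝ) = 2 by rw [show (4:ℝ) = 2^2 by norm_num, Real.sqrt_sq (by norm_num)]]
    field_simp
  have h7 : N / 2 * √(c / (2 * N)) ≤ (N - R) * √(c / (2 * N)) := by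
    gcongr; linarith
  have h8 : y < q * √N := by rw [div_lt_iff₀ hqp] at hN2; linarith
  linarith

theorem main (H : WP g u0 M B c δ) (hψ : ∀ r, 0 < r → ψ r = g r⁻¹) {C : ℝ} (hC : 0 < C) :
    sInf (ψ '' Ioi 0) = g u0 ∧
    StrictMonoOn (fun e => C * AA ψ e) (Ioo (g u0) 0) ∧
    ContDiffOn ℝ 1 (fun e => C * AA ψ e) (Ioo (g u0) 0) ∧
    (fun e => C * AA ψ e) '' (Ioo (g u0) 0) = Ioi 0 ∧
    ∀ e ∈ Ioo (g u0) 0, HasDerivAt (fun e => C * AA ψ e) (C / 2 *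
      ∫ r in (sInf {r | 0 < r ∧ ψ r < e})..(sSup {r | 0 < r ∧ ψ r < e}), 1 / √(e - ψ r)) e ∧
      0 < C / 2 * ∫ r in (sInf {r | 0 < r ∧ ψ r < e})..(sSup {r | 0 < r ∧ ψ r < e}), 1 / √(e - ψ r) := by
  have hd : ∀ e ∈ Ioo (g u0) 0, HasDerivAt (fun e => C * AA ψ e) (C / 2 * TT ψ e) e := by
    intro e he
    have := (A_deriv H hψ he).const_mul C
    rwa [show C * (TT ψ e / 2) = C / 2 * TT ψ e by ring] at this
  have hcont : ContinuousOn (fun e => C * AA ψ e) (Ioo (g u0) 0) :=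
    fun e he => (hd e he).continuousAt.continuousWithinAt
  refine ⟨?_, ?_, ?_, ?_, ?_⟩
  · have hl : IsLeast (ψ '' Ioi 0) (g u0) := by
      constructor
      · exact ⟨u0⁻¹, inv_pos.2 H.u0pos, by rw [hψ _ (inv_pos.2 H.u0pos), inv_inv]⟩
      · rintro _ ⟨r, hr, rfl⟩
        rw [hψ r hr]
        exact H.min _ (inv_pos.2 hr)
    exact hl.csInf_eq
  · refine strictMonoOn_of_deriv_pos (convex_Ioo _ _) hcont ?_
    intro e he
    rw [interior_Ioo] at he
    rw [(hd e he).deriv]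
    have := T_pos H hψ he
    positivity
  · rw [show (1 : WithTop ℕ∞) = 0 + 1 by simp, contDiffOn_succ_iff_deriv_of_isOpen isOpen_Ioo]
    refine ⟨fun e he => (hd e he).differentiableAt.differentiableWithinAt, by simp, ?_⟩
    rw [contDiffOn_zero]
    exact (continuousOn_const.mul (T_cont H hψ)).congr fun e he => (hd e he).deriv
  · ext y
    constructor
    · rintro ⟨e, he, rfl⟩
      exact mul_pos hC (A_pos H hψ he)
    · intro hy
      have hy : 0 < y := hy
      obtain ⟨a, ha, ha2⟩ := A_small H hψ (div_pos hy hC)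
      obtain ⟨b, hb, hb2⟩ := A_large H hψ (y := y / C)
      rw [lt_div_iff₀ hC] at ha2
      rw [div_lt_iff₀ hC] at hb2
      have := isPreconnected_Ioo.intermediate_value ha hb hcont
      exact this ⟨by linarith, by linarith⟩
  · intro e he
    rw [T_interval H hψ he]
    have := T_pos H hψ he
    exact ⟨hd e he, by positivity⟩


lemma cart (G : ℝ × (ℝ × ℝ) → ℝ≥0∞) (hG : Measurable G) :
    ∫⁻ y : E3, G (y 0, (y 1, y 2)) = ∫⁻ z : ℝ, ∫⁻ p : ℝ × ℝ, G (z, p) := by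
  have m1 := PiLp.volume_preserving_ofLp (Fin 3)
  have m2 := volume_preserving_piFinSuccAbove (fun _ : Fin 3 => ℝ) 0
  have m3 : MeasurePreserving (Prod.map (id : ℝ → ℝ) (MeasurableEquiv.finTwoArrow (α := ℝ))) 
      (volume.prod volume) (volume.prod volume) :=
    (MeasurePreserving.id volume).prod (volume_preserving_finTwoArrow ℝ)
  have m4 := m3.comp (m2.comp m1)
  have := m4.lintegral_comp hG
  rw [lintegral_prod _ hG.aemeasurable] at this
  rw [← this]
  rfl

lemma norm3 (y : E3) : ‖y‖ = √((y 0)^2 + ((y 1)^2 + (y 2)^2)) := by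
  rw [EuclideanSpace.norm_eq]
  simp [Fin.sum_univ_three, add_assoc]

lemma radial2 (z : ℝ) (G : ℝ → ℝ≥0∞) (hG : Measurable G) :
    ∫⁻ p : ℝ × ℝ, G (√(z^2 + (p.1^2 + p.2^2))) =
      ∫⁻ s in Ioi |z|, ENNReal.ofReal (2 * π * s) * G s := by
  rw [← lintegral_comp_polarCoord_symm, polarCoord_target]
  have h1 : ∀ p : ℝ × ℝ, ENNReal.ofReal p.1 • G (√(z^2 + ((polarCoord.symm p).1^2 + (polarCoord.symm p).2^2)))
      = ENNReal.ofReal p.1 * G (√(z^2 + p.1^2)) := by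
    intro p
    rw [polarCoord_symm_apply]
    simp only [smul_eq_mul]
    congr 4
    have := Real.sin_sq_add_cos_sq p.2
    linear_combination p.1 ^ 2 * this
  simp only [h1]
  rw [show (volume : Measure (ℝ × ℝ)) = volume.prod volume from rfl, setLIntegral_prod]
  swap
  · refine Measurable.aemeasurable ?_
    fun_prop
  simp only [lintegral_const, Measure.restrict_apply MeasurableSet.univ, univ_inter, Real.volume_Ioo]
  have himg : (fun q : ℝ => √(z^2 + q^2)) '' Ioi 0 = Ioi |z| := by
    ext s
    constructor
    · rintro ⟨q, hq, rfl⟩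
      have hq : 0 < q := hq
      show |z| < √(z^2 + q^2)
      rw [← Real.sqrt_sq_eq_abs]
      exact Real.sqrt_lt_sqrt (sq_nonneg z) (by nlinarith)
    · intro hs
      have hs : |z| < s := hs
      have h0 := abs_nonneg z
      have h2 : z ^ 2 < s ^ 2 := by rw [← sq_abs z]; gcongr
      refine ⟨√(s^2 - z^2), Real.sqrt_pos.2 (by linarith), ?_⟩
      simp only
      rw [Real.sq_sqrt (by linarith), add_sub_cancel, Real.sqrt_sq (by linarith)]
  have hinj : InjOn (fun q : ℝ => √(z^2 + q^2)) (Ioi 0) := by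
    intro a ha b hb hab
    have ha : 0 < a := ha
    have hb : 0 < b := hb
    simp only at hab
    rw [Real.sqrt_inj (by positivity) (by positivity)] at hab
    exact (sq_eq_sq₀ ha.le hb.le).1 (by linarith)
  have hder : ∀ q ∈ Ioi (0:ℝ), HasDerivWithinAt (fun q : ℝ => √(z^2 + q^2)) (q / √(z^2 + q^2)) (Ioi 0) q := by
    intro q hq
    have hq : 0 < q := hq
    have := (((hasDerivAt_pow 2 q).const_add (z^2)).sqrt (by positivity)).hasDerivWithinAt (s := Ioi 0)
    have h5 : ((2:ℕ):ℝ) * q ^ (2 - 1) / (2 * √(z^2 + q^2)) = q / √(z^2 + q^2) := by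
      have hs : 0 < √(z^2 + q^2) := Real.sqrt_pos.2 (by positivity)
      push_cast
      rw [mul_div_mul_left _ _ (two_ne_zero' ℝ)]
      simp
    rw [h5] at this
    exact this
  rw [← himg, lintegral_image_eq_lintegral_abs_deriv_mul measurableSet_Ioi hder hinj]
  refine setLIntegral_congr_fun measurableSet_Ioi fun q hq => ?_
  have hq : 0 < q := hq
  have hs : 0 < √(z^2 + q^2) := Real.sqrt_pos.2 (by positivity)
  rw [← mul_assoc, ← ENNReal.ofReal_mul (abs_nonneg _), abs_of_pos (by positivity),
    mul_right_comm, ← ENNReal.ofReal_mul hq.le]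
  congr 2
  field_simp
  ring

lemma cyl (F : ℝ → ℝ → ℝ≥0∞) (hF : Measurable (Function.uncurry F)) :
    ∫⁻ y : E3, F (y 0) ‖y‖ =
      ∫⁻ s in Ioi (0:ℝ), ENNReal.ofReal (2 * π * s) * ∫⁻ z in Ioo (-s) s, F z s := by
  simp only [norm3]
  have hm : Measurable (fun q : ℝ × (ℝ × ℝ) => F q.1 (√(q.1^2 + (q.2.1^2 + q.2.2^2)))) := by
    have : Measurable (fun q : ℝ × (ℝ × ℝ) => (q.1, √(q.1^2 + (q.2.1^2 + q.2.2^2)))) := by fun_prop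
    exact hF.comp this
  rw [cart (fun q => F q.1 (√(q.1^2 + (q.2.1^2 + q.2.2^2)))) hm]
  have h1 : ∀ z : ℝ, ∫⁻ p : ℝ × ℝ, F z (√(z^2 + (p.1^2 + p.2^2))) =
      ∫⁻ s : ℝ, {q : ℝ × ℝ | |q.1| < q.2}.indicator (fun q => ENNReal.ofReal (2 * π * q.2) * F q.1 q.2) (z, s) := by
    intro z
    rw [radial2 z (F z) (hF.comp measurable_prodMk_left), ← lintegral_indicator measurableSet_Ioi]
    rfl
  simp only [h1]
  rw [lintegral_lintegral_swap]
  swap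
  · refine Measurable.aemeasurable ?_
    refine Measurable.indicator ?_ (measurableSet_lt (by fun_prop) (by fun_prop))
    have h3 : Measurable (fun q : ℝ × ℝ => F q.1 q.2) := hF
    fun_prop
  rw [← lintegral_indicator measurableSet_Ioi]
  refine lintegral_congr fun s => ?_
  by_cases hs : 0 < s
  · rw [indicator_of_mem (mem_Ioi.2 hs), ← lintegral_const_mul' _ _ ENNReal.ofReal_ne_top,
      ← lintegral_indicator measurableSet_Ioo]
    refine lintegral_congr fun z => ?_
    simp only [indicator, mem_ofPred_eq, mem_Ioo, abs_lt]
  · rw [indicator_of_notMem (by simpa using hs)]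
    rw [lintegral_eq_zero_iff' (by
      refine Measurable.aemeasurable ?_
      have h3 : Measurable (fun q : ℝ × ℝ => F q.1 q.2) := hF
      have h4 : Measurable ({q : ℝ × ℝ | |q.1| < q.2}.indicator (fun q => ENNReal.ofReal (2 * π * q.2) * F q.1 q.2)) :=
        Measurable.indicator (by fun_prop) (measurableSet_lt (by fun_prop) (by fun_prop))
      exact h4.comp measurable_prodMk_right)]
    refine Eventually.of_forall fun z => ?_
    refine indicator_of_notMem ?_ _
    simp only [mem_ofPred_eq, not_lt]
    exact (not_lt.1 hs).trans (abs_nonneg z)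

lemma inner_int {r s : ℝ} (hr : 0 < r) (hs : 0 < s) :
    ∫⁻ z in Ioo (-s) s, ENNReal.ofReal (1 / √(r^2 + s^2 - 2 * r * z)) =
      ∫⁻ z in Ioo (-s) s, ENNReal.ofReal (1 / max r s) := by
  have hle : -s ≤ s := by linarith
  have hI : ∫ z in (-s)..s, 1 / √(r^2 + s^2 - 2 * r * z) = 2 * s / max r s := by
    rw [intervalIntegral.integral_comp_sub_mul (fun x => 1 / √x) (by positivity)]
    have h := sqrt_ftc (r ^ 2 + s ^ 2 - 2 * r * s) (r ^ 2 + s ^ 2 - 2 * r * -s) 0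
    simp only [sub_zero] at h
    rw [h, max_eq_left (by nlinarith), max_eq_left (by nlinarith [sq_nonneg (r - s)]),
      show r ^ 2 + s ^ 2 - 2 * r * -s = (r + s)^2 by ring,
      show r ^ 2 + s ^ 2 - 2 * r * s = (r - s)^2 by ring, Real.sqrt_sq (by positivity),
      Real.sqrt_sq_eq_abs, smul_eq_mul]
    rcases le_total r s with h | h
    · rw [max_eq_right h, abs_of_nonpos (by linarith)]; field_simp; ring
    · rw [max_eq_left h, abs_of_nonneg (by linarith)]; field_simp; ring
  have hint : IntervalIntegrable (fun z => 1 / √(r^2 + s^2 - 2 * r * z)) volume (-s) s := by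
    by_contra hn
    rw [intervalIntegral.integral_undef hn] at hI
    have : 0 < 2 * s / max r s := by
      have : 0 < max r s := lt_max_of_lt_left hr
      positivity
    linarith
  rw [intervalIntegrable_iff_integrableOn_Ioo_of_le hle] at hint
  rw [intervalIntegral.integral_of_le hle, integral_Ioc_eq_integral_Ioo] at hI
  rw [← ofReal_integral_eq_lintegral_ofReal hint (Eventually.of_forall fun z => by positivity), hI,
    lintegral_const, Measure.restrict_apply MeasurableSet.univ, univ_inter, Real.volume_Ioo,
    ← ENNReal.ofReal_mul (by positivity)]
  congr 1
  ring

abbrev e0 : E3 := EuclideanSpace.single (0 : Fin 3) (1:ℝ)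

lemma norm_re0 (r : ℝ) (y : E3) : ‖r • e0 - y‖ = √(r^2 + ‖y‖^2 - 2 * r * y 0) := by
  rw [← Real.sqrt_sq (norm_nonneg _), norm_sub_sq_real, norm_smul, inner_smul_left,
    EuclideanSpace.inner_single_left]
  congr 1
  simp
  ring

lemma newton (ρ : E3 → ℝ) (hm : Measurable ρ) (h0 : ∀ y, 0 ≤ ρ y) (hrad : ∀ y, ρ y = ρ (‖y‖ • e0))
    {r : ℝ} (hr : 0 < r) :
    ∫ y, ρ y / (4 * π * ‖r • e0 - y‖) = ∫ y, ρ y / (4 * π) * (max r ‖y‖)⁻¹ := by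
  have hm3 : AEStronglyMeasurable (fun y : E3 => ρ y / (4 * π * ‖r • e0 - y‖)) volume :=
    Measurable.aestronglyMeasurable
      (hm.div (measurable_const.mul (measurable_const.sub measurable_id).norm))
  have hm4 : AEStronglyMeasurable (fun y : E3 => ρ y / (4 * π) * (max r ‖y‖)⁻¹) volume :=
    Measurable.aestronglyMeasurable (by fun_prop)
  have hp3 : 0 ≤ᵐ[volume] (fun y : E3 => ρ y / (4 * π * ‖r • e0 - y‖)) :=
    Eventually.of_forall fun y => by
      have := h0 y
      simp only [Pi.zero_apply]; positivity
  have hp4 : 0 ≤ᵐ[volume] (fun y : E3 => ρ y / (4 * π) * (max r ‖y‖)⁻¹) :=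
    Eventually.of_forall fun y => by
      have := h0 y
      have h2 : 0 < max r ‖y‖ := lt_max_of_lt_left hr
      simp only [Pi.zero_apply]; positivity
  rw [integral_eq_lintegral_of_nonneg_ae hp3 hm3, integral_eq_lintegral_of_nonneg_ae hp4 hm4]
  congr 1
  have hm2 : Measurable (fun s : ℝ => ρ (s • e0)) := by fun_prop
  have e1 : ∀ y : E3, ENNReal.ofReal (ρ y / (4 * π * ‖r • e0 - y‖)) =
      (fun z s => ENNReal.ofReal (ρ (s • e0) / (4 * π)) * ENNReal.ofReal (1 / √(r^2 + s^2 - 2 * r * z))) (y 0) ‖y‖ := by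
    intro y
    simp only
    have := h0 (‖y‖ • e0)
    rw [← hrad, ← ENNReal.ofReal_mul (by rw [← hrad] at this; positivity), norm_re0]
    congr 1
    rw [div_mul_div_comm, mul_one]
  have e2 : ∀ y : E3, ENNReal.ofReal (ρ y / (4 * π) * (max r ‖y‖)⁻¹) =
      (fun z s => ENNReal.ofReal (ρ (s • e0) / (4 * π)) * ENNReal.ofReal (1 / max r s)) (y 0) ‖y‖ := by
    intro y
    simp only
    have := h0 (‖y‖ • e0)
    rw [← hrad, ← ENNReal.ofReal_mul (by rw [← hrad] at this; positivity), one_div]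
  simp only [e1, e2]
  rw [cyl (fun z s => ENNReal.ofReal (ρ (s • e0) / (4 * π)) * ENNReal.ofReal (1 / √(r^2 + s^2 - 2 * r * z))) (by
    unfold Function.uncurry
    fun_prop), cyl (fun z s => ENNReal.ofReal (ρ (s • e0) / (4 * π)) * ENNReal.ofReal (1 / max r s)) (by
    unfold Function.uncurry
    fun_prop)]
  refine setLIntegral_congr_fun measurableSet_Ioi fun s hs => ?_
  rw [lintegral_const_mul' _ _ ENNReal.ofReal_ne_top, lintegral_const_mul' _ _ ENNReal.ofReal_ne_top, inner_int hr hs]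

lemma rot (y : E3) : ∃ R : E3 ≃ₗᵢ[ℝ] E3, LinearMap.det (R.toLinearEquiv : E3 →ₗ[ℝ] E3) = 1 ∧
    R y = ‖y‖ • e0 := by
  by_cases hy : y = ‖y‖ • e0
  · exact ⟨LinearIsometryEquiv.refl ℝ E3, by
      show LinearMap.det LinearMap.id = 1
      simp, hy⟩
  have hn : ‖y‖ = ‖‖y‖ • e0‖ := by rw [norm_smul]; simp
  set K1 : Submodule ℝ E3 := (ℝ ∙ (y - ‖y‖ • e0))ᗮ with hK1
  set K2 : Submodule ℝ E3 := (ℝ ∙ (EuclideanSpace.single (1 : Fin 3) (1:ℝ) : E3))ᗮ with hK2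
  refine ⟨K1.reflection.trans K2.reflection, ?_, ?_⟩
  · have hc : ((K1.reflection.trans K2.reflection).toLinearEquiv : E3 →ₗ[ℝ] E3) =
      (K2.reflection.toLinearEquiv : E3 →ₗ[ℝ] E3) ∘ₗ (K1.reflection.toLinearEquiv : E3 →ₗ[ℝ] E3) := rfl
    rw [hc, LinearMap.det_comp, Submodule.det_reflection, Submodule.det_reflection, hK1, hK2,
      Submodule.orthogonal_orthogonal, Submodule.orthogonal_orthogonal,
      finrank_span_singleton (sub_ne_zero.2 hy), finrank_span_singleton (by
        intro h
        have := congrArg (fun v : E3 => v 1) h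
        simp at this)]
    norm_num
  · have h1 : K1.reflection y = ‖y‖ • e0 := Submodule.reflection_sub hn
    rw [LinearIsometryEquiv.trans_apply, h1]
    refine Submodule.reflection_mem_subspace_eq_self ?_
    rw [hK2, Submodule.mem_orthogonal_singleton_iff_inner_right, inner_smul_right,
      EuclideanSpace.inner_single_left]
    simp


def mm (u s : ℝ) : ℝ := (max u⁻¹ s)⁻¹

lemma mm_pos {u s : ℝ} (hu : 0 < u) : 0 < mm u s :=
  inv_pos.2 (lt_max_of_lt_left (inv_pos.2 hu))

lemma mm_le {u s : ℝ} (hu : 0 < u) : mm u s ≤ u := by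
  unfold mm
  exact inv_le_of_inv_le₀ hu (le_max_left _ _)

lemma mm_mul {u s : ℝ} (hu : 0 < u) : s * mm u s ≤ 1 := by
  have h : 0 < max u⁻¹ s := lt_max_of_lt_left (inv_pos.2 hu)
  unfold mm
  rw [← div_eq_mul_inv, div_le_one h]
  exact le_max_right _ _

lemma le_mm {u s v : ℝ} (hv : 0 < v) (h1 : v ≤ u) (h2 : s * v ≤ 1) : v ≤ mm u s := by
  have hu : 0 < u := hv.trans_le h1
  have h : 0 < max u⁻¹ s := lt_max_of_lt_left (inv_pos.2 hu)
  unfold mm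
  rw [le_inv_comm₀ hv h]
  refine max_le (inv_anti₀ hv h1) ?_
  rwa [← one_div, le_div_iff₀ hv]

section
variable {ρ : E3 → ℝ}

def hh (ρ : E3 → ℝ) (u : ℝ) : ℝ := ∫ y, ρ y / (4 * π) * mm u ‖y‖

lemma hh_int (hi : Integrable ρ) {u : ℝ} (hu : 0 < u) : 
    Integrable (fun y => ρ y / (4 * π) * mm u ‖y‖) := by
  refine (hi.div_const (4 * π)).mul_bdd (c := u) ?_ ?_
  · unfold mm
    exact Measurable.aestronglyMeasurable (by fun_prop)
  · refine Eventually.of_forall fun y => ?_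
    rw [Real.norm_of_nonneg (mm_pos hu).le]
    exact mm_le hu

lemma hh_concave (h0 : ∀ y, 0 ≤ ρ y) (hi : Integrable ρ) : ConcaveOn ℝ (Ioi 0) (hh ρ) := by
  refine ⟨convex_Ioi _, ?_⟩
  intro x hx y hy a b ha hb hab
  have hz : 0 < a • x + b • y := convex_Ioi (0:ℝ) hx hy ha hb hab
  have hx : 0 < x := hx
  have hy : 0 < y := hy
  unfold hh
  simp only [smul_eq_mul] at hz ⊢
  rw [← integral_const_mul, ← integral_const_mul,
    ← integral_add ((hh_int hi hx).const_mul a) ((hh_int hi hy).const_mul b)]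
  refine integral_mono (((hh_int hi hx).const_mul a).add ((hh_int hi hy).const_mul b)) (hh_int hi hz) ?_
  intro w
  simp only
  have hw : 0 ≤ ρ w / (4 * π) := div_nonneg (h0 w) (by positivity)
  have key : a * mm x ‖w‖ + b * mm y ‖w‖ ≤ mm (a * x + b * y) ‖w‖ := by
    have p1 := mm_pos (s := ‖w‖) hx
    have p2 := mm_pos (s := ‖w‖) hy
    have q1 := mm_le (s := ‖w‖) hx
    have q2 := mm_le (s := ‖w‖) hy
    have s1 := mm_mul (s := ‖w‖) hx
    have s2 := mm_mul (s := ‖w‖) hy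
    refine le_mm ?_ ?_ ?_
    · rcases ha.eq_or_lt with h | h
      · have : b = 1 := by linarith
        rw [← h, this]; linarith
      · have := mul_pos h p1
        have := mul_nonneg hb p2.le
        linarith
    · gcongr
    · nlinarith
  nlinarith

lemma hh_ub (h0 : ∀ y, 0 ≤ ρ y) (hi : Integrable ρ) {u : ℝ} (hu : 0 < u) :
    hh ρ u ≤ (∫ y, ρ y / (4 * π)) * u := by
  rw [← integral_mul_const]
  refine integral_mono (hh_int hi hu) ((hi.div_const _).mul_const _) fun w => ?_
  have hw : 0 ≤ ρ w / (4 * π) := div_nonneg (h0 w) (by positivity)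
  exact mul_le_mul_of_nonneg_left (mm_le hu) hw

lemma hh_lb (h0 : ∀ y, 0 ≤ ρ y) (hi : Integrable ρ) {u : ℝ} (hu : 0 < u) (hu1 : u ≤ 1) :
    hh ρ 1 * u ≤ hh ρ u := by
  unfold hh
  rw [← integral_mul_const]
  refine integral_mono ((hh_int hi one_pos).mul_const _) (hh_int hi hu) fun w => ?_
  have hw : 0 ≤ ρ w / (4 * π) := div_nonneg (h0 w) (by positivity)
  simp only
  rw [mul_assoc]
  refine mul_le_mul_of_nonneg_left ?_ hw
  have p := mm_pos (s := ‖w‖) one_pos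
  have q := mm_le (s := ‖w‖) one_pos
  have s := mm_mul (s := ‖w‖) one_pos
  refine le_mm (by positivity) (by nlinarith) ?_
  have : 0 ≤ ‖w‖ * mm 1 ‖w‖ := mul_nonneg (norm_nonneg _) p.le
  nlinarith

lemma hh_pos (h0 : ∀ y, 0 ≤ ρ y) (hi : Integrable ρ) (hne : ¬ ρ =ᵐ[volume] 0) : 0 < hh ρ 1 := by
  have hnn : 0 ≤ fun y => ρ y / (4 * π) * mm 1 ‖y‖ := fun y =>
    mul_nonneg (div_nonneg (h0 y) (by positivity)) (mm_pos one_pos).le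
  refine lt_of_le_of_ne (integral_nonneg hnn) fun h => hne ?_
  have := (integral_eq_zero_iff_of_nonneg hnn (hh_int hi one_pos)).1 h.symm
  filter_upwards [this] with y hy
  have p := mm_pos (s := ‖y‖) one_pos
  simp only [Pi.zero_apply, mul_eq_zero, p.ne', or_false, div_eq_zero_iff] at hy ⊢
  rcases hy with h | h
  · exact h
  · have := Real.pi_pos
    rcases h with h | h <;> linarith

lemma exWP (h0 : ∀ y, 0 ≤ ρ y) (hi : Integrable ρ) (hne : ¬ ρ =ᵐ[volume] 0) {ℓ : ℝ} (hℓ : 0 < ℓ) :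
    ∃ u0 M B c δ, WP (fun u => ℓ / 2 * u^2 - hh ρ u) u0 M B c δ := by
  set G : ℝ → ℝ := fun u => ℓ / 2 * u^2 - hh ρ u with hG
  set M := ∫ y, ρ y / (4 * π) with hM
  have hc := hh_pos h0 hi hne
  set c := hh ρ 1 with hcc
  have hMp : 0 < M := by
    have := hh_ub h0 hi one_pos
    linarith
  have hcvx : ConvexOn ℝ (Ioi 0) G := by
    have h1 : ConvexOn ℝ (Ioi (0:ℝ)) (fun u : ℝ => ℓ / 2 * u^2) := by
      have h2 : ConvexOn ℝ (Ioi (0:ℝ)) (fun u : ℝ => u^2) :=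
        (Even.convexOn_pow (even_two)).subset (subset_univ _) (convex_Ioi _)
      exact h2.smul (by positivity)
    exact h1.sub (hh_concave h0 hi)
  have hlb : ∀ u, 0 < u → -M * u ≤ G u := by
    intro u hu
    have := hh_ub h0 hi hu
    have h2 : 0 ≤ ℓ / 2 * u^2 := by positivity
    simp only [hG]; linarith
  have hbig : ∀ u, 2 * M / ℓ ≤ u → 0 ≤ G u := by
    intro u hu
    have hu0 : 0 < u := lt_of_lt_of_le (by positivity) hu
    have := hh_ub h0 hi hu0
    rw [div_le_iff₀ hℓ] at hu
    simp only [hG]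
    nlinarith
  have hδ : 0 < min 1 (c / ℓ) := lt_min one_pos (by positivity)
  have hub : ∀ u, 0 < u → u ≤ min 1 (c / ℓ) → G u ≤ -(c/2) * u := by
    intro u hu hu2
    have := hh_lb h0 hi hu (hu2.trans (min_le_left _ _))
    have h3 := hu2.trans (min_le_right _ _)
    rw [le_div_iff₀ hℓ] at h3
    simp only [hG]
    nlinarith
  set δ := min 1 (c / ℓ) with hδd
  set B := 2 * M / ℓ with hB
  have hBp : 0 < B := by positivity
  have hGδ : G δ < 0 := by
    have := hub δ hδ le_rfl
    nlinarith [mul_pos hc hδ]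
  set a := min δ (-G δ / M) with ha
  have hap : 0 < a := lt_min hδ (div_pos (by linarith) hMp)
  have hδB : δ ≤ B := by
    by_contra h
    have := hbig δ (not_le.1 h).le
    linarith
  have hcont : ContinuousOn G (Icc a B) :=
    (ConvexOn.continuousOn isOpen_Ioi hcvx).mono fun x hx => lt_of_lt_of_le hap hx.1
  obtain ⟨u0, hu0, hmin⟩ := isCompact_Icc.exists_isMinOn (nonempty_Icc.2 ((min_le_left _ _).trans hδB)) hcont
  have hmδ : G u0 ≤ G δ := hmin (show δ ∈ Icc a B from ⟨min_le_left _ _, hδB⟩)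
  refine ⟨u0, M, B, c / 2, δ, hcvx, lt_of_lt_of_le hap hu0.1, ?_, hMp, hlb, hBp, hbig, by positivity, hδ, hub⟩
  intro u hu
  by_cases h1 : a ≤ u
  · by_cases h2 : u ≤ B
    · exact hmin (show u ∈ Icc a B from ⟨h1, h2⟩)
    · have := hbig u (not_le.1 h2).le
      linarith
  · have h3 : u ≤ -G δ / M := (not_le.1 h1).le.trans (min_le_right _ _)
    rw [le_div_iff₀ hMp] at h3
    have := hlb u hu
    linarith

end

lemma rho_meas {f : Phase → ℝ} (hf : Measurable f) : Measurable (rhoF f) := by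
  have : StronglyMeasurable (fun x => ∫ v : E3, f (x, v)) :=
    StronglyMeasurable.integral_prod_right (f := fun x v => f (x, v)) hf.stronglyMeasurable
  exact this.measurable

lemma f_int {f : Phase → ℝ} (hf : memE f) : Integrable f := by
  obtain ⟨h1, h2, h3⟩ := hf
  refine memLp_one_iff_integrable.1 ⟨h1.aestronglyMeasurable, ?_⟩
  exact lt_of_le_of_lt (le_self_add.trans le_self_add) h3

lemma rho_int {f : Phase → ℝ} (hf : memE f) : Integrable (rhoF f) :=
  (f_int hf).integral_prod_left

lemma rho_ne {f : Phase → ℝ} (hf : memE f) (hf0 : ¬ f =ᵐ[volume] (0 : Phase → ℝ)) :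
    ¬ rhoF f =ᵐ[volume] 0 := by
  intro h
  have h1 : ∫ x, rhoF f x = 0 := by
    rw [integral_congr_ae h]; simp
  have h2 : ∫ z, f z = ∫ x, rhoF f x := integral_prod f (f_int hf)
  rw [h1] at h2
  exact hf0 ((integral_eq_zero_iff_of_nonneg hf.2.1 (f_int hf)).1 h2)

lemma rho_rad {f : Phase → ℝ} (hf : SphSym f) (y : E3) : rhoF f y = rhoF f (‖y‖ • e0) := by
  obtain ⟨R, hR, hy⟩ := rot y
  rw [← hy]
  unfold rhoF
  have h1 := R.measurePreserving.integral_comp' (f := R.toMeasurableEquiv) (fun v => f (R y, v))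
  rw [← h1]
  refine integral_congr_ae (Eventually.of_forall fun v => ?_)
  exact (hf R hR (y, v)).symm

lemma psi_eq {f : Phase → ℝ} (hf : memErad f) (ℓ : ℝ) (r : ℝ) (hr : 0 < r) :
    psiPot (phiRad f) ℓ r = (fun u => ℓ / 2 * u^2 - hh (rhoF f) u) r⁻¹ := by
  have := newton (rhoF f) (rho_meas hf.1.1) (fun y => integral_nonneg fun v => hf.1.2.1 _)
    (rho_rad hf.2) hr
  unfold psiPot phiRad phiF
  rw [this]
  simp only [hh, mm, inv_inv]
  field_simp
  ring

end Aux8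

/-- `e ↦ a_φ(e,ℓ)` is a strictly increasing C¹ diffeomorphism from `(e_{φ,ℓ},0)` onto
`(0,∞)` with explicit positive derivative. -/
theorem stmt8 (f : Phase → ℝ) (hf : memErad f)
    (hf0 : ¬ f =ᵐ[volume] (0 : Phase → ℝ)) (ℓ : ℝ) (hℓ : 0 < ℓ) :
    StrictMonoOn (fun e => aPot (phiRad f) e ℓ) (Ioo (eMinPot (phiRad f) ℓ) 0) ∧
    ContDiffOn ℝ 1 (fun e => aPot (phiRad f) e ℓ) (Ioo (eMinPot (phiRad f) ℓ) 0) ∧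
    (fun e => aPot (phiRad f) e ℓ) '' Ioo (eMinPot (phiRad f) ℓ) 0 = Ioi 0 ∧
    ∀ e ∈ Ioo (eMinPot (phiRad f) ℓ) 0,
      HasDerivAt (fun e' => aPot (phiRad f) e' ℓ)
        (4 * π ^ 2 * Real.sqrt 2 *
          ∫ r in (r1Pot (phiRad f) e ℓ)..(r2Pot (phiRad f) e ℓ),
            1 / Real.sqrt (e - psiPot (phiRad f) ℓ r)) e ∧
      0 < 4 * π ^ 2 * Real.sqrt 2 *
          ∫ r in (r1Pot (phiRad f) e ℓ)..(r2Pot (phiRad f) e ℓ),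
            1 / Real.sqrt (e - psiPot (phiRad f) ℓ r) := by
  obtain ⟨u0, M, B, c, δ, H⟩ := Aux8.exWP (ρ := rhoF f)
    (fun y => integral_nonneg fun v => hf.1.2.1 _) (Aux8.rho_int hf.1) (Aux8.rho_ne hf.1 hf0) hℓ
  have hC : 0 < 8 * π ^ 2 * Real.sqrt 2 := by positivity
  obtain ⟨h1, h2, h3, h4, h5⟩ := Aux8.main H (Aux8.psi_eq hf ℓ) hC
  have h6 : eMinPot (phiRad f) ℓ = _ := h1
  rw [h6]
  refine ⟨h2, h3, h4, ?_⟩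
  intro e he
  have h7 := h5 e he
  rw [show 8 * π ^ 2 * Real.sqrt 2 / 2 = 4 * π ^ 2 * Real.sqrt 2 by ring] at h7
  exact h7
end
end

section
/- Let ℓ > 0 and s > 0, let φ = φ_f and φ̃ = φ_{f̃} be nonzero elements of Φ_rad, and set h = φ̃ − φ. Then the map λ ↦ a_{φ+λh}^{−1}(s,ℓ) is differentiable on [0,1] and ∂/∂λ a_{φ+λh}^{−1}(s,ℓ) = [∫_{r₁}^{r₂} (a_{φ+λh}^{−1}(s,ℓ) − ψ_{φ,ℓ}(r) − λh(r))^{−1/2} h(r) dr] / [∫_{r₁}^{r₂} (a_{φ+λh}^{−1}(s,ℓ) − ψ_{φ,ℓ}(r) − λh(r))^{−1/2} dr], where r_i = r_i(φ+λh, a_{φ+λh}^{−1}(s,ℓ), ℓ) for i = 1,2. -/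
noncomputable section

open MeasureTheory Real Filter Set Topology
open scoped ENNReal NNReal

/-- The interpolated potential `φ + λ(φ̃ - φ)`. -/
def combPot (f g : Phase → ℝ) (lam r : ℝ) : ℝ :=
  phiRad f r + lam * (phiRad g r - phiRad f r)


lemma sqrt_pert (Q x : ℝ) (hQ : Q ≠ 0) : |√(Q + x) - √Q| ≤ |x| / √|Q| := by
  rcases lt_or_gt_of_ne hQ with h | h
  · rw [Real.sqrt_eq_zero_of_nonpos h.le, abs_of_neg h, sub_zero, abs_of_nonneg (Real.sqrt_nonneg _)]
    rcases le_or_gt (Q + x) 0 with h1 | h1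
    · rw [Real.sqrt_eq_zero_of_nonpos h1]; positivity
    · have hx : 0 < x := by linarith
      rw [abs_of_pos hx, le_div_iff₀ (Real.sqrt_pos.2 (by linarith))]
      calc √(Q + x) * √(-Q) ≤ √x * √x := by
            gcongr
            · linarith
            · linarith
        _ = x := Real.mul_self_sqrt hx.le
  · rw [abs_of_pos h]
    have hs := Real.sqrt_pos.2 h
    rw [le_div_iff₀ hs]
    rcases le_or_gt (Q + x) 0 with h1 | h1
    · rw [Real.sqrt_eq_zero_of_nonpos h1, zero_sub, abs_neg, abs_of_pos hs, Real.mul_self_sqrt h.le,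
        abs_of_neg (by linarith)]
      linarith
    · have h2 := Real.sqrt_nonneg (Q + x)
      have e : |x| = |√(Q + x) - √Q| * (√(Q + x) + √Q) := by
        rw [← abs_of_nonneg (add_nonneg h2 hs.le), ← abs_mul]
        congr 1
        nlinarith [Real.mul_self_sqrt h.le, Real.mul_self_sqrt h1.le]
      rw [e]
      gcongr
      linarith

lemma sqrt_line_deriv (Q d : ℝ) (hQ : Q ≠ 0) :
    HasDerivAt (fun t : ℝ => √(Q + t * d)) (d / (2 * √Q)) 0 := by
  have h1 : HasDerivAt (fun t : ℝ => Q + t * d) d 0 := by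
    simpa using ((hasDerivAt_id (0:ℝ)).mul_const d).const_add Q
  rcases lt_or_gt_of_ne hQ with h | h
  · rw [Real.sqrt_eq_zero_of_nonpos h.le]
    simp only [mul_zero, div_zero]
    refine (hasDerivAt_const (0:ℝ) (0:ℝ)).congr_of_eventuallyEq ?_
    have : ∀ᶠ t in 𝓝 (0:ℝ), Q + t * d < 0 :=
      h1.continuousAt.eventually_lt continuousAt_const (by simpa using h)
    filter_upwards [this] with t ht
    exact Real.sqrt_eq_zero_of_nonpos ht.le
  · have := h1.sqrt (by simpa using hQ)
    simpa using this

lemma int_inv_sqrt (a b c : ℝ) : IntegrableOn (fun r => 1 / √|r - c|) (Icc a b) := by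
  have key : ∀ x y : ℝ, IntervalIntegrable (fun r => 1 / √|r|) volume x y := by
    have hpos : ∀ y : ℝ, 0 ≤ y → IntervalIntegrable (fun r => 1 / √|r|) volume 0 y := by
      intro y hy
      have := (intervalIntegral.intervalIntegrable_rpow' (a := 0) (b := y) (r := -(1/2:ℝ)) (by norm_num))
      refine this.congr ?_
      intro r hr
      rw [uIoc_of_le hy] at hr
      have h0 := hr.1
      simp only
      rw [Real.rpow_neg h0.le, ← Real.sqrt_eq_rpow, abs_of_pos h0, one_div]
    have h0 : ∀ y : ℝ, IntervalIntegrable (fun r => 1 / √|r|) volume 0 y := by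
      intro y
      rcases le_total 0 y with h | h
      · exact hpos y h
      · have := (hpos (-y) (by linarith)).comp_sub_left 0
        simpa using this
    intro x y
    exact (h0 x).symm.trans (h0 y)
  rcases le_total a b with h | h
  · rw [integrableOn_Icc_iff_integrableOn_Ioc, ← intervalIntegrable_iff_integrableOn_Ioc_of_le h]
    have := (key (a - c) (b - c)).comp_sub_right c
    simpa using this
  · rcases eq_or_lt_of_le h with h | h
    · subst h; simp
    · simp [Icc_eq_empty (not_le.2 h)]

lemma deriv_core (Q δ : ℝ → ℝ) (a b r1 r2 k D : ℝ) (hr : r1 < r2) (hk : 0 < k)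
    (hQc : ContinuousOn Q (Icc a b)) (hδc : ContinuousOn δ (Icc a b))
    (hQ : ∀ r ∈ Icc a b, k * |r - r1| * |r - r2| ≤ |Q r|)
    (hD : ∀ r ∈ Icc a b, |δ r| ≤ D) :
    IntegrableOn (fun r => δ r / √(Q r)) (Icc a b) ∧
    HasDerivAt (fun t => ∫ r in Icc a b, √(Q r + t * δ r))
      ((∫ r in Icc a b, δ r / √(Q r)) / 2) 0 := by
  set w := (r2 - r1) / 2 with hw
  have hwp : 0 < w := by simp only [hw]; linarith
  have hms : MeasurableSet (Icc a b) := measurableSet_Icc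
  have hae : ∀ᵐ r ∂(volume.restrict (Icc a b)), r ∈ Icc a b ∧ r ≠ r1 ∧ r ≠ r2 := by
    refine (ae_restrict_mem hms).and (ae_restrict_of_ae ?_)
    have h1 : ∀ᵐ r : ℝ, r ≠ r1 := by simp [ae_iff, measure_singleton]
    have h2 : ∀ᵐ r : ℝ, r ≠ r2 := by simp [ae_iff, measure_singleton]
    exact h1.and h2
  have hbd : ∀ r ∈ Icc a b, r ≠ r1 → r ≠ r2 → Q r ≠ 0 ∧
      1 / √|Q r| ≤ 1 / √(k * w) * (1 / √|r - r1| + 1 / √|r - r2|) := by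
    intro r hrm n1 n2
    have p1 : 0 < |r - r1| := abs_pos.2 (sub_ne_zero.2 n1)
    have p2 : 0 < |r - r2| := abs_pos.2 (sub_ne_zero.2 n2)
    have hq := hQ r hrm
    have hq0 : 0 < |Q r| := lt_of_lt_of_le (by positivity) hq
    refine ⟨abs_pos.1 hq0, ?_⟩
    have hsum : 2 * w ≤ |r - r1| + |r - r2| := by
      have := abs_sub_le r2 r r1
      rw [abs_sub_comm r2 r] at this
      have := le_abs_self (r2 - r1)
      simp only [hw]; linarith
    rw [mul_add]
    have s1 : 0 < √|r - r1| := Real.sqrt_pos.2 p1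
    have s2 : 0 < √|r - r2| := Real.sqrt_pos.2 p2
    have s0 : 0 < √(k * w) := Real.sqrt_pos.2 (by positivity)
    rcases le_total w |r - r1| with h | h
    · have : k * w * |r - r2| ≤ |Q r| := le_trans (by gcongr) hq
      have h3 : √(k * w) * √|r - r2| ≤ √|Q r| := by
        rw [← Real.sqrt_mul (by positivity)]; exact Real.sqrt_le_sqrt this
      have h4 : 1 / √|Q r| ≤ 1 / (√(k * w) * √|r - r2|) := by gcongr
      rw [← one_div_mul_one_div] at h4
      have : 0 ≤ 1 / √(k * w) * (1 / √|r - r1|) := by positivity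
      linarith
    · have h' : w ≤ |r - r2| := by linarith
      have : k * w * |r - r1| ≤ |Q r| := by
        refine le_trans ?_ hq
        calc k * w * |r - r1| = k * |r - r1| * w := by ring
          _ ≤ _ := by gcongr
      have h3 : √(k * w) * √|r - r1| ≤ √|Q r| := by
        rw [← Real.sqrt_mul (by positivity)]; exact Real.sqrt_le_sqrt this
      have h4 : 1 / √|Q r| ≤ 1 / (√(k * w) * √|r - r1|) := by gcongr
      rw [← one_div_mul_one_div] at h4
      have : 0 ≤ 1 / √(k * w) * (1 / √|r - r2|) := by positivity
      linarith
  have hmeas : ∀ t : ℝ, AEStronglyMeasurable (fun r => √(Q r + t * δ r)) (volume.restrict (Icc a b)) := by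
    intro t
    refine ContinuousOn.aestronglyMeasurable ?_ hms
    exact (hQc.add (continuousOn_const.mul hδc)).sqrt
  set bd : ℝ → ℝ := fun r => D * (1 / √(k * w) * (1 / √|r - r1| + 1 / √|r - r2|)) with hbdd
  have hbi : Integrable bd (volume.restrict (Icc a b)) :=
    (((int_inv_sqrt a b r1).add (int_inv_sqrt a b r2)).const_mul _).const_mul _
  have hm1 : AEStronglyMeasurable (fun r => δ r / √(Q r)) (volume.restrict (Icc a b)) := by
    refine AEMeasurable.aestronglyMeasurable ?_
    exact (hδc.aemeasurable hms).div (hQc.sqrt.aemeasurable hms)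
  have hm2 : AEStronglyMeasurable (fun r => δ r / (2 * √(Q r))) (volume.restrict (Icc a b)) := by
    refine AEMeasurable.aestronglyMeasurable ?_
    exact (hδc.aemeasurable hms).div ((hQc.sqrt.aemeasurable hms).const_mul 2)
  constructor
  · refine Integrable.mono' hbi hm1 ?_
    filter_upwards [hae] with r hr'
    obtain ⟨hrm, n1, n2⟩ := hr'
    have hD0 : 0 ≤ D := (abs_nonneg _).trans (hD r hrm)
    obtain ⟨hq0, hb⟩ := hbd r hrm n1 n2
    rw [Real.norm_eq_abs, abs_div, abs_of_nonneg (Real.sqrt_nonneg _)]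
    have : 1 / √(Q r) ≤ 1 / √|Q r| := by
      rcases lt_or_gt_of_ne hq0 with h | h
      · rw [Real.sqrt_eq_zero_of_nonpos h.le]; simp
      · rw [abs_of_pos h]
    calc |δ r| / √(Q r) = |δ r| * (1 / √(Q r)) := by ring
      _ ≤ D * (1 / √|Q r|) := by
        apply mul_le_mul (hD r hrm) this (by positivity) hD0
      _ ≤ _ := by simp only [hbdd]; gcongr
  · have hi0 : Integrable (fun r => √(Q r + (0:ℝ) * δ r)) (volume.restrict (Icc a b)) :=
      ((hQc.add (continuousOn_const.mul hδc)).sqrt).integrableOn_compact isCompact_Icc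
    have := hasFDerivAt_integral_of_dominated_loc_of_lip' (𝕜 := ℝ) (μ := volume.restrict (Icc a b))
      (F := fun (t : ℝ) r => √(Q r + t * δ r)) (x₀ := (0:ℝ)) (s := univ) (bound := bd)
      (F' := fun r => ContinuousLinearMap.toSpanSingleton ℝ (δ r / (2 * √(Q r))))
      univ_mem (fun t _ => hmeas t) hi0
      (by
        have hc : Continuous (fun x : ℝ => ContinuousLinearMap.toSpanSingleton ℝ x) :=
          (ContinuousLinearMap.toSpanSingletonCLE (𝕜 := ℝ) (E := ℝ)).continuous
        exact hc.comp_aestronglyMeasurable hm2)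
      (by
        filter_upwards [hae] with r hr'
        obtain ⟨hrm, n1, n2⟩ := hr'
        obtain ⟨hq0, hb⟩ := hbd r hrm n1 n2
        intro t _
        have hD0 : 0 ≤ D := (abs_nonneg _).trans (hD r hrm)
        simp only [zero_mul, add_zero, sub_zero, Real.norm_eq_abs]
        refine (sqrt_pert (Q r) (t * δ r) hq0).trans ?_
        rw [abs_mul]
        calc |t| * |δ r| / √|Q r| = |δ r| * (1 / √|Q r|) * |t| := by ring
          _ ≤ D * (1 / √(k * w) * (1 / √|r - r1| + 1 / √|r - r2|)) * |t| := by
            gcongr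
            exact hD r hrm)
      hbi
      (by
        filter_upwards [hae] with r hr'
        obtain ⟨hrm, n1, n2⟩ := hr'
        exact (sqrt_line_deriv (Q r) (δ r) (hbd r hrm n1 n2).1).hasFDerivAt)
    obtain ⟨hI, hd⟩ := this
    have h2 := hd.hasDerivAt
    rw [ContinuousLinearMap.integral_apply hI] at h2
    simp only [ContinuousLinearMap.toSpanSingleton_apply, one_smul] at h2
    rw [← integral_div]
    refine h2.congr_deriv ?_
    congr 1
    ext r
    ring


structure Good (φ : ℝ → ℝ) (C c : ℝ) : Prop where
  hC : 0 < C
  hc : 0 < c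
  cvx : ConvexOn ℝ (Ioi 0) (fun u => φ u⁻¹)
  lb : ∀ r, 0 < r → -(C / r) ≤ φ r
  ub : ∀ r, 1 ≤ r → φ r ≤ -(c / r)

lemma Good.cont {φ : ℝ → ℝ} {C c : ℝ} (h : Good φ C c) : ContinuousOn φ (Ioi 0) := by
  have h1 := h.cvx.continuousOn isOpen_Ioi
  have h2 : ContinuousOn (fun r : ℝ => r⁻¹) (Ioi 0) :=
    continuousOn_inv₀.mono (fun x hx => ne_of_gt hx)
  have := h1.comp h2 (fun x hx => mem_Ioi.2 (inv_pos.2 (mem_Ioi.1 hx)))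
  refine this.congr (fun x _ => ?_)
  simp

lemma Good.mono {φ : ℝ → ℝ} {C c C' c' : ℝ} (h : Good φ C c) (h1 : C ≤ C') (h2 : c' ≤ c)
    (h3 : 0 < c') : Good φ C' c' where
  hC := h.hC.trans_le h1
  hc := h3
  cvx := h.cvx
  lb r hr := by
    have := h.lb r hr
    have : C / r ≤ C' / r := by gcongr
    linarith
  ub r hr := by
    have := h.ub r hr
    have : c' / r ≤ c / r := by gcongr
    linarith

lemma Good.comb {φ χ : ℝ → ℝ} {C c : ℝ} (h : Good φ C c) (h' : Good χ C c) {t : ℝ}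
    (ht : t ∈ Icc (0:ℝ) 1) : Good (fun r => φ r + t * (χ r - φ r)) C c where
  hC := h.hC
  hc := h.hc
  cvx := by
    have e : (fun u : ℝ => (fun r => φ r + t * (χ r - φ r)) u⁻¹)
      = (fun u => (1 - t) • (fun u => φ u⁻¹) u) + (fun u => t • (fun u => χ u⁻¹) u) := by
      ext u; simp; ring
    rw [e]
    exact (h.cvx.smul (by linarith [ht.2])).add (h'.cvx.smul ht.1)
  lb r hr := by
    have := h.lb r hr
    have := h'.lb r hr
    nlinarith [ht.1, ht.2]
  ub r hr := by
    have := h.ub r hr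
    have := h'.ub r hr
    nlinarith [ht.1, ht.2]

lemma three_pt {W : ℝ → ℝ} (h : ConvexOn ℝ (Ioi 0) W) {x y z : ℝ} (hx : 0 < x) (hxy : x < y)
    (hyz : y < z) : (z - x) * W y ≤ (z - y) * W x + (y - x) * W z := by
  have hzx : 0 < z - x := by linarith
  have := h.2 (mem_Ioi.2 hx) (mem_Ioi.2 (by linarith : 0 < z))
    (div_nonneg (by linarith : 0 ≤ z - y) hzx.le) (div_nonneg (by linarith : 0 ≤ y - x) hzx.le)
    (by field_simp; ring)
  have e : ((z - y) / (z - x)) • x + ((y - x) / (z - x)) • z = y := by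
    simp only [smul_eq_mul]; field_simp; ring
  rw [e] at this
  simp only [smul_eq_mul] at this
  calc (z - x) * W y ≤ (z - x) * ((z - y) / (z - x) * W x + (y - x) / (z - x) * W z) := by gcongr
    _ = _ := by field_simp

lemma Q_u {W : ℝ → ℝ} (h : ConvexOn ℝ (Ioi 0) W) {e l p q u : ℝ} (hl : 0 < l) (hp : 0 < p)
    (hpq : p < q) (zp : e - (W p + l / 2 * p ^ 2) = 0) (zq : e - (W q + l / 2 * q ^ 2) = 0)
    (hu : 0 < u) :
    (p < u → u < q → 0 < e - (W u + l / 2 * u ^ 2)) ∧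
    l / 2 * |u - p| * |u - q| ≤ |e - (W u + l / 2 * u ^ 2)| := by
  have wp : W p = e - l / 2 * p ^ 2 := by linarith
  have wq : W q = e - l / 2 * q ^ 2 := by linarith
  have A : p < u → u < q → l / 2 * (u - p) * (q - u) ≤ e - (W u + l / 2 * u ^ 2) := by
    intro h1 h2
    have := three_pt h hp h1 h2
    rw [wp, wq] at this
    have h3 : 0 < q - p := by linarith
    refine le_of_mul_le_mul_left ?_ h3
    nlinarith
  constructor
  · intro h1 h2
    refine lt_of_lt_of_le ?_ (A h1 h2)
    have := sub_pos.2 h1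
    have := sub_pos.2 h2
    positivity
  · rcases lt_trichotomy u p with h1 | h1 | h1
    · have := three_pt h hu h1 hpq
      rw [wp, wq] at this
      have h3 : 0 < q - p := by linarith
      rw [abs_of_neg (sub_neg.2 h1), abs_of_neg (by linarith : u - q < 0), ← abs_neg]
      refine le_trans ?_ (le_abs_self _)
      refine le_of_mul_le_mul_left ?_ h3
      nlinarith
    · subst h1; simp
    · rcases lt_trichotomy u q with h2 | h2 | h2
      · rw [abs_of_pos (sub_pos.2 h1), abs_of_neg (sub_neg.2 h2)]
        refine le_trans ?_ (le_abs_self _)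
        have := A h1 h2
        linarith
      · subst h2; simp
      · have := three_pt h hp hpq h2
        rw [wp, wq] at this
        have h3 : 0 < q - p := by linarith
        rw [abs_of_pos (sub_pos.2 h1), abs_of_pos (sub_pos.2 h2), ← abs_neg]
        refine le_trans ?_ (le_abs_self _)
        refine le_of_mul_le_mul_left ?_ h3
        nlinarith

section good
variable {φ : ℝ → ℝ} {C c : ℝ} (h : Good φ C c) {ℓ : ℝ} (hℓ : 0 < ℓ)
include h hℓ

lemma Good.psi_cont : ContinuousOn (psiPot φ ℓ) (Ioi 0) := by
  refine h.cont.add (continuousOn_const.div (by fun_prop) ?_)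
  intro x hx
  have : (0:ℝ) < x := hx
  positivity

lemma Good.psi_lb {r : ℝ} (hr : 0 < r) : -(C ^ 2 / (2 * ℓ)) ≤ psiPot φ ℓ r := by
  have h1 := h.lb r hr
  unfold psiPot
  have : 0 ≤ (C * r - ℓ) ^ 2 / (2 * ℓ * r ^ 2) := by positivity
  have e : (C * r - ℓ) ^ 2 / (2 * ℓ * r ^ 2) = C ^ 2 / (2 * ℓ) - C / r + ℓ / (2 * r ^ 2) := by
    field_simp; ring
  linarith

lemma Good.supp {e e' r : ℝ} (he : e ≤ e') (he' : e' < 0) (hr : 0 < r)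
    (hp : 0 < e - psiPot φ ℓ r) : r ∈ Icc (ℓ / (2 * C)) (C / (-e')) := by
  have h1 := h.lb r hr
  have hC := h.hC
  unfold psiPot at hp
  have h2 : ℓ / (2 * r ^ 2) < C / r := by linarith
  have h3 : 0 < ℓ / (2 * r ^ 2) := by positivity
  have h4 : -e' < C / r := by linarith
  constructor
  · rw [div_le_iff₀ (by positivity)]
    rw [div_lt_div_iff₀ (by positivity) hr] at h2
    have : ℓ < C * (2 * r) := by
      refine lt_of_mul_lt_mul_right (a := r) ?_ hr.le
      nlinarith
    linarith
  · rw [le_div_iff₀ (by linarith)]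
    rw [lt_div_iff₀ hr] at h4
    linarith

lemma Good.aPot_eq {e e' : ℝ} (he : e ≤ e') (he' : e' < 0) :
    aPot φ e ℓ = 8 * π ^ 2 * √2 * ∫ r in Icc (ℓ / (2 * C)) (C / (-e')), √(e - psiPot φ ℓ r) := by
  unfold aPot
  congr 1
  have hC := h.hC
  have e1 : ∀ r, √(max (e - psiPot φ ℓ r) 0) = √(e - psiPot φ ℓ r) := by
    intro r
    rcases le_total (e - psiPot φ ℓ r) 0 with h | h
    · rw [max_eq_right h, Real.sqrt_eq_zero_of_nonpos h, Real.sqrt_zero]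
    · rw [max_eq_left h]
  simp only [e1]
  refine setIntegral_eq_of_subset_of_forall_sdiff_eq_zero measurableSet_Ioi ?_ ?_
  · intro r hr
    exact lt_of_lt_of_le (by positivity) hr.1
  · intro r hr
    apply Real.sqrt_eq_zero_of_nonpos
    by_contra hcon
    exact hr.2 (h.supp hℓ he he' hr.1 (not_le.1 hcon))

lemma Icc_sub_Ioi {e' : ℝ} : Icc (ℓ / (2 * C)) (C / (-e')) ⊆ Ioi 0 := by
  intro r hr
  have hC := h.hC
  exact lt_of_lt_of_le (by positivity) hr.1

lemma Good.Q_cont (e e' : ℝ) :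
    ContinuousOn (fun r => e - psiPot φ ℓ r) (Icc (ℓ / (2 * C)) (C / (-e'))) :=
  continuousOn_const.sub ((h.psi_cont hℓ).mono (Icc_sub_Ioi h hℓ))

lemma Good.aPot_mono {e e' : ℝ} (he : e ≤ e') (he' : e' < 0) : aPot φ e ℓ ≤ aPot φ e' ℓ := by
  rw [h.aPot_eq hℓ he he', h.aPot_eq hℓ le_rfl he']
  refine mul_le_mul_of_nonneg_left ?_ (by positivity)
  refine setIntegral_mono ?_ ?_ ?_
  · exact ((h.Q_cont hℓ e e').sqrt).integrableOn_compact isCompact_Icc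
  · exact ((h.Q_cont hℓ e' e').sqrt).integrableOn_compact isCompact_Icc
  · intro r
    apply Real.sqrt_le_sqrt
    linarith

lemma Good.aPot_pos {e : ℝ} (hp : 0 < aPot φ e ℓ) :
    ∃ r, 0 < r ∧ 0 < e - psiPot φ ℓ r := by
  by_contra hcon
  push Not at hcon
  have : aPot φ e ℓ = 0 := by
    unfold aPot
    rw [setIntegral_eq_zero_of_forall_eq_zero, mul_zero]
    intro r hr
    rw [max_eq_right (hcon r hr), Real.sqrt_zero]
  linarith

lemma Good.eMin_lt {e : ℝ} (hp : 0 < aPot φ e ℓ) : eMinPot φ ℓ < e := by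
  obtain ⟨r, hr, hq⟩ := h.aPot_pos hℓ hp
  refine csInf_lt_of_lt (a := psiPot φ ℓ r) ?_ (mem_image_of_mem _ hr) (sub_pos.1 hq)
  refine ⟨-(C ^ 2 / (2 * ℓ)), ?_⟩
  rintro _ ⟨r, hr, rfl⟩
  exact h.psi_lb hℓ hr

lemma Good.le_inv {e s : ℝ} (he : e < 0) (h0 : 0 < aPot φ e ℓ) (h1 : aPot φ e ℓ < s) :
    e ≤ aPotInv φ s ℓ :=
  le_csSup ⟨0, fun _ hx => hx.2.1.le⟩ ⟨h.eMin_lt hℓ h0, he, h1⟩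

lemma Good.inv_le {e e' s : ℝ} (he : e < 0) (h0 : 0 < aPot φ e ℓ) (h1 : aPot φ e ℓ < s)
    (he' : e' < 0) (h2 : s ≤ aPot φ e' ℓ) : aPotInv φ s ℓ ≤ e' := by
  refine csSup_le ⟨e, h.eMin_lt hℓ h0, he, h1⟩ ?_
  rintro x ⟨_, hx, hxs⟩
  by_contra hcon
  have := h.aPot_mono hℓ (not_le.1 hcon).le hx
  linarith

lemma Good.aPot_contOn {e' : ℝ} (he' : e' < 0) : ContinuousOn (fun e => aPot φ e ℓ) (Iic e') := by
  have : ContinuousOn (fun e => 8 * π ^ 2 * √2 *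
      ∫ r in Icc (ℓ / (2 * C)) (C / (-e')), √(e - psiPot φ ℓ r)) (Iic e') := by
    refine continuousOn_const.mul ?_
    refine continuousOn_of_dominated (bound := fun r => √(e' - psiPot φ ℓ r)) ?_ ?_ ?_ ?_
    · intro e _
      exact ((h.Q_cont hℓ e e').sqrt).aestronglyMeasurable measurableSet_Icc
    · intro e he
      refine ae_of_all _ fun r => ?_
      rw [Real.norm_eq_abs, abs_of_nonneg (Real.sqrt_nonneg _)]
      apply Real.sqrt_le_sqrt
      have : e ≤ e' := he
      linarith
    · exact ((h.Q_cont hℓ e' e').sqrt).integrableOn_compact isCompact_Icc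
    · refine ae_of_all _ fun r => ?_
      fun_prop
  refine this.congr ?_
  intro e he
  exact h.aPot_eq hℓ he he'

lemma Good.aPot_large (s : ℝ) : ∃ e < 0, s ≤ aPot φ e ℓ := by
  have hC := h.hC
  have hc := h.hc
  set R := max 1 (2 * ℓ / c) with hR
  have hR1 : 1 ≤ R := le_max_left _ _
  have hR2 : 2 * ℓ / c ≤ R := le_max_right _ _
  set N := max (2 * R) (8 * s ^ 2 / c) with hN
  have hN1 : 2 * R ≤ N := le_max_left _ _
  have hN2 : 8 * s ^ 2 / c ≤ N := le_max_right _ _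
  have hN0 : 0 < N := by linarith
  have hneg : -(c / (4 * N)) < 0 := by
    have : 0 < c / (4 * N) := by positivity
    linarith
  refine ⟨-(c / (4 * N)), hneg, ?_⟩
  have key : ∀ r ∈ Icc R N, c / (2 * N) ≤ -(c / (4 * N)) - psiPot φ ℓ r := by
    intro r hr
    have hr1 : 1 ≤ r := hR1.trans hr.1
    have hr0 : 0 < r := by linarith
    have h1 := h.ub r hr1
    unfold psiPot
    have h2 : ℓ / (2 * r ^ 2) ≤ c / (4 * r) := by
      have : 2 * ℓ ≤ r * c := by
        have := hR2.trans hr.1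
        rwa [div_le_iff₀ hc] at this
      rw [div_le_div_iff₀ (by positivity) (by positivity)]
      nlinarith
    have h3 : c / N ≤ c / r := by
      gcongr
      exact hr.2
    have e1 : c / (4 * r) = c / r / 4 := by field_simp
    have e2 : c / (4 * N) = c / N / 4 := by field_simp
    have e3 : c / (2 * N) = c / N / 2 := by field_simp
    rw [e2, e3]
    rw [e1] at h2
    linarith
  rw [h.aPot_eq hℓ le_rfl hneg]
  have hsub : Icc R N ⊆ Icc (ℓ / (2 * C)) (C / (-(-(c / (4 * N))))) := by
    intro r hr
    refine h.supp hℓ le_rfl hneg (by linarith [hr.1]) ?_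
    exact lt_of_lt_of_le (by positivity) (key r hr)
  have hi := ((h.Q_cont hℓ (-(c / (4 * N))) (-(c / (4 * N)))).sqrt).integrableOn_compact
    (μ := volume) isCompact_Icc
  have h1 : ∫ r in Icc R N, √(c / (2 * N)) ≤
      ∫ r in Icc (ℓ / (2 * C)) (C / (-(-(c / (4 * N))))), √(-(c / (4 * N)) - psiPot φ ℓ r) := by
    refine le_trans ?_ (setIntegral_mono_set hi (ae_of_all _ fun r => Real.sqrt_nonneg _)
      hsub.eventuallyLE)
    refine setIntegral_mono_on ?_ (hi.mono_set hsub) measurableSet_Icc ?_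
    · exact integrableOn_const (by simp)
    · intro r hr
      exact Real.sqrt_le_sqrt (key r hr)
  rw [setIntegral_const] at h1
  simp only [smul_eq_mul] at h1
  rw [Real.volume_real_Icc_of_le (by linarith)] at h1
  have h2 : s ≤ (N - R) * √(c / (2 * N)) := by
    have : s ≤ N / 2 * √(c / (2 * N)) := by
      have e : N / 2 * √(c / (2 * N)) = √(c * N / 8) := by
        rw [show c * N / 8 = (N / 2) ^ 2 * (c / (2 * N)) by field_simp; ring]
        rw [Real.sqrt_mul (by positivity), Real.sqrt_sq (by positivity)]
      rw [e]
      apply Real.le_sqrt_of_sq_le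
      rw [div_le_iff₀ hc] at hN2
      linarith
    refine this.trans ?_
    gcongr
    linarith
  have h3 := h2.trans h1
  have hc1 : (1:ℝ) ≤ 8 * π ^ 2 * √2 := by
    have : 1 ≤ √2 := by
      rw [Real.one_le_sqrt]; norm_num
    nlinarith [Real.pi_gt_three, Real.pi_gt_three, sq_nonneg π]
  refine h3.trans ?_
  exact le_mul_of_one_le_left (integral_nonneg fun r => Real.sqrt_nonneg _) hc1

lemma Good.exists_e {s : ℝ} (hs : 0 < s) : ∃ e < 0, aPot φ e ℓ = s := by
  obtain ⟨e', he', hse⟩ := h.aPot_large hℓ s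
  set e1 := min e' (-(C ^ 2 / (2 * ℓ))) with he1
  have h1 : aPot φ e1 ℓ ≤ 0 := by
    by_contra hcon
    obtain ⟨r, hr, hq⟩ := h.aPot_pos hℓ (not_le.1 hcon)
    have := h.psi_lb hℓ hr
    have : e1 ≤ -(C ^ 2 / (2 * ℓ)) := min_le_right _ _
    linarith
  have hle : e1 ≤ e' := min_le_left _ _
  obtain ⟨e, he, hes⟩ := intermediate_value_Icc hle
    ((h.aPot_contOn hℓ he').mono Icc_subset_Iic_self) (show s ∈ Icc _ _ from ⟨by linarith, hse⟩)
  exact ⟨e, lt_of_le_of_lt he.2 he', hes⟩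

end good


lemma Good.struct {φ : ℝ → ℝ} {C c : ℝ} (h : Good φ C c) {ℓ : ℝ} (hℓ : 0 < ℓ) {e : ℝ} (he : e < 0)
    (hpos : 0 < aPot φ e ℓ) :
    r1Pot φ e ℓ < r2Pot φ e ℓ ∧
    Icc (r1Pot φ e ℓ) (r2Pot φ e ℓ) ⊆ Icc (ℓ / (2 * C)) (C / (-(e / 2))) ∧
    (∀ r ∈ Ioo (r1Pot φ e ℓ) (r2Pot φ e ℓ), 0 < e - psiPot φ ℓ r) ∧
    (∀ r, 0 < r → r ∉ Icc (r1Pot φ e ℓ) (r2Pot φ e ℓ) → e - psiPot φ ℓ r ≤ 0) ∧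
    ∃ k > 0, ∀ r ∈ Icc (ℓ / (2 * C)) (C / (-(e / 2))),
      k * |r - r1Pot φ e ℓ| * |r - r2Pot φ e ℓ| ≤ |e - psiPot φ ℓ r| := by
  have hC := h.hC
  set a := ℓ / (2 * C) with ha
  set b := C / (-(e / 2)) with hb
  have ha0 : 0 < a := by positivity
  have hb0 : 0 < b := div_pos hC (by linarith)
  set S := {r : ℝ | 0 < r ∧ psiPot φ ℓ r < e} with hS
  have hSo : IsOpen S := (h.psi_cont hℓ).isOpen_inter_preimage isOpen_Ioi isOpen_Iio
  have hTo : IsOpen {r : ℝ | 0 < r ∧ e < psiPot φ ℓ r} :=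
    (h.psi_cont hℓ).isOpen_inter_preimage isOpen_Ioi isOpen_Ioi
  have hSn : S.Nonempty := by
    obtain ⟨r, hr, hq⟩ := h.aPot_pos hℓ hpos
    exact ⟨r, hr, by linarith⟩
  have hSab : S ⊆ Icc a b := by
    intro r hr
    exact h.supp hℓ (by linarith) (by linarith) hr.1 (by linarith [hr.2])
  have hbb : BddBelow S := ⟨a, fun r hr => (hSab hr).1⟩
  have hba : BddAbove S := ⟨b, fun r hr => (hSab hr).2⟩
  set r1 := r1Pot φ e ℓ with hr1
  set r2 := r2Pot φ e ℓ with hr2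
  have e1 : r1 = sInf S := rfl
  have e2 : r2 = sSup S := rfl
  have hSr : S ⊆ Icc r1 r2 := fun r hr => ⟨csInf_le hbb hr, le_csSup hba hr⟩
  have c1 : r1 ∈ closure S := csInf_mem_closure hSn hbb
  have c2 : r2 ∈ closure S := csSup_mem_closure hSn hba
  have m1 : r1 ∈ Icc a b := closure_minimal hSab isClosed_Icc c1
  have m2 : r2 ∈ Icc a b := closure_minimal hSab isClosed_Icc c2
  have p1 : 0 < r1 := ha0.trans_le m1.1
  have p2 : 0 < r2 := ha0.trans_le m2.1
  have ncl : ∀ r ∈ closure S, 0 < r → psiPot φ ℓ r ≤ e := by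
    intro r hr hr0
    by_contra hcon
    obtain ⟨x, hx1, hx2⟩ := mem_closure_iff.1 hr _ hTo ⟨hr0, not_le.1 hcon⟩
    have := hx1.2
    have := hx2.2
    linarith
  have n1 : r1 ∉ S := by
    intro hm
    obtain ⟨ε, hε, hsub⟩ := Metric.isOpen_iff.1 hSo r1 hm
    have : r1 - ε / 2 ∈ S := hsub (by rw [Metric.mem_ball, Real.dist_eq]; simp only [sub_sub_cancel_left, add_sub_cancel_left, abs_neg]; rw [abs_of_pos (half_pos hε)]; exact half_lt_self hε)
    have := (hSr this).1
    linarith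
  have n2 : r2 ∉ S := by
    intro hm
    obtain ⟨ε, hε, hsub⟩ := Metric.isOpen_iff.1 hSo r2 hm
    have : r2 + ε / 2 ∈ S := hsub (by rw [Metric.mem_ball, Real.dist_eq]; simp only [sub_sub_cancel_left, add_sub_cancel_left, abs_neg]; rw [abs_of_pos (half_pos hε)]; exact half_lt_self hε)
    have := (hSr this).2
    linarith
  have z1 : e - psiPot φ ℓ r1 = 0 := by
    have := ncl r1 c1 p1
    have : ¬ psiPot φ ℓ r1 < e := fun hh => n1 ⟨p1, hh⟩
    linarith
  have z2 : e - psiPot φ ℓ r2 = 0 := by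
    have := ncl r2 c2 p2
    have : ¬ psiPot φ ℓ r2 < e := fun hh => n2 ⟨p2, hh⟩
    linarith
  have h12 : r1 < r2 := by
    obtain ⟨r, hr⟩ := hSn
    have h1 := hSr hr
    rcases eq_or_lt_of_le h1.1 with h2 | h2
    · rw [← h2] at hr; exact absurd hr n1
    · linarith [h1.2]
  have psi_u : ∀ r, 0 < r → psiPot φ ℓ r = φ (r⁻¹)⁻¹ + ℓ / 2 * (r⁻¹) ^ 2 := by
    intro r hr
    unfold psiPot
    rw [inv_inv]
    field_simp
  have hQ := fun (r : ℝ) (hr : 0 < r) => Q_u h.cvx (e := e) (l := ℓ) (p := r2⁻¹) (q := r1⁻¹)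
    (u := r⁻¹) hℓ (by positivity) (by gcongr) (by rw [← psi_u r2 p2]; exact z2)
    (by rw [← psi_u r1 p1]; exact z1) (by positivity)
  refine ⟨h12, ?_, ?_, ?_, ?_⟩
  · intro r hr
    exact ⟨m1.1.trans hr.1, hr.2.trans m2.2⟩
  · intro r hr
    have hr0 : 0 < r := p1.trans hr.1
    rw [psi_u r hr0]
    apply (hQ r hr0).1
    · have := hr.2
      gcongr
    · have := hr.1
      gcongr
  · intro r hr0 hr
    by_contra hcon
    exact hr (hSr ⟨hr0, by linarith⟩)
  · refine ⟨ℓ / (2 * b ^ 4), by positivity, ?_⟩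
    intro r hr
    have hr0 : 0 < r := ha0.trans_le hr.1
    have h3 := (hQ r hr0).2
    rw [← psi_u r hr0] at h3
    refine le_trans ?_ h3
    have key : ∀ x, x ∈ Icc a b → |r - x| / b ^ 2 ≤ |r⁻¹ - x⁻¹| := by
      intro x hx
      have hx0 : 0 < x := ha0.trans_le hx.1
      rw [inv_sub_inv hr0.ne' hx0.ne', abs_div, abs_sub_comm x r, abs_of_pos (mul_pos hr0 hx0)]
      gcongr
      rw [sq]
      exact mul_le_mul hr.2 hx.2 hx0.le hb0.le
    calc ℓ / (2 * b ^ 4) * |r - r1| * |r - r2| = ℓ / 2 * (|r - r2| / b ^ 2) * (|r - r1| / b ^ 2) := by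
          field_simp
      _ ≤ _ := by
        have := key r1 m1
        have := key r2 m2
        gcongr

lemma Good.line {φ : ℝ → ℝ} {C c : ℝ} (h : Good φ C c) {ℓ : ℝ} (hℓ : 0 < ℓ) {e : ℝ} (he : e < 0)
    (hpos : 0 < aPot φ e ℓ) {δ : ℝ → ℝ} (hδ : ContinuousOn δ (Ioi 0)) :
    IntervalIntegrable (fun r => δ r / √(e - psiPot φ ℓ r)) volume (r1Pot φ e ℓ) (r2Pot φ e ℓ) ∧
    HasDerivAt (fun t => ∫ r in Icc (ℓ / (2 * C)) (C / (-(e / 2))), √(e - psiPot φ ℓ r + t * δ r))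
      ((∫ r in (r1Pot φ e ℓ)..(r2Pot φ e ℓ), δ r / √(e - psiPot φ ℓ r)) / 2) 0 := by
  obtain ⟨h12, hsub, hin, hout, k, hk, hkb⟩ := h.struct hℓ he hpos
  have hδc := hδ.mono (Icc_sub_Ioi h hℓ (e' := e / 2))
  obtain ⟨D, hD⟩ := isCompact_Icc.exists_bound_of_continuousOn hδc
  obtain ⟨hI, hd⟩ := deriv_core (fun r => e - psiPot φ ℓ r) δ _ _ _ _ k D h12 hk
    (h.Q_cont hℓ e (e / 2)) hδc hkb hD
  constructor
  · rw [intervalIntegrable_iff_integrableOn_Icc_of_le h12.le]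
    exact hI.mono_set hsub
  · refine hd.congr_deriv ?_
    congr 1
    rw [intervalIntegral.integral_of_le h12.le, ← integral_Icc_eq_integral_Ioc]
    refine setIntegral_eq_of_subset_of_forall_sdiff_eq_zero measurableSet_Icc hsub ?_
    intro r hr
    rw [Real.sqrt_eq_zero_of_nonpos (hout r (Icc_sub_Ioi h hℓ hr.1) hr.2), div_zero]

lemma Good.I_pos {φ : ℝ → ℝ} {C c : ℝ} (h : Good φ C c) {ℓ : ℝ} (hℓ : 0 < ℓ) {e : ℝ} (he : e < 0)
    (hpos : 0 < aPot φ e ℓ) :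
    0 < ∫ r in (r1Pot φ e ℓ)..(r2Pot φ e ℓ), 1 / √(e - psiPot φ ℓ r) := by
  obtain ⟨h12, hsub, hin, hout, k, hk, hkb⟩ := h.struct hℓ he hpos
  refine intervalIntegral.intervalIntegral_pos_of_pos_on
    (h.line hℓ he hpos (δ := fun _ => 1) continuousOn_const).1 ?_ h12
  intro r hr
  have := Real.sqrt_pos.2 (hin r hr)
  positivity

lemma sign_of_deriv {J : ℝ → ℝ} {D : ℝ} (h : HasDerivAt J D 0) (hD : 0 < D) :
    ∀ᶠ t in 𝓝 (0:ℝ), (0 < t → J 0 < J t) ∧ (t < 0 → J t < J 0) := by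
  have h1 := (hasDerivAt_iff_isLittleO.1 h).def (half_pos hD)
  filter_upwards [h1] with t ht
  simp only [sub_zero, smul_eq_mul, Real.norm_eq_abs] at ht
  have h2 := abs_le.1 ht
  constructor
  · intro h0
    rw [abs_of_pos h0] at h2
    nlinarith [h2.1]
  · intro h0
    rw [abs_of_neg h0] at h2
    nlinarith [h2.2]

lemma Good.inv_eq {φ : ℝ → ℝ} {C c : ℝ} (h : Good φ C c) {ℓ : ℝ} (hℓ : 0 < ℓ) {s : ℝ}
    (hs : 0 < s) : aPotInv φ s ℓ < 0 ∧ aPot φ (aPotInv φ s ℓ) ℓ = s := by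
  obtain ⟨e, he, hes⟩ := h.exists_e hℓ hs
  have hpos : 0 < aPot φ e ℓ := by rw [hes]; exact hs
  suffices aPotInv φ s ℓ = e by rw [this]; exact ⟨he, hes⟩
  have hd := (h.line hℓ he hpos (δ := fun _ => 1) continuousOn_const).2
  have hI := h.I_pos hℓ he hpos
  have hd2 := hd.const_mul (8 * π ^ 2 * √2)
  have hsg := sign_of_deriv hd2 (by positivity)
  have hcont := hd2.continuousAt
  have hev : ∀ᶠ t in 𝓝 (0:ℝ), e + t ≤ e / 2 :=
    ((continuous_const.add continuous_id).tendsto' 0 e (by simp)).eventually_le_const (by linarith)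
  have hJ : ∀ t, e + t ≤ e / 2 → aPot φ (e + t) ℓ = 8 * π ^ 2 * √2 *
      ∫ r in Icc (ℓ / (2 * C)) (C / (-(e / 2))), √(e - psiPot φ ℓ r + t * 1) := by
    intro t ht
    rw [h.aPot_eq hℓ ht (by linarith)]
    congr 2
    ext r
    congr 1
    ring
  have hJ0 := hJ 0 (by linarith)
  rw [add_zero, hes] at hJ0
  have hevp : ∀ᶠ t in 𝓝 (0:ℝ), 0 < 8 * π ^ 2 * √2 *
      ∫ r in Icc (ℓ / (2 * C)) (C / (-(e / 2))), √(e - psiPot φ ℓ r + t * 1) :=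
    hcont.eventually (lt_mem_nhds (lt_of_lt_of_eq hs hJ0))
  have hall : ∀ᶠ t in 𝓝 (0:ℝ), t < 0 → e + t < 0 ∧ 0 < aPot φ (e + t) ℓ ∧ aPot φ (e + t) ℓ < s := by
    filter_upwards [hsg, hev, hevp] with t h1 h2 h3 h0
    rw [hJ t h2]
    refine ⟨by linarith, h3, ?_⟩
    have := h1.2 h0
    rwa [← hJ0] at this
  have hall' : ∀ᶠ t in 𝓝[<] (0:ℝ), e + t < 0 ∧ 0 < aPot φ (e + t) ℓ ∧ aPot φ (e + t) ℓ < s := by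
    rw [eventually_nhdsWithin_iff]; exact hall
  apply le_antisymm
  · obtain ⟨t, ht1, ht2, ht3⟩ := hall'.exists
    exact h.inv_le hℓ ht1 ht2 ht3 he hes.ge
  · have ht : Tendsto (fun t : ℝ => e + t) (𝓝[<] 0) (𝓝 e) :=
      ((continuous_const.add continuous_id).tendsto' 0 e (by simp)).mono_left nhdsWithin_le_nhds
    refine le_of_tendsto ht ?_
    filter_upwards [hall'] with t ht
    exact h.le_inv hℓ ht.1 ht.2.1 ht.2.2

theorem main_abs {φ χ : ℝ → ℝ} {C c : ℝ} (h : Good φ C c) (h' : Good χ C c) {ℓ s : ℝ} (hℓ : 0 < ℓ)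
    (hs : 0 < s) (P : ℝ → ℝ → ℝ) (hP : ∀ t r, P t r = φ r + t * (χ r - φ r))
    (lam : ℝ) (hl : lam ∈ Icc (0:ℝ) 1) :
      HasDerivWithinAt (fun μ : ℝ => aPotInv (P μ) s ℓ)
        ((∫ r in (r1Pot (P lam) (aPotInv (P lam) s ℓ) ℓ)..(r2Pot (P lam) (aPotInv (P lam) s ℓ) ℓ),
            (χ r - φ r) / Real.sqrt (aPotInv (P lam) s ℓ - psiPot (P lam) ℓ r)) /
          (∫ r in (r1Pot (P lam) (aPotInv (P lam) s ℓ) ℓ)..(r2Pot (P lam) (aPotInv (P lam) s ℓ) ℓ),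
            1 / Real.sqrt (aPotInv (P lam) s ℓ - psiPot (P lam) ℓ r)))
        (Icc 0 1) lam := by
  have hG : ∀ μ ∈ Icc (0:ℝ) 1, Good (P μ) C c := by
    intro μ hμ
    have := h.comb h' hμ
    rwa [← (funext (hP μ) : P μ = _)] at this
  have g0 := hG lam hl
  obtain ⟨he, hes⟩ := g0.inv_eq hℓ hs
  set e := aPotInv (P lam) s ℓ with hedef
  have hpos : 0 < aPot (P lam) e ℓ := by rw [hes]; exact hs
  have hhc : ContinuousOn (fun r => χ r - φ r) (Ioi 0) := h'.cont.sub h.cont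
  have hIp := g0.I_pos hℓ he hpos
  have hI1 := (g0.line hℓ he hpos (δ := fun _ => 1) continuousOn_const).1
  have hIh := (g0.line hℓ he hpos hhc).1
  set r1 := r1Pot (P lam) e ℓ
  set r2 := r2Pot (P lam) e ℓ
  set I1 := ∫ r in r1..r2, 1 / √(e - psiPot (P lam) ℓ r) with hI1d
  set Ih := ∫ r in r1..r2, (χ r - φ r) / √(e - psiPot (P lam) ℓ r) with hIhd
  -- the function along a line
  set J : ℝ → ℝ → ℝ := fun m t => 8 * π ^ 2 * √2 *
    ∫ r in Icc (ℓ / (2 * C)) (C / (-(e / 2))), √(e - psiPot (P lam) ℓ r + t * (m - (χ r - φ r)))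
    with hJd
  have hJder : ∀ m, HasDerivAt (J m) (8 * π ^ 2 * √2 * ((m - Ih / I1) * I1 / 2)) 0 := by
    intro m
    have hd := (g0.line hℓ he hpos (δ := fun r => m - (χ r - φ r)) (continuousOn_const.sub hhc)).2
    refine (hd.const_mul (8 * π ^ 2 * √2)).congr_deriv ?_
    congr 2
    have : (fun r => (m - (χ r - φ r)) / √(e - psiPot (P lam) ℓ r)) =
      fun r => m * (1 / √(e - psiPot (P lam) ℓ r)) - (χ r - φ r) / √(e - psiPot (P lam) ℓ r) := by
      ext r; ring
    rw [this, intervalIntegral.integral_sub (hI1.const_mul m) hIh, intervalIntegral.integral_const_mul]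
    rw [← hI1d, ← hIhd]
    field_simp
  have hJeq : ∀ m t, lam + t ∈ Icc (0:ℝ) 1 → e + m * t ≤ e / 2 →
      aPot (P (lam + t)) (e + m * t) ℓ = J m t := by
    intro m t ht h2
    rw [(hG _ ht).aPot_eq hℓ h2 (by linarith)]
    simp only [hJd]
    congr 2
    ext r
    congr 1
    simp only [psiPot, hP]
    ring
  have hJ0 : ∀ m, J m 0 = s := by
    intro m
    rw [← hJeq m 0 (by simpa using hl) (by linarith)]
    rw [add_zero, mul_zero, add_zero]; exact hes
  have hevm : ∀ m, ∀ᶠ t in 𝓝 (0:ℝ), e + m * t ≤ e / 2 := fun m =>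
    (Continuous.tendsto' (by fun_prop : Continuous fun t : ℝ => e + m * t) 0 e
      (by ring)).eventually_le_const (by linarith)
  have hevp : ∀ m, ∀ᶠ t in 𝓝 (0:ℝ), 0 < J m t := fun m =>
    (hJder m).continuousAt.eventually (lt_mem_nhds (by rw [hJ0]; exact hs))
  rw [hasDerivWithinAt_iff_isLittleO]
  rw [Asymptotics.isLittleO_iff]
  intro ε hε
  set d := Ih / I1 with hd
  have hK : (0:ℝ) < 8 * π ^ 2 * √2 := by positivity
  have s1 := sign_of_deriv (hJder (d + ε)) (by
    have : d + ε - d = ε := by ring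
    rw [this]; positivity)
  have s2 := sign_of_deriv (hJder (d - ε)).neg (by
    have : d - ε - d = -ε := by ring
    rw [this]
    have : 0 < 8 * π ^ 2 * √2 * (ε * I1 / 2) := by positivity
    linarith)
  have hmain : ∀ᶠ t in 𝓝 (0:ℝ), lam + t ∈ Icc (0:ℝ) 1 →
      |aPotInv (P (lam + t)) s ℓ - e - t * d| ≤ ε * |t| := by
    filter_upwards [s1, s2, hevm (d + ε), hevm (d - ε), hevp (d + ε), hevp (d - ε)]
      with t t1 t2 t3 t4 t5 t6 ht
    have g := hG _ ht
    simp only [hJ0, Pi.neg_apply] at t1 t2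
    rw [← hJeq _ _ ht t3] at t1 t5
    rw [← hJeq _ _ ht t4] at t2 t6
    rw [abs_le]
    rcases lt_trichotomy t 0 with h0 | h0 | h0
    · have u1 := t1.2 h0
      have u2 := t2.2 h0
      have v1 := g.le_inv hℓ (by linarith) t5 u1
      have v2 := g.inv_le hℓ (by linarith) t5 u1 (e' := e + (d - ε) * t) (by linarith) (by linarith)
      rw [abs_of_neg h0]
      constructor <;> linarith
    · subst h0
      simp [hedef]
    · have u1 := t1.1 h0
      have u2 := t2.1 h0
      have v1 := g.le_inv hℓ (by linarith) t6 (neg_lt_neg_iff.1 u2)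
      have v2 := g.inv_le hℓ (by linarith) t6 (s := s) (by linarith) (e' := e + (d + ε) * t)
        (by linarith) (by linarith)
      rw [abs_of_pos h0]
      constructor <;> linarith
  have hmap : Tendsto (fun x : ℝ => x - lam) (𝓝[Icc 0 1] lam) (𝓝 0) :=
    ((continuous_id.sub continuous_const).tendsto' lam 0 (by simp)).mono_left nhdsWithin_le_nhds
  filter_upwards [hmap.eventually hmain, self_mem_nhdsWithin] with x hx hxm
  have hx' := hx (by simpa using hxm)
  simpa using hx'


lemma cyl_sub (z : ℝ) (g : ℝ → ℝ≥0∞) :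
    ∫⁻ t in Ioi (0:ℝ), ENNReal.ofReal t * g √(z ^ 2 + t ^ 2) =
      ∫⁻ ρ in Ioi |z|, ENNReal.ofReal ρ * g ρ := by
  have him : (fun t : ℝ => √(z ^ 2 + t ^ 2)) '' Ioi 0 = Ioi |z| := by
    ext ρ
    simp only [mem_image, mem_Ioi]
    constructor
    · rintro ⟨t, ht, rfl⟩
      apply Real.lt_sqrt_of_sq_lt
      rw [sq_abs]
      nlinarith
    · intro h
      have h0 := abs_nonneg z
      have h1 : 0 < ρ ^ 2 - z ^ 2 := by
        rw [← sq_abs z]; nlinarith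
      refine ⟨√(ρ ^ 2 - z ^ 2), Real.sqrt_pos.2 h1, ?_⟩
      rw [Real.sq_sqrt h1.le, add_sub_cancel, Real.sqrt_sq (by linarith)]
  rw [← him]
  rw [lintegral_image_eq_lintegral_abs_deriv_mul measurableSet_Ioi
    (f' := fun t => t / √(z ^ 2 + t ^ 2))]
  · refine setLIntegral_congr_fun measurableSet_Ioi ?_
    intro t ht
    have ht0 : (0:ℝ) < t := ht
    have hp : 0 < √(z ^ 2 + t ^ 2) := Real.sqrt_pos.2 (by positivity)
    simp only
    rw [← mul_assoc, ← ENNReal.ofReal_mul (abs_nonneg _), abs_of_pos (div_pos ht0 hp),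
      div_mul_cancel₀ _ hp.ne']
  · intro t ht
    have ht0 : (0:ℝ) < t := ht
    have h1 : HasDerivAt (fun t : ℝ => z ^ 2 + t ^ 2) (2 * t) t := by
      simpa using (hasDerivAt_pow 2 t).const_add (z ^ 2)
    have := h1.sqrt (by positivity)
    refine (this.congr_deriv ?_).hasDerivWithinAt
    have hp : 0 < √(z ^ 2 + t ^ 2) := Real.sqrt_pos.2 (by positivity)
    field_simp
  · intro t ht t' ht' heq
    have h1 : (0:ℝ) < t := ht
    have h2 : (0:ℝ) < t' := ht'
    simp only at heq
    rw [Real.sqrt_inj (by positivity) (by positivity)] at heq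
    have : t ^ 2 = t' ^ 2 := by linarith
    exact (pow_left_inj₀ h1.le h2.le (by norm_num)).1 this

lemma polar_rad (g : ℝ → ℝ≥0∞) (hg : Measurable g) (z : ℝ) :
    ∫⁻ q : ℝ × ℝ, g √(z ^ 2 + (q.1 ^ 2 + q.2 ^ 2)) =
      ENNReal.ofReal (2 * π) * ∫⁻ ρ in Ioi |z|, ENNReal.ofReal ρ * g ρ := by
  rw [← lintegral_comp_polarCoord_symm, ← cyl_sub]
  have e : ∀ p : ℝ × ℝ, ENNReal.ofReal p.1 • g √(z ^ 2 + ((polarCoord.symm p).1 ^ 2 + (polarCoord.symm p).2 ^ 2))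
     = ENNReal.ofReal p.1 * g √(z ^ 2 + p.1 ^ 2) := by
    intro p
    rw [smul_eq_mul]
    congr 4
    rw [polarCoord_symm_apply]
    simp only
    have := Real.sin_sq_add_cos_sq p.2
    nlinarith
  simp only [e]
  rw [polarCoord_target, Measure.volume_eq_prod, ← Measure.prod_restrict]
  rw [lintegral_prod _ (by fun_prop)]
  simp only [lintegral_const, Measure.restrict_apply MeasurableSet.univ, univ_inter, Real.volume_Ioo]
  rw [lintegral_mul_const' _ _ (by simp), mul_comm]
  congr 2
  ring

lemma arch (H : ℝ × ℝ → ℝ≥0∞) (hH : Measurable H) :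
    ∫⁻ y : E3, H (y 0, ‖y‖) =
      ∫⁻ ρ in Ioi (0:ℝ), ENNReal.ofReal (2 * π) * (ENNReal.ofReal ρ * ∫⁻ z in Ioo (-ρ) ρ, H (z, ρ)) := by
  have s1 : ∫⁻ y : E3, H (y 0, ‖y‖) =
      ∫⁻ w : Fin 3 → ℝ, H (w 0, √(w 0 ^ 2 + (w 1 ^ 2 + w 2 ^ 2))) := by
    rw [← (PiLp.volume_preserving_ofLp (Fin 3)).lintegral_comp_emb
      (MeasurableEquiv.toLp 2 (Fin 3 → ℝ)).symm.measurableEmbedding]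
    refine lintegral_congr fun y => ?_
    rw [EuclideanSpace.norm_eq, Fin.sum_univ_three]
    simp only [Real.norm_eq_abs, sq_abs]
    rw [add_assoc]
  have s2 : ∫⁻ w : Fin 3 → ℝ, H (w 0, √(w 0 ^ 2 + (w 1 ^ 2 + w 2 ^ 2))) =
      ∫⁻ p : ℝ × (Fin 2 → ℝ), H (p.1, √(p.1 ^ 2 + (p.2 0 ^ 2 + p.2 1 ^ 2))) := by
    rw [← (volume_preserving_piFinSuccAbove (fun _ : Fin 3 => ℝ) 0).lintegral_comp_emb
      (MeasurableEquiv.piFinSuccAbove (fun _ : Fin 3 => ℝ) 0).measurableEmbedding]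
    refine lintegral_congr fun w => ?_
    rfl
  rw [s1, s2, Measure.volume_eq_prod, lintegral_prod _ (by fun_prop)]
  have s3 : ∀ z : ℝ, ∫⁻ q : Fin 2 → ℝ, H (z, √(z ^ 2 + (q 0 ^ 2 + q 1 ^ 2))) =
      ENNReal.ofReal (2 * π) * ∫⁻ ρ in Ioi |z|, ENNReal.ofReal ρ * H (z, ρ) := by
    intro z
    rw [← polar_rad (fun ρ => H (z, ρ)) (by fun_prop) z]
    rw [← (volume_preserving_finTwoArrow ℝ).lintegral_comp_emb
      (MeasurableEquiv.finTwoArrow).measurableEmbedding]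
    rfl
  simp only [s3]
  rw [lintegral_const_mul' _ _ ENNReal.ofReal_ne_top, lintegral_const_mul' _ _ ENNReal.ofReal_ne_top]
  congr 1
  have i1 : ∀ z : ℝ, ∫⁻ ρ in Ioi |z|, ENNReal.ofReal ρ * H (z, ρ) =
      ∫⁻ ρ, ({p : ℝ × ℝ | |p.1| < p.2}.indicator (fun p => ENNReal.ofReal p.2 * H p)) (z, ρ) := by
    intro z
    rw [← lintegral_indicator measurableSet_Ioi]
    rfl
  have hms : MeasurableSet {p : ℝ × ℝ | |p.1| < p.2} :=
    (isOpen_lt (by fun_prop) (by fun_prop)).measurableSet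
  simp only [i1]
  rw [lintegral_lintegral_swap]
  · rw [← lintegral_indicator measurableSet_Ioi]
    refine lintegral_congr fun ρ => ?_
    by_cases hρ : 0 < ρ
    · rw [indicator_of_mem (mem_Ioi.2 hρ), ← lintegral_const_mul' _ _ (by simp),
        ← lintegral_indicator measurableSet_Ioo]
      refine lintegral_congr fun z => ?_
      simp only [indicator, mem_ofPred_eq, mem_Ioo, abs_lt]
    · rw [indicator_of_notMem (by simpa using hρ)]
      rw [lintegral_eq_zero_of_ae_eq_zero]
      refine ae_of_all _ fun z => ?_
      refine indicator_of_notMem (fun hm => hρ ?_) _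
      exact lt_of_le_of_lt (abs_nonneg z) hm
  · refine Measurable.aemeasurable ?_
    exact Measurable.indicator (by fun_prop) hms


lemma shell_inner (r ρ : ℝ) (hr : 0 < r) (hρ : 0 < ρ) :
    ∫⁻ z in Ioo (-ρ) ρ, ENNReal.ofReal (1 / √(r ^ 2 - 2 * r * z + ρ ^ 2)) =
      ∫⁻ z in Ioo (-ρ) ρ, ENNReal.ofReal (min (1 / r) (1 / ρ)) := by
  have hle : -ρ ≤ ρ := by linarith
  have hcont : ContinuousOn (fun z => -√(r ^ 2 - 2 * r * z + ρ ^ 2) / r) (Icc (-ρ) ρ) := by fun_prop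
  have hder : ∀ z ∈ Ioo (-ρ) ρ, HasDerivAt (fun z => -√(r ^ 2 - 2 * r * z + ρ ^ 2) / r)
      (1 / √(r ^ 2 - 2 * r * z + ρ ^ 2)) z := by
    intro z hz
    have hp : 0 < r ^ 2 - 2 * r * z + ρ ^ 2 := by
      have := mul_lt_mul_of_pos_left hz.2 hr
      nlinarith [sq_nonneg (r - ρ)]
    have h1 : HasDerivAt (fun z : ℝ => r ^ 2 - 2 * r * z + ρ ^ 2) (-(2 * r)) z := by
      simpa using (((hasDerivAt_id z).const_mul (2 * r)).const_sub (r ^ 2)).add_const (ρ ^ 2)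
    refine ((h1.sqrt hp.ne').neg.div_const r).congr_deriv ?_
    have := Real.sqrt_pos.2 hp
    field_simp
  have hint := intervalIntegral.integrableOn_deriv_of_nonneg hcont hder
    (fun z _ => by positivity)
  have hval := intervalIntegral.integral_eq_sub_of_hasDerivAt_of_le hle hcont hder
    ((intervalIntegrable_iff_integrableOn_Ioc_of_le hle).2 hint)
  rw [intervalIntegral.integral_of_le hle, integral_Ioc_eq_integral_Ioo] at hval
  rw [← ofReal_integral_eq_lintegral_ofReal (hint.mono_set Ioo_subset_Ioc_self)
    (ae_of_all _ fun z => by positivity), hval, setLIntegral_const, Real.volume_Ioo,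
    ← ENNReal.ofReal_mul (by positivity)]
  congr 1
  have e1 : √(r ^ 2 - 2 * r * (-ρ) + ρ ^ 2) = r + ρ := by
    rw [show r ^ 2 - 2 * r * (-ρ) + ρ ^ 2 = (r + ρ) ^ 2 by ring, Real.sqrt_sq (by positivity)]
  have e2 : √(r ^ 2 - 2 * r * ρ + ρ ^ 2) = |r - ρ| := by
    rw [show r ^ 2 - 2 * r * ρ + ρ ^ 2 = (r - ρ) ^ 2 by ring, Real.sqrt_sq_eq_abs]
  rw [e1, e2]
  rcases le_total r ρ with h | h
  · rw [min_eq_right (one_div_le_one_div_of_le hr h), abs_of_nonpos (by linarith)]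
    field_simp; ring
  · rw [min_eq_left (one_div_le_one_div_of_le hρ h), abs_of_nonneg (by linarith)]
    field_simp; ring

abbrev e0v : E3 := EuclideanSpace.single (0 : Fin 3) (1:ℝ)

lemma norm_sub_e0 (r : ℝ) (y : E3) : ‖r • e0v - y‖ = √(r ^ 2 - 2 * r * y 0 + ‖y‖ ^ 2) := by
  rw [EuclideanSpace.norm_eq, EuclideanSpace.norm_eq, Real.sq_sqrt (by positivity)]
  congr 1
  simp [Fin.sum_univ_three]
  ring

lemma shell (r : ℝ) (hr : 0 < r) (F : ℝ → ℝ≥0∞) (hF : Measurable F) :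
    ∫⁻ y : E3, F ‖y‖ * ENNReal.ofReal (1 / ‖r • e0v - y‖) =
      ∫⁻ y : E3, F ‖y‖ * ENNReal.ofReal (min (1 / r) (1 / ‖y‖)) := by
  have h1 := arch (fun p => F p.2 * ENNReal.ofReal (1 / √(r ^ 2 - 2 * r * p.1 + p.2 ^ 2)))
    (by fun_prop)
  have h2 := arch (fun p => F p.2 * ENNReal.ofReal (min (1 / r) (1 / p.2))) (by fun_prop)
  simp only [norm_sub_e0]
  simp only at h1 h2
  rw [h1, h2]
  refine setLIntegral_congr_fun measurableSet_Ioi ?_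
  intro ρ hρ
  simp only
  congr 2
  rw [lintegral_const_mul _ (by fun_prop), lintegral_const_mul _ (by fun_prop)]
  rw [shell_inner r ρ hr hρ]

lemma exists_rot (y : E3) : ∃ R : E3 ≃ₗᵢ[ℝ] E3,
    LinearMap.det (R.toLinearEquiv : E3 →ₗ[ℝ] E3) = 1 ∧ R y = ‖y‖ • e0v := by
  by_cases hy : y = ‖y‖ • e0v
  · refine ⟨LinearIsometryEquiv.refl ℝ E3, ?_, ?_⟩
    · exact LinearMap.det_id
    · exact hy
  · have hdet : ∀ v : E3, v ≠ 0 →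
        LinearMap.det ((ℝ ∙ v)ᗮ.reflection.toLinearEquiv : E3 →ₗ[ℝ] E3) = -1 := by
      intro v hv
      have := Submodule.det_reflection (𝕜 := ℝ) (ℝ ∙ v)ᗮ
      rw [Submodule.orthogonal_orthogonal, finrank_span_singleton hv, pow_one] at this
      exact this
    set e1 : E3 := EuclideanSpace.single (1 : Fin 3) (1:ℝ) with he1
    have he1n : e1 ≠ 0 := by
      intro h
      have := congrArg (fun v : E3 => v 1) h
      simp [he1] at this
    refine ⟨((ℝ ∙ (y - ‖y‖ • e0v))ᗮ.reflection).trans ((ℝ ∙ e1)ᗮ.reflection), ?_, ?_⟩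
    · have : ((((ℝ ∙ (y - ‖y‖ • e0v))ᗮ.reflection).trans ((ℝ ∙ e1)ᗮ.reflection)).toLinearEquiv :
          E3 →ₗ[ℝ] E3) = ((ℝ ∙ e1)ᗮ.reflection.toLinearEquiv : E3 →ₗ[ℝ] E3) ∘ₗ
            ((ℝ ∙ (y - ‖y‖ • e0v))ᗮ.reflection.toLinearEquiv : E3 →ₗ[ℝ] E3) := rfl
      rw [this, LinearMap.det_comp, hdet _ he1n, hdet _ (sub_ne_zero.2 hy)]
      norm_num
    · rw [LinearIsometryEquiv.trans_apply, Submodule.reflection_sub (by simp [norm_smul])]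
      apply Submodule.reflection_mem_subspace_eq_self
      rw [Submodule.mem_orthogonal_singleton_iff_inner_right]
      simp [he1, inner_smul_right, EuclideanSpace.inner_single_left]

lemma rho_rad {f : Phase → ℝ} (hf : SphSym f) (y : E3) : rhoF f y = rhoF f (‖y‖ • e0v) := by
  obtain ⟨R, hR, hRy⟩ := exists_rot y
  rw [← hRy]
  unfold rhoF
  have key := (R.measurePreserving).integral_comp (R.toHomeomorph.measurableEmbedding)
    (fun v => f (R y, v))
  refine Eq.trans ?_ key
  refine integral_congr_ae (ae_of_all _ fun v => ?_)
  exact (hf R hR (y, v)).symm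

lemma rho_meas {f : Phase → ℝ} (hf : memE f) : Measurable (rhoF f) :=
  (hf.1.stronglyMeasurable.integral_prod_right' (ν := (volume : Measure E3))).measurable

lemma rho_nonneg {f : Phase → ℝ} (hf : memE f) (y : E3) : 0 ≤ rhoF f y :=
  integral_nonneg fun _ => hf.2.1 _

lemma rho_int {f : Phase → ℝ} (hf : memE f) : Integrable (rhoF f) := by
  have h1 : Integrable f (volume : Measure Phase) := by
    rw [← memLp_one_iff_integrable]
    refine ⟨hf.1.aestronglyMeasurable, ?_⟩
    refine lt_of_le_of_lt ?_ hf.2.2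
    unfold eNormE
    rw [add_assoc]
    exact le_self_add
  rw [Measure.volume_eq_prod] at h1
  exact h1.integral_prod_left

lemma phiRad_eq {f : Phase → ℝ} (hf : memErad f) {r : ℝ} (hr : 0 < r) :
    phiRad f r = - ∫ y : E3, rhoF f y / (4 * π) * min (1 / r) (1 / ‖y‖) := by
  have hm := rho_meas hf.1
  have hn := rho_nonneg hf.1
  unfold phiRad phiF
  congr 1
  rw [integral_eq_lintegral_of_nonneg_ae, integral_eq_lintegral_of_nonneg_ae]
  · congr 1
    have := shell r hr (fun t => ENNReal.ofReal (rhoF f (t • e0v) / (4 * π))) (by fun_prop)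
    simp only [← rho_rad hf.2] at this
    have hn' : ∀ y, 0 ≤ rhoF f y / (4 * π) := fun y => div_nonneg (hn y) (by positivity)
    simp only [← ENNReal.ofReal_mul (hn' _)] at this
    rw [← this]
    refine lintegral_congr fun y => ?_
    congr 1
    rw [div_mul_div_comm, mul_one]
  · exact ae_of_all _ fun y => mul_nonneg (div_nonneg (hn y) (by positivity)) (by positivity)
  · refine Measurable.aestronglyMeasurable ?_
    fun_prop
  · exact ae_of_all _ fun y => div_nonneg (hn y) (by positivity)
  · refine Measurable.aestronglyMeasurable ?_
    fun_prop

lemma good_phi {f : Phase → ℝ} (hf : memErad f) (h0 : phiF f ≠ 0) :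
    ∃ C c, Good (phiRad f) C c := by
  have hm := rho_meas hf.1
  have hn' : ∀ y, 0 ≤ rhoF f y / (4 * π) := fun y => div_nonneg (rho_nonneg hf.1 y) (by positivity)
  have hi : Integrable (fun y => rhoF f y / (4 * π)) := (rho_int hf.1).div_const _
  have hmin : ∀ u, 0 ≤ u → ∀ y : E3, 0 ≤ min u (1 / ‖y‖) := fun u hu y => le_min hu (by positivity)
  have hGi : ∀ u, 0 ≤ u → Integrable (fun y : E3 => rhoF f y / (4 * π) * min u (1 / ‖y‖)) := by
    intro u hu
    refine (hi.mul_const u).mono' ?_ ?_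
    · refine Measurable.aestronglyMeasurable ?_
      fun_prop
    · refine ae_of_all _ fun y => ?_
      rw [Real.norm_eq_abs, abs_of_nonneg (mul_nonneg (hn' y) (hmin u hu y))]
      exact mul_le_mul_of_nonneg_left (min_le_left _ _) (hn' y)
  set G : ℝ → ℝ := fun u => ∫ y : E3, rhoF f y / (4 * π) * min u (1 / ‖y‖) with hG
  have hphi : ∀ r, 0 < r → phiRad f r = - G (1 / r) := fun r hr => phiRad_eq hf hr
  have hub : ∀ u, 0 ≤ u → G u ≤ (∫ y, rhoF f y / (4 * π)) * u := by
    intro u hu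
    rw [← integral_mul_const]
    refine integral_mono (hGi u hu) (hi.mul_const u) fun y => ?_
    exact mul_le_mul_of_nonneg_left (min_le_left _ _) (hn' y)
  have hc : 0 < G 1 := by
    have hge : 0 ≤ G 1 := integral_nonneg fun y => mul_nonneg (hn' y) (hmin 1 zero_le_one y)
    rcases eq_or_lt_of_le hge with h | h
    · exfalso
      apply h0
      have hz := (integral_eq_zero_iff_of_nonneg
        (fun y => mul_nonneg (hn' y) (hmin 1 zero_le_one y)) (hGi 1 zero_le_one)).1 h.symm
      have hne : ∀ᵐ y : E3, y ≠ 0 := by simp [ae_iff, measure_singleton]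
      have hρ : ∀ᵐ y : E3, rhoF f y = 0 := by
        filter_upwards [hz, hne] with y hy hy0
        have hy1 : 0 < ‖y‖ := norm_pos_iff.2 hy0
        have : 0 < min 1 (1 / ‖y‖) := lt_min one_pos (by positivity)
        have := (mul_eq_zero.1 hy).resolve_right this.ne'
        rcases div_eq_zero_iff.1 this with h | h
        · exact h
        · exact absurd h (by positivity)
      ext x
      unfold phiF
      rw [integral_eq_zero_of_ae]
      · simp
      · filter_upwards [hρ] with y hy
        simp [hy]
    · exact h
  have hCpos : 0 < ∫ y, rhoF f y / (4 * π) := by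
    have := hub 1 zero_le_one
    linarith
  refine ⟨∫ y, rhoF f y / (4 * π), G 1, hCpos, hc, ?_, ?_, ?_⟩
  · refine ⟨convex_Ioi 0, ?_⟩
    intro x hx y hy a b ha hb hab
    have hx0 : (0:ℝ) < x := hx
    have hy0 : (0:ℝ) < y := hy
    have hxy : 0 < a • x + b • y := (convex_Ioi (0:ℝ)) hx hy ha hb hab
    simp only
    rw [hphi _ (inv_pos.2 hx0), hphi _ (inv_pos.2 hy0), hphi _ (inv_pos.2 hxy)]
    simp only [one_div, inv_inv, smul_eq_mul] at hxy ⊢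
    have : a * G x + b * G y ≤ G (a * x + b * y) := by
      simp only [hG]
      rw [← integral_const_mul, ← integral_const_mul,
        ← integral_add ((hGi x hx0.le).const_mul a) ((hGi y hy0.le).const_mul b)]
      refine integral_mono (((hGi x hx0.le).const_mul a).add ((hGi y hy0.le).const_mul b))
        (hGi _ hxy.le) fun w => ?_
      simp only [Pi.add_apply]
      have : a * min x (1 / ‖w‖) + b * min y (1 / ‖w‖) ≤ min (a * x + b * y) (1 / ‖w‖) := by
        apply le_min
        · gcongr
          · exact min_le_left _ _
          · exact min_le_left _ _
        · calc _ ≤ a * (1 / ‖w‖) + b * (1 / ‖w‖) := by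
                gcongr
                · exact min_le_right _ _
                · exact min_le_right _ _
            _ = 1 / ‖w‖ := by rw [← add_mul, hab, one_mul]
      have := mul_le_mul_of_nonneg_left this (hn' w)
      linarith
    linarith
  · intro r hr
    rw [hphi r hr]
    have := hub (1 / r) (by positivity)
    rw [mul_one_div] at this
    linarith
  · intro r hr
    have hr0 : 0 < r := by linarith
    rw [hphi r hr0]
    have : G 1 / r ≤ G (1 / r) := by
      simp only [hG]
      rw [← integral_div]
      refine integral_mono ((hGi 1 zero_le_one).div_const r) (hGi _ (by positivity)) fun w => ?_
      simp only
      rw [mul_div_assoc]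
      refine mul_le_mul_of_nonneg_left ?_ (hn' w)
      rw [div_le_iff₀ hr0, min_mul_of_nonneg _ _ hr0.le]
      apply le_min
      · rw [one_div_mul_cancel hr0.ne']; exact min_le_left _ _
      · refine (min_le_right _ _).trans ?_
        exact le_mul_of_one_le_right (by positivity) hr
    linarith

/-- Differentiability of `λ ↦ a_{φ+λh}^{-1}(s,ℓ)` with explicit derivative. -/
theorem stmt11 (f g : Phase → ℝ) (hf : memErad f) (hg : memErad g)
    (hf0 : phiF f ≠ 0) (hg0 : phiF g ≠ 0)
    (ℓ s : ℝ) (hℓ : 0 < ℓ) (hs : 0 < s) :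
    ∀ lam ∈ Icc (0:ℝ) 1,
      HasDerivWithinAt (fun μ : ℝ => aPotInv (combPot f g μ) s ℓ)
        ((∫ r in
            (r1Pot (combPot f g lam) (aPotInv (combPot f g lam) s ℓ) ℓ)..(r2Pot
              (combPot f g lam) (aPotInv (combPot f g lam) s ℓ) ℓ),
            (phiRad g r - phiRad f r) /
              Real.sqrt (aPotInv (combPot f g lam) s ℓ - psiPot (combPot f g lam) ℓ r)) /
          (∫ r in
            (r1Pot (combPot f g lam) (aPotInv (combPot f g lam) s ℓ) ℓ)..(r2Pot
              (combPot f g lam) (aPotInv (combPot f g lam) s ℓ) ℓ),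
            1 / Real.sqrt (aPotInv (combPot f g lam) s ℓ - psiPot (combPot f g lam) ℓ r)))
        (Icc 0 1) lam := by
  obtain ⟨C1, c1, h1⟩ := good_phi hf hf0
  obtain ⟨C2, c2, h2⟩ := good_phi hg hg0
  have h1' := h1.mono (le_max_left C1 C2) (min_le_left c1 c2) (lt_min h1.hc h2.hc)
  have h2' := h2.mono (le_max_right C1 C2) (min_le_right c1 c2) (lt_min h1.hc h2.hc)
  intro lam hl
  exact main_abs h1' h2' hℓ hs (combPot f g) (fun _ _ => rfl) lam hl
end
end

section
/- Let f, g ∈ L¹ ∩ L∞(ℝ⁶) be nonnegative and spherically symmetric. Then for a.e. ℓ > 0: the function t ↦ f^*(t,ℓ) is nonincreasing on [0,∞) and μ_f(t,ℓ) equals the Lebesgue measure of {s > 0 : f^*(s,ℓ) > t} for every t ≥ 0. Moreover |f^*|_{L^p((0,∞)×(0,∞), ds dℓ)} = |f|_{L^p(ℝ⁶)} for every p ∈ [1,∞], and |f^* − g^*|_{L¹((0,∞)×(0,∞))} ≤ |f − g|_{L¹(ℝ⁶)}. -/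
noncomputable section

open MeasureTheory Real Filter Set Topology
open scoped ENNReal NNReal

def ee (i : Fin 3) : E3 := EuclideanSpace.single i (1:ℝ)

lemma det_refl_aux (w : E3) (hw : w ≠ 0) :
    LinearMap.det ((Submodule.reflection (Submodule.span ℝ {w})ᗮ).toLinearEquiv : E3 →ₗ[ℝ] E3) = -1 := by
  have h := Submodule.det_reflection (𝕜 := ℝ) (K := (Submodule.span ℝ {w})ᗮ)
  rw [Submodule.orthogonal_orthogonal, finrank_span_singleton hw, pow_one] at h
  exact h

lemma rot_exists (x y : E3) (h : ‖x‖ = ‖y‖) (hy : inner ℝ (ee 2) y = 0) :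
    ∃ R : E3 ≃ₗᵢ[ℝ] E3, LinearMap.det (R.toLinearEquiv : E3 →ₗ[ℝ] E3) = 1 ∧ R x = y ∧
      ∀ z : E3, inner ℝ (x - y) z = 0 → inner ℝ (ee 2) z = 0 → R z = z := by
  by_cases hxy : x = y
  · refine ⟨LinearIsometryEquiv.refl ℝ E3, ?_, by simpa using hxy, by simp⟩
    exact LinearMap.det_id
  · have h1 : x - y ≠ 0 := sub_ne_zero.2 hxy
    have h2 : ee 2 ≠ 0 := by simp [ee]
    refine ⟨(Submodule.reflection (Submodule.span ℝ {x - y})ᗮ).trans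
      (Submodule.reflection (Submodule.span ℝ {ee 2})ᗮ), ?_, ?_, ?_⟩
    · have : ((((Submodule.reflection (Submodule.span ℝ {x - y})ᗮ).trans
        (Submodule.reflection (Submodule.span ℝ {ee 2})ᗮ)).toLinearEquiv : E3 ≃ₗ[ℝ] E3) : E3 →ₗ[ℝ] E3)
        = ((Submodule.reflection (Submodule.span ℝ {ee 2})ᗮ).toLinearEquiv : E3 →ₗ[ℝ] E3) ∘ₗ
          ((Submodule.reflection (Submodule.span ℝ {x - y})ᗮ).toLinearEquiv : E3 →ₗ[ℝ] E3) := rfl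
      rw [this, LinearMap.det_comp, det_refl_aux _ h1, det_refl_aux _ h2]; norm_num
    · rw [LinearIsometryEquiv.trans_apply, Submodule.reflection_sub h]
      exact Submodule.reflection_mem_subspace_eq_self (Submodule.mem_orthogonal_singleton_iff_inner_right.2 hy)
    · intro z hz hz2
      rw [LinearIsometryEquiv.trans_apply, Submodule.reflection_mem_subspace_eq_self
          (Submodule.mem_orthogonal_singleton_iff_inner_right.2 hz)]
      exact Submodule.reflection_mem_subspace_eq_self (Submodule.mem_orthogonal_singleton_iff_inner_right.2 hz2)

lemma lint_norm (G : ℝ → ℝ≥0∞) (hG : Measurable G) :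
    ∫⁻ x : E3, G ‖x‖ = ENNReal.ofReal (4 * π) * ∫⁻ r in Ioi (0:ℝ), ENNReal.ofReal (r ^ 2) * G r := by
  calc
    ∫⁻ x : E3, G ‖x‖ = ∫⁻ x : ({(0)}ᶜ : Set E3), G (‖x.1‖) ∂((volume : Measure E3).comap (↑)) := by
      rw [lintegral_subtype_comap (measurableSet_singleton _).compl fun x : E3 ↦ G (‖x‖),
        restrict_compl_singleton]
    _ = ∫⁻ x, G x.2 ∂(volume : Measure E3).toSphere.prod (.volumeIoiPow (Module.finrank ℝ E3 - 1)) := by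
      simpa using (volume : Measure E3).measurePreserving_homeomorphUnitSphereProd.lintegral_comp_emb
        (Homeomorph.measurableEmbedding _) (G ∘ Subtype.val ∘ Prod.snd)
    _ = (volume : Measure E3).toSphere univ * ∫⁻ x : Ioi (0 : ℝ), G x ∂.volumeIoiPow (Module.finrank ℝ E3 - 1) := by
      rw [lintegral_prod _ (by fun_prop)]
      simp only [lintegral_const]
      rw [mul_comm]
    _ = _ := by
      rw [Measure.toSphere_apply_univ, EuclideanSpace.volume_ball_fin_three]
      simp only [finrank_euclideanSpace, Fintype.card_fin]
      congr 1
      · rw [show ((3:ℕ):ℝ≥0∞) = ENNReal.ofReal 3 by simp,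
          ENNReal.ofReal_one, one_pow, one_mul, ← ENNReal.ofReal_mul (by norm_num)]
        congr 1; ring
      · rw [Measure.volumeIoiPow, lintegral_withDensity_eq_lintegral_mul _ (by fun_prop) (by fun_prop)]
        exact lintegral_subtype_comap measurableSet_Ioi (fun r : ℝ => ENNReal.ofReal (r^2) * G r)

lemma lint_E3 (H : E3 → ℝ≥0∞) (hH : Measurable H) :
    ∫⁻ v, H v = ∫⁻ a : ℝ, ∫⁻ q : ℝ × ℝ, H (a • ee 0 + q.1 • ee 1 + q.2 • ee 2) := by
  have h1 := (PiLp.volume_preserving_toLp (Fin 3)).lintegral_comp hH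
  have h2 := ((volume_preserving_piFinSuccAbove (fun _ : Fin 3 => ℝ) 0).symm).lintegral_comp_emb
    (MeasurableEquiv.measurableEmbedding _) (fun x => H (WithLp.toLp 2 x))
  rw [← h1, ← h2, Measure.volume_eq_prod, lintegral_prod]
  · refine lintegral_congr fun a => ?_
    have h3 := ((volume_preserving_finTwoArrow ℝ).symm).lintegral_comp_emb
      (MeasurableEquiv.measurableEmbedding _) 
       (fun y => H (WithLp.toLp 2 ((MeasurableEquiv.piFinSuccAbove (fun _ : Fin 3 => ℝ) 0).symm (a, y))))
    rw [← h3]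
    refine lintegral_congr fun q => ?_
    congr 1
    ext i
    fin_cases i <;> simp [ee, MeasurableEquiv.piFinSuccAbove, MeasurableEquiv.finTwoArrow, Fin.insertNthEquiv, Fin.insertNth_zero', Fin.cons]
    all_goals rfl
  · refine Measurable.aemeasurable ?_
    exact hH.comp ((WithLp.measurable_toLp 2 _).comp (MeasurableEquiv.measurable _))

lemma lint_V (H : E3 → ℝ≥0∞) (hH : Measurable H)
    (hs : ∀ a b c : ℝ, H (a • ee 0 + b • ee 1 + c • ee 2) = H (a • ee 0 + √(b^2+c^2) • ee 1)) :
    ∫⁻ v, H v = ENNReal.ofReal (2 * π) * ∫⁻ a : ℝ, ∫⁻ ρ in Ioi (0:ℝ), ENNReal.ofReal ρ * H (a • ee 0 + ρ • ee 1) := by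
  have hm : Measurable (fun q : ℝ × ℝ => ENNReal.ofReal q.2 * H (q.1 • ee 0 + q.2 • ee 1)) := by
    fun_prop
  rw [lint_E3 H hH, ← lintegral_const_mul _ (hm.lintegral_prod_right')]
  refine lintegral_congr fun a => ?_
  rw [← lintegral_comp_polarCoord_symm, polarCoord_target, Measure.volume_eq_prod, ← Measure.prod_restrict,
    lintegral_prod_symm _ (by simp only [polarCoord_symm_apply, smul_eq_mul]; fun_prop)]
  rw [show (∫⁻ y in Ioo (-π) π, ∫⁻ x in Ioi (0:ℝ), ENNReal.ofReal x •
     H (a • ee 0 + (polarCoord.symm (x,y)).1 • ee 1 + (polarCoord.symm (x,y)).2 • ee 2)) = 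
     ∫⁻ y in Ioo (-π) π, ∫⁻ x in Ioi (0:ℝ), ENNReal.ofReal x * H (a • ee 0 + x • ee 1) from ?_]
  · simp only [lintegral_const, Measure.restrict_apply MeasurableSet.univ, univ_inter, Real.volume_Ioo]
    rw [mul_comm]; congr 2; ring
  · refine lintegral_congr fun y => setLIntegral_congr_fun measurableSet_Ioi fun x hx => ?_
    simp only [polarCoord_symm_apply, smul_eq_mul]
    rw [hs]
    congr 5
    rw [show (x * Real.cos y)^2 + (x * Real.sin y)^2 = x^2 * (Real.cos y ^2 + Real.sin y^2) by ring]
    rw [Real.cos_sq_add_sin_sq, mul_one, Real.sqrt_sq (le_of_lt hx)]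

lemma lint_CL (r : ℝ) (hr : 0 < r) (h : ℝ → ℝ≥0∞) :
    ∫⁻ ρ in Ioi (0:ℝ), ENNReal.ofReal ρ * h ρ =
      ∫⁻ ℓ in Ioi (0:ℝ), ENNReal.ofReal (1 / (2 * r^2)) * h (√ℓ / r) := by
  have him : (fun ℓ => √ℓ / r) '' Ioi 0 = Ioi 0 := by
    ext y
    constructor
    · rintro ⟨x, hx, rfl⟩
      exact div_pos (Real.sqrt_pos.2 hx) hr
    · intro hy
      refine ⟨(r*y)^2, pow_pos (mul_pos hr hy) 2, ?_⟩
      simp only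
      rw [Real.sqrt_sq (mul_pos hr hy).le]
      field_simp
  have hinj : InjOn (fun ℓ => √ℓ / r) (Ioi 0) := by
    intro x hx y hy hxy
    simp only at hxy
    rw [div_left_inj' hr.ne'] at hxy
    exact (Real.sqrt_inj (le_of_lt hx) (le_of_lt hy)).1 hxy
  have hd : ∀ x ∈ Ioi (0:ℝ), HasDerivWithinAt (fun ℓ => √ℓ / r) (1 / (2 * √x) / r) (Ioi 0) x := by
    intro x hx
    exact ((Real.hasDerivAt_sqrt (ne_of_gt hx)).div_const r).hasDerivWithinAt
  have := lintegral_image_eq_lintegral_abs_deriv_mul measurableSet_Ioi hd hinj (fun ρ => ENNReal.ofReal ρ * h ρ)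
  rw [him] at this
  rw [this]
  refine setLIntegral_congr_fun measurableSet_Ioi fun x hx => ?_
  have hx' : 0 < √x := Real.sqrt_pos.2 hx
  rw [← mul_assoc, ← ENNReal.ofReal_mul (abs_nonneg _), abs_of_pos (by positivity)]
  congr 2
  field_simp

lemma lint_CA (r ℓ : ℝ) (hr : 0 < r) (hℓ : 0 < ℓ) (h : ℝ → ℝ≥0∞) :
    ∫⁻ a, h a = ∫⁻ u in {u : ℝ | ℓ < r^2*u^2}, ENNReal.ofReal (r * |u| / √(r^2*u^2-ℓ)) *
      h (Real.sign u * √(r^2*u^2-ℓ) / r) := by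
  set S := {u : ℝ | ℓ < r^2*u^2} with hS
  have hSo : IsOpen S := isOpen_lt (by fun_prop) (by fun_prop)
  have hne : ∀ u ∈ S, u ≠ 0 := by
    rintro u hu rfl
    simp [hS] at hu; linarith
  have hsq : ∀ u ∈ S, 0 < √(r^2*u^2-ℓ) := fun u hu => Real.sqrt_pos.2 (sub_pos.2 hu)
  have him : (fun u => Real.sign u * √(r^2*u^2-ℓ) / r) '' S = {0}ᶜ := by
    ext y
    constructor
    · rintro ⟨x, hx, rfl⟩
      have := hsq x hx
      have h2 : Real.sign x ≠ 0 := by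
        rw [Ne, Real.sign_eq_zero_iff]; exact hne x hx
      simp only [mem_compl_iff, mem_singleton_iff]
      positivity
    · intro hy
      have hy : y ≠ 0 := hy
      have hp : 0 < √(r^2*y^2+ℓ)/r := by positivity
      have hval : r^2*(√(r^2*y^2+ℓ)/r)^2 = r^2*y^2+ℓ := by
        rw [div_pow, Real.sq_sqrt (by positivity)]; field_simp
      rcases lt_or_gt_of_ne hy with hy | hy
      · refine ⟨-(√(r^2*y^2+ℓ)/r), ?_, ?_⟩
        · simp only [hS, mem_ofPred_eq, neg_sq]; rw [hval]
          have : 0 < r^2*y^2 := by have := hy.ne; positivity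
          linarith
        · simp only [neg_sq]; rw [hval, Real.sign_of_neg (by linarith)]
          rw [show r^2*y^2+ℓ-ℓ = (r*(-y))^2 by ring, Real.sqrt_sq (mul_nonneg hr.le (by linarith))]
          field_simp
      · refine ⟨(√(r^2*y^2+ℓ)/r), ?_, ?_⟩
        · simp only [hS, mem_ofPred_eq]; rw [hval]
          have : 0 < r^2*y^2 := by positivity
          linarith
        · simp only; rw [hval, Real.sign_of_pos (by linarith)]
          rw [show r^2*y^2+ℓ-ℓ = (r*y)^2 by ring, Real.sqrt_sq (by positivity)]
          field_simp
  have hinj : InjOn (fun u => Real.sign u * √(r^2*u^2-ℓ) / r) S := by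
    intro x hx y hy hxy
    simp only at hxy
    rw [div_left_inj' hr.ne'] at hxy
    have h1 := hsq x hx
    have h2 := hsq y hy
    have key : √(r^2*x^2-ℓ) = √(r^2*y^2-ℓ) → x^2 = y^2 := by
      intro hh
      rw [Real.sqrt_inj (sub_nonneg.2 (le_of_lt hx)) (sub_nonneg.2 (le_of_lt hy))] at hh
      have : r^2 * x^2 = r^2*y^2 := by linarith
      exact mul_left_cancel₀ (by positivity) this
    rcases lt_or_gt_of_ne (hne x hx) with hx0 | hx0 <;> rcases lt_or_gt_of_ne (hne y hy) with hy0 | hy0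
    · rw [Real.sign_of_neg hx0, Real.sign_of_neg hy0] at hxy
      have := key (by linarith)
      nlinarith
    · rw [Real.sign_of_neg hx0, Real.sign_of_pos hy0] at hxy
      linarith
    · rw [Real.sign_of_pos hx0, Real.sign_of_neg hy0] at hxy
      linarith
    · rw [Real.sign_of_pos hx0, Real.sign_of_pos hy0] at hxy
      have := key (by linarith)
      nlinarith
  have hd : ∀ x ∈ S, HasDerivWithinAt (fun u => Real.sign u * √(r^2*u^2-ℓ) / r)
      (r * |x| / √(r^2*x^2-ℓ)) S x := by
    intro x hx
    refine HasDerivAt.hasDerivWithinAt ?_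
    have h1 := hsq x hx
    have hb : HasDerivAt (fun u => √(r^2*u^2-ℓ)) ((r^2*(2*x)) / (2 * √(r^2*x^2-ℓ))) x := by
      refine HasDerivAt.sqrt ?_ (sub_pos.2 hx).ne'
      have := ((hasDerivAt_pow 2 x).const_mul (r^2)).sub_const ℓ
      simpa using this
    rcases lt_or_gt_of_ne (hne x hx) with hx0 | hx0
    · have h3 : HasDerivAt (fun u => (-1) * √(r^2*u^2-ℓ) / r) (r * |x| / √(r^2*x^2-ℓ)) x := by
        have h4 := (hb.const_mul (-1)).div_const r
        have h5 : (-1) * (r^2*(2*x) / (2 * √(r^2*x^2-ℓ))) / r = r * |x| / √(r^2*x^2-ℓ) := by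
          rw [abs_of_neg hx0]; field_simp
        rw [h5] at h4
        exact h4
      refine h3.congr_of_eventuallyEq ?_
      filter_upwards [Iio_mem_nhds hx0] with u hu
      rw [Real.sign_of_neg hu]
    · have h3 : HasDerivAt (fun u => 1 * √(r^2*u^2-ℓ) / r) (r * |x| / √(r^2*x^2-ℓ)) x := by
        have h4 := (hb.const_mul (1)).div_const r
        have h5 : (1) * (r^2*(2*x) / (2 * √(r^2*x^2-ℓ))) / r = r * |x| / √(r^2*x^2-ℓ) := by
          rw [abs_of_pos hx0]; field_simp
        rw [h5] at h4
        exact h4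
      refine h3.congr_of_eventuallyEq ?_
      filter_upwards [Ioi_mem_nhds hx0] with u hu
      rw [Real.sign_of_pos hu]
  have := lintegral_image_eq_lintegral_abs_deriv_mul hSo.measurableSet hd hinj h
  rw [him, restrict_compl_singleton] at this
  rw [this]
  refine setLIntegral_congr_fun hSo.measurableSet fun x hx => ?_
  have := hsq x hx
  rw [abs_of_nonneg (by positivity)]

lemma inner_ee (i j : Fin 3) : inner ℝ (ee i) (ee j) = if i = j then (1:ℝ) else 0 := by
  simp [ee, EuclideanSpace.inner_single_left]

lemma meas_sign : Measurable Real.sign := by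
  have : Real.sign = fun r : ℝ => if r < 0 then (-1:ℝ) else if 0 < r then 1 else 0 := by
    funext r; rfl
  rw [this]
  exact Measurable.ite measurableSet_Iio measurable_const
    (Measurable.ite measurableSet_Ioi measurable_const measurable_const)

lemma meas_radPoint : Measurable (fun q : (ℝ × ℝ) × ℝ => radPoint q.1.1 q.1.2 q.2) := by
  unfold radPoint
  have := meas_sign
  refine Measurable.prodMk (by fun_prop) ?_
  refine Measurable.add (Measurable.smul_const ?_ _) (Measurable.smul_const (by fun_prop) _)
  exact ((this.comp (by fun_prop)).mul (by fun_prop)).div (by fun_prop)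

lemma meas_nuDens : Measurable (fun q : (ℝ × ℝ) × ℝ => nuDens q.2 q.1) := by
  unfold nuDens
  refine Measurable.ite ?_ (by fun_prop) measurable_const
  have h1 : MeasurableSet {q : (ℝ × ℝ) × ℝ | 0 < q.1.1} :=
    measurableSet_lt measurable_const (by fun_prop)
  have h2 : MeasurableSet {q : (ℝ × ℝ) × ℝ | q.2 < q.1.1 ^ 2 * q.1.2 ^ 2} :=
    measurableSet_lt (by fun_prop) (by fun_prop)
  exact h1.inter h2

theorem disint (F : Phase → ℝ≥0∞) (hF : Measurable F)
    (hs : ∀ R : E3 ≃ₗᵢ[ℝ] E3, LinearMap.det (R.toLinearEquiv : E3 →ₗ[ℝ] E3) = 1 →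
    ∀ z : Phase, F (R z.1, R z.2) = F z) :
    ∫⁻ z, F z = ∫⁻ ℓ in Ioi (0:ℝ), ∫⁻ p : ℝ × ℝ, nuDens ℓ p * F (radPoint p.1 p.2 ℓ) := by
  -- step 1
  have hG : ∀ x : E3, ∫⁻ v, F (x, v) = ∫⁻ v, F (‖x‖ • ee 0, v) := by
    intro x
    obtain ⟨R, hR, hx, -⟩ := rot_exists x (‖x‖ • ee 0) (by simp [norm_smul, ee])
      (by simp [inner_ee, inner_smul_right])
    have := (R.measurePreserving).lintegral_comp (f := fun v => F (‖x‖ • ee 0, v)) (by fun_prop)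
    rw [← this]
    refine lintegral_congr fun v => ?_
    rw [← hs R hR (x, v)]
    simp only [hx]
  have hGm : Measurable (fun r : ℝ => ∫⁻ v, F (r • ee 0, v)) := by
    refine Measurable.lintegral_prod_right' (f := fun q : ℝ × E3 => F (q.1 • ee 0, q.2)) ?_
    fun_prop
  rw [Measure.volume_eq_prod, lintegral_prod _ hF.aemeasurable, lintegral_congr hG,
    lint_norm _ hGm]
  -- step 2
  have hV : ∀ r ∈ Ioi (0:ℝ), ENNReal.ofReal (4 * π) * (ENNReal.ofReal (r^2) * ∫⁻ v, F (r • ee 0, v))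
      = ∫⁻ ℓ in Ioi (0:ℝ), ∫⁻ u, nuDens ℓ (r, u) * F (radPoint r u ℓ) := by
    intro r hr
    have hr : 0 < r := hr
    rw [lint_V (fun v => F (r • ee 0, v)) (by fun_prop)]
    swap
    · intro a b c
      obtain ⟨R, hR, hx, hfix⟩ := rot_exists (a • ee 0 + b • ee 1 + c • ee 2)
        (a • ee 0 + √(b^2+c^2) • ee 1)
        (by 
          simp only [EuclideanSpace.norm_eq, Fin.sum_univ_three]
          have : 0 ≤ b^2 + c^2 := by positivity
          simp [ee, Real.sq_sqrt this, add_assoc])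
        (by simp [inner_ee, inner_add_right, inner_smul_right])
      rw [← hs R hR (r • ee 0, _)]
      simp only
      rw [hx, map_smul, hfix]
      · simp [inner_ee, inner_add_left, inner_sub_left, inner_smul_left]
      · simp [inner_ee]
    rw [lintegral_lintegral_swap (by fun_prop)]
    have hin : ∀ ρ : ℝ, ∫⁻ a : ℝ, ENNReal.ofReal ρ * F (r • ee 0, a • ee 0 + ρ • ee 1) = 
       ENNReal.ofReal ρ * ∫⁻ a : ℝ, F (r • ee 0, a • ee 0 + ρ • ee 1) := fun ρ => 
      lintegral_const_mul _ (hF.comp (Continuous.measurable (by fun_prop)))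
    simp_rw [hin]
    rw [lint_CL r hr (fun ρ => ∫⁻ a : ℝ, F (r • ee 0, a • ee 0 + ρ • ee 1))]
    have hmm : Measurable (fun ℓ : ℝ => ∫⁻ a : ℝ, F (r • ee 0, a • ee 0 + (√ℓ / r) • ee 1)) := by
      refine Measurable.lintegral_prod_right' (f := fun q : ℝ × ℝ => F (r • ee 0, q.2 • ee 0 + (√q.1 / r) • ee 1)) ?_
      fun_prop
    rw [lintegral_const_mul _ hmm, ← mul_assoc, ← mul_assoc, ← mul_assoc,
      ← ENNReal.ofReal_mul (by positivity), ← ENNReal.ofReal_mul (by positivity),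
      ← ENNReal.ofReal_mul (by positivity), ← lintegral_const_mul _ hmm]
    refine setLIntegral_congr_fun measurableSet_Ioi fun ℓ hℓ => ?_
    have hℓ : 0 < ℓ := hℓ
    have hSm : MeasurableSet {u : ℝ | ℓ < r^2*u^2} := measurableSet_lt (by fun_prop) (by fun_prop)
    rw [lint_CA r ℓ hr hℓ, ← lintegral_const_mul' _ _ ENNReal.ofReal_ne_top, ← lintegral_indicator hSm]
    refine lintegral_congr fun u => ?_
    by_cases hu : ℓ < r^2*u^2
    · rw [indicator_of_mem (show u ∈ {u : ℝ | ℓ < r^2*u^2} from hu)]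
      rw [nuDens, if_pos ⟨hr, hu⟩, ← mul_assoc, ← ENNReal.ofReal_mul (by positivity)]
      congr 2
      field_simp
    · rw [indicator_of_notMem (show u ∉ {u : ℝ | ℓ < r^2*u^2} from hu)]
      rw [nuDens, if_neg (fun h => hu h.2), zero_mul]
  have hM : Measurable (fun q : (ℝ × ℝ) × ℝ => nuDens q.2 q.1 * F (radPoint q.1.1 q.1.2 q.2)) :=
    meas_nuDens.mul (hF.comp meas_radPoint)
  rw [← lintegral_const_mul' _ _ ENNReal.ofReal_ne_top, setLIntegral_congr_fun measurableSet_Ioi hV,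
    lintegral_lintegral_swap]
  · refine lintegral_congr fun ℓ => ?_
    rw [Measure.volume_eq_prod, lintegral_prod]
    · rw [← lintegral_indicator measurableSet_Ioi]
      refine lintegral_congr fun r => ?_
      by_cases hr : 0 < r
      · rw [indicator_of_mem (show r ∈ Ioi 0 from hr)]
      · rw [indicator_of_notMem (show r ∉ Ioi 0 from hr)]
        simp [nuDens, hr]
    · exact (hM.comp (measurable_id.prodMk measurable_const)).aemeasurable
  · refine Measurable.aemeasurable ?_
    refine Measurable.lintegral_prod_right' (f := fun q : (ℝ × ℝ) × ℝ => 
      nuDens q.1.2 (q.1.1, q.2) * F (radPoint q.1.1 q.2 q.1.2)) ?_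
    exact hM.comp (g := fun q : (ℝ × ℝ) × ℝ => nuDens q.2 q.1 * F (radPoint q.1.1 q.1.2 q.2))
      (f := fun q : (ℝ × ℝ) × ℝ => ((q.1.1, q.2), q.1.2)) (by fun_prop)

theorem disint_set (A : Set Phase) (hA : MeasurableSet A)
    (hs : ∀ R : E3 ≃ₗᵢ[ℝ] E3, LinearMap.det (R.toLinearEquiv : E3 →ₗ[ℝ] E3) = 1 →
    ∀ z : Phase, (R z.1, R z.2) ∈ A ↔ z ∈ A) :
    volume A = ∫⁻ ℓ in Ioi (0:ℝ), nuMeas ℓ {p | radPoint p.1 p.2 ℓ ∈ A} := by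
  rw [← lintegral_indicator_one hA, disint _ (measurable_one.indicator hA)]
  · refine lintegral_congr fun ℓ => ?_
    have h1 : MeasurableSet {p : ℝ × ℝ | radPoint p.1 p.2 ℓ ∈ A} :=
      (meas_radPoint.comp (measurable_id.prodMk measurable_const)) hA
    rw [nuMeas, withDensity_apply _ h1, ← lintegral_indicator h1]
    refine lintegral_congr fun p => ?_
    by_cases hp : radPoint p.1 p.2 ℓ ∈ A
    · rw [indicator_of_mem hp, indicator_of_mem (show p ∈ {p : ℝ × ℝ | radPoint p.1 p.2 ℓ ∈ A} from hp)]; simp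
    · rw [indicator_of_notMem hp, indicator_of_notMem (show p ∉ {p : ℝ × ℝ | radPoint p.1 p.2 ℓ ∈ A} from hp)]; simp
  · intro R hR z
    have := hs R hR z
    by_cases hz : z ∈ A
    · rw [indicator_of_mem hz, indicator_of_mem (this.2 hz)]; rfl
    · rw [indicator_of_notMem hz, indicator_of_notMem (fun h => hz (this.1 h))]

lemma meas_nuSet (A : Set Phase) (hA : MeasurableSet A) :
    Measurable (fun ℓ => nuMeas ℓ {p | radPoint p.1 p.2 ℓ ∈ A}) := by
  have : ∀ ℓ, nuMeas ℓ {p | radPoint p.1 p.2 ℓ ∈ A} =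
      ∫⁻ p, ((fun q : (ℝ × ℝ) × ℝ => radPoint q.1.1 q.1.2 q.2) ⁻¹' A).indicator
        (fun q : (ℝ × ℝ) × ℝ => nuDens q.2 q.1) (p, ℓ) := by
    intro ℓ
    have h1 : MeasurableSet {p : ℝ × ℝ | radPoint p.1 p.2 ℓ ∈ A} :=
      (meas_radPoint.comp (measurable_id.prodMk measurable_const)) hA
    rw [nuMeas, withDensity_apply _ h1, ← lintegral_indicator h1]
    rfl
  simp_rw [this]
  exact Measurable.lintegral_prod_left' (meas_nuDens.indicator (meas_radPoint hA))

lemma muDist_anti (f : Phase → ℝ) (ℓ : ℝ) {s t : ℝ} (h : s ≤ t) : muDist f t ℓ ≤ muDist f s ℓ :=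
  measure_mono fun _ hp => lt_of_le_of_lt h hp

lemma muDist_rc (f : Phase → ℝ) (ℓ s : ℝ) :
    muDist f s ℓ = ⨆ n : ℕ, muDist f (s + 1 / ((n:ℝ) + 1)) ℓ := by
  unfold muDist
  rw [← Monotone.measure_iUnion]
  · congr 1
    ext p
    simp only [mem_iUnion]
    constructor
    · intro h
      have h : s < f (radPoint p.1 p.2 ℓ) := h
      obtain ⟨n, hn⟩ := exists_nat_one_div_lt (sub_pos.2 h)
      refine ⟨n, ?_⟩
      show s + 1 / ((n:ℝ) + 1) < f (radPoint p.1 p.2 ℓ)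
      linarith
    · rintro ⟨n, hn⟩
      have hn : s + 1 / ((n:ℝ) + 1) < f (radPoint p.1 p.2 ℓ) := hn
      have : 0 < 1 / ((n:ℝ) + 1) := by positivity
      show s < f (radPoint p.1 p.2 ℓ)
      linarith
  · intro m n hmn p hp
    have hp : s + 1 / ((m:ℝ) + 1) < f (radPoint p.1 p.2 ℓ) := hp
    have := one_div_le_one_div_of_le (by positivity : (0:ℝ) < (m:ℝ)+1)
      (add_le_add (Nat.cast_le.2 hmn) le_rfl : (m:ℝ)+1 ≤ (n:ℝ)+1)
    show s + 1 / ((n:ℝ) + 1) < f (radPoint p.1 p.2 ℓ)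
    linarith

lemma schwarz_nonneg (f : Phase → ℝ) (t ℓ : ℝ) : 0 ≤ schwarz f t ℓ := by
  unfold schwarz
  split_ifs
  · exact Real.sSup_nonneg fun s hs => hs.1
  · exact le_rfl

lemma lt_schwarz {f : Phase → ℝ} {M ℓ : ℝ} (hM : muDist f M ℓ = 0) {s : ℝ} (hs : 0 ≤ s) (t : ℝ) :
    s < schwarz f t ℓ ↔ ENNReal.ofReal t < muDist f s ℓ := by
  have hbdd : BddAbove {s : ℝ | 0 ≤ s ∧ ENNReal.ofReal t < muDist f s ℓ} := by
    refine ⟨M, fun s' hs' => ?_⟩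
    by_contra hc
    have := (hs'.2.trans_le (muDist_anti f ℓ (le_of_lt (not_le.1 hc))))
    rw [hM] at this
    exact not_lt_bot this
  unfold schwarz
  constructor
  · intro h
    split_ifs at h with h0
    · have hne : {s : ℝ | 0 ≤ s ∧ ENNReal.ofReal t < muDist f s ℓ}.Nonempty := ⟨0, le_rfl, h0⟩
      obtain ⟨s', hs', hlt⟩ := exists_lt_of_lt_csSup hne h
      exact hs'.2.trans_le (muDist_anti f ℓ hlt.le)
    · linarith
  · intro h
    rw [if_pos (h.trans_le (muDist_anti f ℓ hs))]
    rw [muDist_rc, lt_iSup_iff] at h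
    obtain ⟨n, hn⟩ := h
    have hp : 0 < 1 / ((n:ℝ) + 1) := by positivity
    refine lt_of_lt_of_le (by linarith : s < s + 1 / ((n:ℝ) + 1)) (le_csSup hbdd ⟨by linarith, hn⟩)

lemma schwarz_mono {f m : Phase → ℝ} {M M' ℓ : ℝ} (hM : muDist f M ℓ = 0) (hM' : muDist m M' ℓ = 0)
    (h : ∀ z, m z ≤ f z) (t : ℝ) : schwarz m t ℓ ≤ schwarz f t ℓ := by
  by_contra hc
  have h1 := (lt_schwarz hM' (schwarz_nonneg f t ℓ) t).1 (not_le.1 hc)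
  have h2 : muDist m (schwarz f t ℓ) ℓ ≤ muDist f (schwarz f t ℓ) ℓ :=
    measure_mono fun p hp => lt_of_lt_of_le hp (h _)
  exact lt_irrefl _ ((lt_schwarz hM (schwarz_nonneg f t ℓ) t).2 (h1.trans_le h2))

lemma vol_aux (c : ℝ≥0∞) : volume {t : ℝ | 0 < t ∧ ENNReal.ofReal t < c} = c := by
  by_cases hc : c = ⊤
  · subst hc
    have : {t : ℝ | 0 < t ∧ ENNReal.ofReal t < ⊤} = Ioi 0 := by
      ext t; simp
    rw [this, Real.volume_Ioi]
  · have : {t : ℝ | 0 < t ∧ ENNReal.ofReal t < c} = Ioo 0 c.toReal := by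
      ext t
      simp only [mem_ofPred_eq, mem_Ioo]
      refine and_congr_right fun ht => ?_
      rw [ENNReal.ofReal_lt_iff_lt_toReal ht.le hc]
    rw [this, Real.volume_Ioo, sub_zero, ENNReal.ofReal_toReal hc]

lemma meas_muDist {f : Phase → ℝ} (hf : Measurable f) (s : ℝ) : Measurable (muDist f s) :=
  meas_nuSet {z | s < f z} (measurableSet_lt measurable_const hf)

lemma vol_eq_muDist {f : Phase → ℝ} (hf : Measurable f) (hs : SphSym f) (s : ℝ) :
    volume {z | s < f z} = ∫⁻ ℓ in Ioi (0:ℝ), muDist f s ℓ := by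
  refine disint_set {z | s < f z} (measurableSet_lt measurable_const hf) fun R hR z => ?_
  simp only [mem_ofPred_eq, hs R hR z]

lemma exists_M {f : Phase → ℝ} (hf : Measurable f) (hs : SphSym f) (hi : eLpNorm f ⊤ volume < ⊤) :
    ∃ M : ℝ, ∀ᵐ ℓ ∂(volume.restrict (Ioi (0:ℝ))), muDist f M ℓ = 0 := by
  refine ⟨(eLpNorm f ⊤ volume).toReal, ?_⟩
  have h : volume {z | (eLpNorm f ⊤ volume).toReal < f z} = 0 := by
    have h1 : ∀ᵐ z, ‖f z‖ₑ ≤ eLpNorm f ⊤ volume := by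
      rw [eLpNorm_exponent_top]; exact ae_le_eLpNormEssSup
    have h2 : ∀ᵐ z, ¬ ((eLpNorm f ⊤ volume).toReal < f z) := by
      filter_upwards [h1] with z hz
      have := (ENNReal.toReal_le_toReal (by simp) hi.ne).2 hz
      rw [toReal_enorm] at this
      exact not_lt.2 ((le_abs_self _).trans this)
    rw [ae_iff] at h2
    simpa using h2
  rw [vol_eq_muDist hf hs, lintegral_eq_zero_iff (meas_muDist hf _)] at h
  exact h

abbrev QQ : Measure (ℝ × ℝ) := volume.restrict ((Ioi (0:ℝ)) ×ˢ (Ioi (0:ℝ)))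

lemma QQ_eq : QQ = (volume.restrict (Ioi (0:ℝ))).prod (volume.restrict (Ioi (0:ℝ))) := by
  rw [QQ, Measure.volume_eq_prod, Measure.prod_restrict]

lemma ae_QQ {P : ℝ → Prop} (h : ∀ᵐ ℓ ∂(volume.restrict (Ioi (0:ℝ))), P ℓ) : ∀ᵐ q ∂QQ, P q.2 := by
  rw [QQ_eq]
  exact Measure.quasiMeasurePreserving_snd.ae h

lemma schwarz_aem {f : Phase → ℝ} (hf : Measurable f) {M : ℝ}
    (hM : ∀ᵐ ℓ ∂(volume.restrict (Ioi (0:ℝ))), muDist f M ℓ = 0) :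
    AEMeasurable (fun q : ℝ × ℝ => schwarz f q.1 q.2) QQ := by
  classical
  refine ⟨fun q => if muDist f M q.2 = 0 then schwarz f q.1 q.2 else 0, ?_, ?_⟩
  · refine measurable_of_Ioi fun a => ?_
    have hm0 : MeasurableSet {q : ℝ × ℝ | muDist f M q.2 = 0} :=
      ((meas_muDist hf M).comp measurable_snd) (measurableSet_singleton 0)
    have hm1 : MeasurableSet {q : ℝ × ℝ | ENNReal.ofReal q.1 < muDist f a q.2} :=
      measurableSet_lt (by fun_prop) ((meas_muDist hf a).comp measurable_snd)
    by_cases ha : a < 0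
    · convert MeasurableSet.univ
      ext q
      simp only [mem_preimage, mem_Ioi, mem_univ, iff_true]
      split_ifs
      · exact ha.trans_le (schwarz_nonneg _ _ _)
      · exact ha
    · convert hm0.inter hm1
      ext q
      simp only [mem_preimage, mem_Ioi, mem_inter_iff, mem_ofPred_eq]
      split_ifs with h
      · simp [h, lt_schwarz h (not_lt.1 ha)]
      · simp [h]; linarith
  · filter_upwards [ae_QQ hM] with q hq
    simp [hq]

lemma schwarz_dist {f : Phase → ℝ} (hf : Measurable f) (hs : SphSym f) {M : ℝ}
    (hM : ∀ᵐ ℓ ∂(volume.restrict (Ioi (0:ℝ))), muDist f M ℓ = 0) {s : ℝ} (h0 : 0 ≤ s) :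
    QQ {q | s < schwarz f q.1 q.2} = volume {z | s < f z} := by
  have h1 : QQ {q | s < schwarz f q.1 q.2} = QQ {q | ENNReal.ofReal q.1 < muDist f s q.2} := by
    refine measure_congr ?_
    filter_upwards [ae_QQ hM] with q hq
    exact propext (lt_schwarz hq h0 q.1)
  have hm1 : MeasurableSet {q : ℝ × ℝ | ENNReal.ofReal q.1 < muDist f s q.2} :=
      measurableSet_lt (by fun_prop) ((meas_muDist hf s).comp measurable_snd)
  rw [h1, QQ_eq, Measure.prod_apply_symm hm1, vol_eq_muDist hf hs]
  refine lintegral_congr fun ℓ => ?_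
  rw [Measure.restrict_apply (hm1.preimage (by fun_prop))]
  conv_rhs => rw [← vol_aux (muDist f s ℓ)]
  congr 1
  ext t
  simp [and_comm]

lemma eLp_eq {α β : Type*} [MeasurableSpace α] [MeasurableSpace β] {μ : Measure α} {ν : Measure β}
    {φ : α → ℝ} {ψ : β → ℝ} (hφ : AEMeasurable φ μ) (hψ : AEMeasurable ψ ν)
    (hφ0 : ∀ x, 0 ≤ φ x) (hψ0 : ∀ x, 0 ≤ ψ x)
    (h : ∀ s : ℝ, 0 ≤ s → μ {x | s < φ x} = ν {x | s < ψ x}) (p : ℝ≥0∞) (hp : 1 ≤ p) :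
    eLpNorm φ p μ = eLpNorm ψ p ν := by
  have hp0 : p ≠ 0 := (lt_of_lt_of_le one_pos hp).ne'
  by_cases hpt : p = ⊤
  · subst hpt
    rw [eLpNorm_exponent_top, eLpNorm_exponent_top, eLpNormEssSup, eLpNormEssSup,
      essSup_eq_sInf, essSup_eq_sInf]
    congr 1
    ext a
    by_cases ha : a = ⊤
    · subst ha; simp
    · have k1 : {x | a < ‖φ x‖ₑ} = {x | a.toReal < φ x} := by
        ext x
        simp only [mem_ofPred_eq]
        rw [Real.enorm_of_nonneg (hφ0 x), ENNReal.lt_ofReal_iff_toReal_lt ha]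
      have k2 : {x | a < ‖ψ x‖ₑ} = {x | a.toReal < ψ x} := by
        ext x
        simp only [mem_ofPred_eq]
        rw [Real.enorm_of_nonneg (hψ0 x), ENNReal.lt_ofReal_iff_toReal_lt ha]
      simp only [mem_ofPred_eq, k1, k2, h _ ENNReal.toReal_nonneg]
  · have hpp : 0 < p.toReal := ENNReal.toReal_pos hp0 hpt
    rw [eLpNorm_eq_lintegral_rpow_enorm_toReal hp0 hpt, eLpNorm_eq_lintegral_rpow_enorm_toReal hp0 hpt]
    congr 1
    have k1 : ∀ x, ‖φ x‖ₑ ^ p.toReal = ENNReal.ofReal (φ x ^ p.toReal) := fun x => by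
      rw [Real.enorm_of_nonneg (hφ0 x), ENNReal.ofReal_rpow_of_nonneg (hφ0 x) hpp.le]
    have k2 : ∀ x, ‖ψ x‖ₑ ^ p.toReal = ENNReal.ofReal (ψ x ^ p.toReal) := fun x => by
      rw [Real.enorm_of_nonneg (hψ0 x), ENNReal.ofReal_rpow_of_nonneg (hψ0 x) hpp.le]
    simp_rw [k1, k2]
    rw [lintegral_rpow_eq_lintegral_meas_lt_mul μ (Eventually.of_forall hφ0) hφ hpp,
      lintegral_rpow_eq_lintegral_meas_lt_mul ν (Eventually.of_forall hψ0) hψ hpp]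
    congr 1
    refine setLIntegral_congr_fun measurableSet_Ioi fun t ht => ?_
    rw [h t (le_of_lt ht)]

lemma schwarz_eLp {f : Phase → ℝ} (hf : Measurable f) (hf0 : ∀ z, 0 ≤ f z) (hs : SphSym f) 
    (hi : eLpNorm f ⊤ volume < ⊤) (p : ℝ≥0∞) (hp : 1 ≤ p) :
    eLpNorm (fun q : ℝ × ℝ => schwarz f q.1 q.2) p QQ = eLpNorm f p volume := by
  obtain ⟨M, hM⟩ := exists_M hf hs hi
  exact eLp_eq (schwarz_aem hf hM) hf.aemeasurable (fun q => schwarz_nonneg _ _ _) hf0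
    (fun s h0 => schwarz_dist hf hs hM h0) p hp

lemma schwarz_int {f : Phase → ℝ} (hf : Measurable f) (hf0 : ∀ z, 0 ≤ f z) (hs : SphSym f) 
    (h1 : eLpNorm f 1 volume < ⊤) (hi : eLpNorm f ⊤ volume < ⊤) :
    Integrable (fun q : ℝ × ℝ => schwarz f q.1 q.2) QQ ∧ 
    ∫ q, schwarz f q.1 q.2 ∂QQ = ∫ z, f z ∧ Integrable f volume := by
  obtain ⟨M, hM⟩ := exists_M hf hs hi
  have ha := schwarz_aem hf hM
  have he := schwarz_eLp hf hf0 hs hi 1 le_rfl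
  refine ⟨memLp_one_iff_integrable.1 ⟨ha.aestronglyMeasurable, he ▸ h1⟩, ?_,
    memLp_one_iff_integrable.1 ⟨hf.aestronglyMeasurable, h1⟩⟩
  rw [eLpNorm_one_eq_lintegral_enorm, eLpNorm_one_eq_lintegral_enorm] at he
  have e1 := integral_norm_eq_lintegral_enorm ha.aestronglyMeasurable
  have e2 := integral_norm_eq_lintegral_enorm (μ := volume) hf.aestronglyMeasurable
  rw [he, ← e2] at e1
  simpa [Real.norm_eq_abs, abs_of_nonneg (schwarz_nonneg _ _ _), abs_of_nonneg (hf0 _)] using e1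

lemma int_abc {α : Type*} [MeasurableSpace α] {μ : Measure α} {a b c : α → ℝ}
    (ha : Integrable a μ) (hb : Integrable b μ) (hc : Integrable c μ) :
    ∫ x, (a x + b x - 2 * c x) ∂μ = (∫ x, a x ∂μ) + (∫ x, b x ∂μ) - 2 * ∫ x, c x ∂μ := by
  have h : Integrable (fun x => a x + b x) μ := ha.add hb
  rw [integral_sub h (hc.const_mul 2), integral_add ha hb, integral_const_mul]

/-- Properties of the Schwarz symmetrization at fixed `ℓ`. -/
theorem stmt12 (f g : Phase → ℝ)
    (hfm : Measurable f) (hgm : Measurable g)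
    (hf1 : eLpNorm f 1 volume < ⊤) (hfi : eLpNorm f ⊤ volume < ⊤)
    (hg1 : eLpNorm g 1 volume < ⊤) (hgi : eLpNorm g ⊤ volume < ⊤)
    (hf0 : ∀ z, 0 ≤ f z) (hg0 : ∀ z, 0 ≤ g z)
    (hfs : SphSym f) (hgs : SphSym g) :
    (∀ᵐ ℓ ∂(volume.restrict (Ioi (0:ℝ))),
      AntitoneOn (fun t => schwarz f t ℓ) (Ici 0) ∧
      ∀ t : ℝ, 0 ≤ t → muDist f t ℓ = volume {s : ℝ | 0 < s ∧ t < schwarz f s ℓ}) ∧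
    (∀ p : ℝ≥0∞, 1 ≤ p →
      eLpNorm (fun q : ℝ × ℝ => schwarz f q.1 q.2) p
          (volume.restrict ((Ioi (0:ℝ)) ×ˢ (Ioi (0:ℝ)))) =
        eLpNorm f p volume) ∧
    (∫ q in (Ioi (0:ℝ)) ×ˢ (Ioi (0:ℝ)), |schwarz f q.1 q.2 - schwarz g q.1 q.2|) ≤
      ∫ z : Phase, |f z - g z| := by
  refine ⟨?_, fun p hp => schwarz_eLp hfm hf0 hfs hfi p hp, ?_⟩
  · obtain ⟨M, hM⟩ := exists_M hfm hfs hfi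
    filter_upwards [hM] with ℓ hℓ
    refine ⟨?_, ?_⟩
    · intro a _ b _ hab
      by_contra hc
      have hc : schwarz f a ℓ < schwarz f b ℓ := not_le.1 hc
      have := (lt_schwarz hℓ (schwarz_nonneg f a ℓ) b).1 hc
      exact lt_irrefl _ ((lt_schwarz hℓ (schwarz_nonneg f a ℓ) a).2
        ((ENNReal.ofReal_le_ofReal hab).trans_lt this))
    · intro t ht
      simp_rw [lt_schwarz hℓ ht]
      exact (vol_aux _).symm
  · set m : Phase → ℝ := fun z => min (f z) (g z) with hm
    have hmm : Measurable m := hfm.min hgm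
    have hm0 : ∀ z, 0 ≤ m z := fun z => le_min (hf0 z) (hg0 z)
    have hms : SphSym m := fun R hR z => by simp only [hm, hfs R hR z, hgs R hR z]
    have hmf : ∀ z, m z ≤ f z := fun z => min_le_left _ _
    have hmg : ∀ z, m z ≤ g z := fun z => min_le_right _ _
    have hle : ∀ p, eLpNorm m p volume ≤ eLpNorm f p volume := fun p => 
      eLpNorm_mono_real fun z => by rw [Real.norm_of_nonneg (hm0 z)]; exact hmf z
    have hm1 := (hle 1).trans_lt hf1
    have hmi := (hle ⊤).trans_lt hfi
    obtain ⟨If, ef, Jf⟩ := schwarz_int hfm hf0 hfs hf1 hfi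
    obtain ⟨Ig, eg, Jg⟩ := schwarz_int hgm hg0 hgs hg1 hgi
    obtain ⟨Im, em, Jm⟩ := schwarz_int hmm hm0 hms hm1 hmi
    obtain ⟨Mf, hMf⟩ := exists_M hfm hfs hfi
    obtain ⟨Mg, hMg⟩ := exists_M hgm hgs hgi
    obtain ⟨Mm, hMm⟩ := exists_M hmm hms hmi
    have step : ∫ q, |schwarz f q.1 q.2 - schwarz g q.1 q.2| ∂QQ ≤
        ∫ q, (schwarz f q.1 q.2 + schwarz g q.1 q.2 - 2 * schwarz m q.1 q.2) ∂QQ := by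
      refine integral_mono_ae (If.sub Ig).abs ((If.add Ig).sub (Im.const_mul 2)) ?_
      filter_upwards [ae_QQ hMf, ae_QQ hMg, ae_QQ hMm] with q h1 h2 h3
      have k1 := schwarz_mono h1 h3 hmf q.1
      have k2 := schwarz_mono h2 h3 hmg q.1
      exact abs_le.2 ⟨by linarith, by linarith⟩
    have e2 : ∫ z, |f z - g z| = (∫ z, f z) + (∫ z, g z) - 2 * ∫ z, m z := by
      rw [← int_abc Jf Jg Jm]
      refine integral_congr_ae (Eventually.of_forall fun z => ?_)
      simp only [hm]
      rcases le_total (f z) (g z) with h | h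
      · rw [min_eq_left h, abs_of_nonpos (by linarith)]; ring
      · rw [min_eq_right h, abs_of_nonneg (by linarith)]; ring
    rw [e2]
    refine step.trans (le_of_eq ?_)
    rw [int_abc If Ig Im, ef, eg, em]
end
end
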